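/- Let R be a commutative Noetherian ring of dimension n ≥ 3, A = R[X₁,…,X_m] a polynomial ring, and P a finitely generated projective A[T]-module of constant rank n. If P/TP contains a unimodular element and P_f contains a unimodular element for some monic polynomial f(T) ∈ A[T] (monic in T), then P contains a unimodular element. -/

import Mathlib

set_option synthInstance.maxHeartbeats 1000000
set_option maxHeartbeats 1000000
set_option linter.unusedSectionVars false
set_option linter.style.haveILetI false

open Matrix

namespace ProjMat

section Conj

variable {ι : Type} [Fintype ι] [DecidableEq ι]

/-- The images of `e₁` and `e₂` are isomorphic, by an isomorphism which is the identity
modulo `𝔟`. -/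
def ConjMod {C : Type} [CommRing C] (𝔟 : Ideal C) (e₁ e₂ : Matrix ι ι C) : Prop :=
  ∃ a b : Matrix ι ι C, e₁ * a = a ∧ a * e₂ = a ∧ e₂ * b = b ∧ b * e₁ = b ∧
    a * b = e₁ ∧ b * a = e₂ ∧ b.map (Ideal.Quotient.mk 𝔟) = e₂.map (Ideal.Quotient.mk 𝔟)

lemma ConjMod.refl {C : Type} [CommRing C] {𝔟 : Ideal C} {e : Matrix ι ι C} (he : e * e = e) :
    ConjMod 𝔟 e e :=
  ⟨e, e, he, he, he, he, he, he, rfl⟩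

lemma ConjMod.trans {C : Type} [CommRing C] {𝔟 : Ideal C} {e₁ e₂ e₃ : Matrix ι ι C}
    (h : ConjMod 𝔟 e₁ e₂) (h' : ConjMod 𝔟 e₂ e₃) : ConjMod 𝔟 e₁ e₃ := by
  obtain ⟨a, b, h1, h2, h3, h4, h5, h6, h7⟩ := h
  obtain ⟨a', b', h1', h2', h3', h4', h5', h6', h7'⟩ := h'
  refine ⟨a * a', b' * b, ?_, ?_, ?_, ?_, ?_, ?_, ?_⟩
  · rw [← mul_assoc, h1]
  · rw [mul_assoc, h2']
  · rw [← mul_assoc, h3']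
  · rw [mul_assoc, h4]
  · rw [mul_assoc, ← mul_assoc a', h5', h3, h5]
  · rw [mul_assoc, ← mul_assoc b, h6, h1', h6']
  · rw [Matrix.map_mul, h7, ← h7', ← Matrix.map_mul, h4']

end Conj

section J

variable {ι : Type} [Fintype ι] [DecidableEq ι] {σ : Type} {R : Type} [CommRing R]

/-- The ideal of all `c` such that moving the point at which `e` is evaluated by multiples
of `c` does not change the isomorphism class of the image of `e`. -/
def J (e : Matrix ι ι (MvPolynomial σ R)) (he : e * e = e) : Ideal R where
  carrier := {c | ∀ (C : Type) [CommRing C] [Algebra R C] (z y : σ → C) (𝔟 : Ideal C),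
    (∀ i, y i ∈ 𝔟) →
      ConjMod 𝔟 (e.map (MvPolynomial.aeval (R := R) z))
        (e.map (MvPolynomial.aeval (R := R) (z + c • y)))}
  zero_mem' := by
    intro C _ _ z y 𝔟 _
    rw [zero_smul, add_zero]
    exact ConjMod.refl (by rw [← Matrix.map_mul, he])
  add_mem' := by
    intro c d hc hd C _ _ z y 𝔟 hy
    have h1 := hc C z y 𝔟 hy
    have h2 := hd C (z + c • y) y 𝔟 hy
    rw [add_assoc, ← add_smul] at h2
    exact h1.trans h2
  smul_mem' := by
    intro r c hc C _ _ z y 𝔟 hy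
    have h1 := hc C z (r • y) 𝔟 (fun i => by
      rw [Pi.smul_apply, Algebra.smul_def]; exact 𝔟.mul_mem_left _ (hy i))
    rwa [smul_smul, mul_comm] at h1

lemma map_mul_self {B C : Type} [CommRing B] [CommRing C] {e : Matrix ι ι B} (he : e * e = e)
    (f : B →+* C) : e.map f * e.map f = e.map f := by
  rw [← Matrix.map_mul, he]

lemma conjMod_of_mem_J [Finite σ] {e : Matrix ι ι (MvPolynomial σ R)} {he : e * e = e}
    {C : Type} [CommRing C] [Algebra R C] (z w : σ → C) (𝔟 : Ideal C)
    (hw : ∀ i, w i ∈ (J e he).map (algebraMap R C) * 𝔟) :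
    ConjMod 𝔟 (e.map (MvPolynomial.aeval (R := R) z))
      (e.map (MvPolynomial.aeval (R := R) (z + w))) := by
  classical
  cases nonempty_fintype σ
  let G : AddSubmonoid (σ → C) :=
    { carrier := {w | ∀ z : σ → C, ConjMod 𝔟 (e.map (MvPolynomial.aeval (R := R) z))
        (e.map (MvPolynomial.aeval (R := R) (z + w)))}
      zero_mem' := by
        intro z
        rw [add_zero]
        exact ConjMod.refl (by rw [← Matrix.map_mul, he])
      add_mem' := by
        intro x y hx hy z
        have := (hx z).trans (hy (z + x))
        rwa [add_assoc] at this }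
  suffices h : w ∈ G from h z
  have key : ∀ i, ∀ x ∈ (J e he).map (algebraMap R C) * 𝔟, Pi.single i x ∈ G := by
    intro i x hx
    refine Submodule.mul_induction_on hx ?_ ?_
    · intro c hc y hy
      unfold Ideal.map at hc
      induction hc using Submodule.span_induction generalizing y with
      | mem x h =>
        obtain ⟨c, hc, rfl⟩ := h
        intro z
        have := hc C z (Pi.single i y) 𝔟 (by
          intro j
          by_cases h : j = i
          · subst h; simpa using hy
          · simp [h])
        rwa [← Pi.single_smul, Algebra.smul_def] at this
      | zero => rw [zero_mul, Pi.single_zero]; exact G.zero_mem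
      | add c d _ _ hc hd => rw [add_mul, Pi.single_add]; exact G.add_mem (hc y hy) (hd y hy)
      | smul r c _ hc =>
        have := hc (r * y) (𝔟.mul_mem_left _ hy)
        rwa [← mul_assoc, mul_comm c] at this
    · intro x y hx hy
      rw [Pi.single_add]; exact G.add_mem hx hy
  rw [← Finset.univ_sum_single w]
  exact G.sum_mem fun i _ => key i _ (hw i)

lemma algebraMap_mem_J {S : Type} [CommRing S] [Algebra R S]
    {e : Matrix ι ι (MvPolynomial σ R)} {he : e * e = e} {c : R} (hc : c ∈ J e he) :
    algebraMap R S c ∈ J (e.map (MvPolynomial.map (algebraMap R S))) (map_mul_self he _) := by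
  intro C _ _ z y 𝔟 hy
  letI : Algebra R C := ((algebraMap S C).comp (algebraMap R S)).toAlgebra
  haveI : IsScalarTower R S C := IsScalarTower.of_algebraMap_eq (fun _ => rfl)
  have := hc C z y 𝔟 hy
  have key : ∀ z : σ → C, (e.map (MvPolynomial.map (algebraMap R S))).map
      (MvPolynomial.aeval (R := S) z) = e.map (MvPolynomial.aeval (R := R) z) := by
    intro z
    ext i j
    simp [MvPolynomial.aeval_map_algebraMap]
  rw [key, key]
  rwa [algebraMap_smul]

end J

section JLoc

variable {ι : Type} [Fintype ι] [DecidableEq ι] {σ : Type} {R : Type} [CommRing R]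

open MvPolynomial

/-- The endomorphism of `R[Z, Y]` with `Y ↦ tY`. -/
noncomputable def scale (σ : Type) {R : Type} [CommRing R] (t : R) :
    MvPolynomial (σ ⊕ σ) R →ₐ[R] MvPolynomial (σ ⊕ σ) R :=
  aeval (Sum.elim (fun i => X (Sum.inl i)) (fun i => C t * X (Sum.inr i)))

@[simp] lemma scale_C (t r : R) : scale σ t (C r) = C r := by simp [scale]

lemma scale_scale (s t : R) (p : MvPolynomial (σ ⊕ σ) R) :
    scale σ s (scale σ t p) = scale σ (s * t) p := by
  have : (scale σ s).comp (scale σ t) = scale σ (s * t) := by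
    apply algHom_ext
    rintro (i | i)
    · simp [scale]
    · simp only [scale, AlgHom.comp_apply, aeval_X, Sum.elim_inr, map_mul, ← algebraMap_eq,
        AlgHom.commutes]
      rw [← mul_assoc, mul_comm (algebraMap _ _ t)]
  rw [← this]; rfl

lemma scale_map {S : Type} [CommRing S] (f : R →+* S) (t : R) (p : MvPolynomial (σ ⊕ σ) R) :
    scale σ (f t) (map f p) = map f (scale σ t p) := by
  induction p using MvPolynomial.induction_on with
  | C r => simp [scale]
  | add p q hp hq => simp [hp, hq]
  | mul_X p i hp =>
    rw [map_mul, map_mul, map_mul, map_mul, hp]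
    rcases i with i | i <;> simp [scale]

lemma dvd_scale_sub_scale_zero (t : R) (p : MvPolynomial (σ ⊕ σ) R) :
    C t ∣ scale σ t p - scale σ 0 p := by
  rw [← Ideal.mem_span_singleton, ← Ideal.Quotient.eq]
  have : ((Ideal.Quotient.mk (Ideal.span {C t})).comp (scale σ t).toRingHom) =
      (Ideal.Quotient.mk (Ideal.span {C t})).comp (scale σ (0 : R)).toRingHom := by
    apply ringHom_ext
    · intro r; simp [scale]
    · rintro (i | i)
      · simp [scale]
      · simp only [scale, RingHom.coe_comp, Function.comp, AlgHom.toRingHom_eq_coe,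
          RingHom.coe_coe, aeval_X, Sum.elim_inr]
        rw [Ideal.Quotient.eq, map_zero, zero_mul, sub_zero]
        exact Ideal.mul_mem_right _ _ (Ideal.mem_span_singleton_self _)
  exact congrArg (fun f => f p) this

lemma scale_eq_zero_of_mul_eq_zero {u : R} {p : MvPolynomial (σ ⊕ σ) R} (hu : C u * p = 0)
    (h0 : scale σ 0 p = 0) : scale σ u p = 0 := by
  suffices h : scale σ u p - scale σ 0 p = 0 by rwa [h0, sub_zero] at h
  have hc : ∀ d, u * coeff d p = 0 := fun d => by rw [← coeff_C_mul, hu, coeff_zero]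
  rw [p.as_sum, map_sum, map_sum, ← Finset.sum_sub_distrib _ _]
  refine Finset.sum_eq_zero fun d _ => ?_
  rw [show monomial d (coeff d p) = C (coeff d p) * monomial d 1 by rw [C_mul_monomial, mul_one]]
  rw [map_mul, map_mul, scale_C, scale_C, ← mul_sub]
  obtain ⟨g, hg⟩ := dvd_scale_sub_scale_zero u (monomial d (1 : R))
  rw [hg, ← mul_assoc, ← C_mul, mul_comm, mul_comm (coeff d p), hc, C_0, mul_zero]

variable {L : Type} [CommRing L] [Algebra R L]

lemma exists_lift_scale {p : MvPolynomial (σ ⊕ σ) L} {p0 : MvPolynomial (σ ⊕ σ) R}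
    (hp : scale σ 0 p = map (algebraMap R L) p0) {t : R}
    (ht : ∀ d, ∃ r, algebraMap R L r = algebraMap R L t * coeff d p) :
    ∃ q, map (algebraMap R L) q = scale σ (algebraMap R L t) p ∧ scale σ 0 q = scale σ 0 p0 := by
  choose r hr using ht
  choose h hh using fun d : σ ⊕ σ →₀ ℕ => dvd_scale_sub_scale_zero t (monomial d (1 : R))
  refine ⟨scale σ 0 p0 + ∑ d ∈ p.support, C (r d) * (h d - scale σ 0 (h d)), ?_, ?_⟩
  · have h1 : map (algebraMap R L) (scale σ 0 p0) = scale σ 0 p := by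
      rw [← scale_map, map_zero, ← hp, scale_scale, zero_mul]
    rw [map_add, h1, ← eq_sub_iff_add_eq', map_sum]
    conv_rhs => rw [p.as_sum, map_sum, map_sum, ← Finset.sum_sub_distrib _ _]
    refine Finset.sum_congr rfl fun d _ => ?_
    rw [show monomial d (coeff d p) = C (coeff d p) * monomial d 1 by rw [C_mul_monomial, mul_one]]
    rw [map_mul (scale σ _), map_mul (scale σ _), scale_C, scale_C, ← mul_sub]
    have h2 : C t * (h d - scale σ 0 (h d)) =
        scale σ t (monomial d (1 : R)) - scale σ 0 (monomial d (1 : R)) := by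
      have := congrArg (scale σ 0) (hh d)
      rw [map_sub, scale_scale, scale_scale, zero_mul, zero_mul, sub_self, map_mul, scale_C] at this
      rw [mul_sub, ← hh, ← this, sub_zero]
    have h3 := congrArg (map (algebraMap R L)) h2
    rw [map_sub, ← scale_map, ← scale_map, map_zero, map_monomial, map_one, map_mul, map_C] at h3
    rw [← h3, map_mul, map_C, hr, ← mul_assoc, ← C_mul, mul_comm (coeff d p)]
  · rw [map_add, scale_scale, zero_mul, map_sum, Finset.sum_eq_zero, add_zero]
    intro d _
    rw [map_mul, map_sub, scale_scale, zero_mul, sub_self, mul_zero]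

lemma exists_common_multiple (D : Submonoid R) [IsLocalization D L] (s : Finset L) :
    ∃ t ∈ D, ∀ x ∈ s, ∃ r, algebraMap R L r = algebraMap R L t * x := by
  obtain ⟨b, hb⟩ := IsLocalization.exist_integer_multiples_of_finset D s
  refine ⟨b, b.2, fun x hx => ?_⟩
  obtain ⟨r, hr⟩ := hb x hx
  exact ⟨r, by rw [hr, Algebra.smul_def]⟩

lemma exists_scale_lift_matrix (D : Submonoid R) [IsLocalization D L] {κ : Type} [Finite κ]
    {p : κ → MvPolynomial (σ ⊕ σ) L} {p0 : κ → MvPolynomial (σ ⊕ σ) R}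
    (hp : ∀ k, scale σ 0 (p k) = map (algebraMap R L) (p0 k)) :
    ∃ t ∈ D, ∃ q : κ → MvPolynomial (σ ⊕ σ) R, ∀ k,
      map (algebraMap R L) (q k) = scale σ (algebraMap R L t) (p k) ∧
        scale σ 0 (q k) = scale σ 0 (p0 k) := by
  classical
  cases nonempty_fintype κ
  obtain ⟨t, ht, h⟩ := exists_common_multiple (L := L) D
    (Finset.univ.biUnion fun k => (p k).support.image fun d => coeff d (p k))
  refine ⟨t, ht, ?_⟩
  have := fun k => exists_lift_scale (hp k) (t := t) (fun d => by
    by_cases hd : d ∈ (p k).support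
    · exact h _ (Finset.mem_biUnion.2 ⟨k, Finset.mem_univ _, Finset.mem_image_of_mem _ hd⟩)
    · refine ⟨0, ?_⟩
      rw [notMem_support_iff.1 hd, mul_zero, map_zero])
  choose q hq using this
  exact ⟨q, hq⟩

lemma exists_scale_eq_zero (D : Submonoid R) [IsLocalization D L] {κ : Type} [Finite κ]
    {p : κ → MvPolynomial (σ ⊕ σ) R}
    (hp : ∀ k, map (algebraMap R L) (p k) = 0) (h0 : ∀ k, scale σ 0 (p k) = 0) :
    ∃ u ∈ D, ∀ k, scale σ u (p k) = 0 := by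
  classical
  cases nonempty_fintype κ
  letI : Algebra (MvPolynomial (σ ⊕ σ) R) (MvPolynomial (σ ⊕ σ) L) := algebraMvPolynomial
  haveI : IsLocalization (D.map C) (MvPolynomial (σ ⊕ σ) L) := MvPolynomial.isLocalization D L
  have : ∀ k, ∃ u ∈ D, C u * p k = 0 := by
    intro k
    obtain ⟨⟨c, u, hu, rfl⟩, hc⟩ := IsLocalization.exists_of_eq (M := D.map C)
      (S := MvPolynomial (σ ⊕ σ) L) (x := p k) (y := 0) (by
        rw [map_zero, ← hp k]; rfl)
    exact ⟨u, hu, by simpa using hc⟩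
  choose u hu h using this
  refine ⟨∏ k, u k, D.prod_mem fun k _ => hu k, fun k => scale_eq_zero_of_mul_eq_zero ?_ (h0 k)⟩
  rw [← Finset.mul_prod_erase Finset.univ u (Finset.mem_univ k), C_mul, mul_comm (C (u k)),
    mul_assoc, h, mul_zero]

/-- `e` evaluated at the point `Z`. -/
noncomputable def atLeft (e : Matrix ι ι (MvPolynomial σ R)) :
    Matrix ι ι (MvPolynomial (σ ⊕ σ) R) :=
  e.map (aeval (R := R) fun i => (X (Sum.inl i) : MvPolynomial (σ ⊕ σ) R))

/-- `e` evaluated at the point `Z + Y`. -/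
noncomputable def atSum (e : Matrix ι ι (MvPolynomial σ R)) :
    Matrix ι ι (MvPolynomial (σ ⊕ σ) R) :=
  e.map (aeval (R := R) fun i => (X (Sum.inl i) + X (Sum.inr i) : MvPolynomial (σ ⊕ σ) R))

lemma atLeft_map_scale (e : Matrix ι ι (MvPolynomial σ R)) (t : R) :
    (atLeft e).map (scale σ t) = atLeft e := by
  ext i j : 1
  simp only [atLeft, Matrix.map_apply]
  rw [← AlgHom.comp_apply]
  congr 1
  ext k
  simp [scale]

lemma atSum_map_scale_zero (e : Matrix ι ι (MvPolynomial σ R)) :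
    (atSum e).map (scale σ (0 : R)) = atLeft e := by
  ext i j : 1
  simp only [atLeft, atSum, Matrix.map_apply]
  rw [← AlgHom.comp_apply]
  congr 1
  ext k
  simp [scale]

lemma map_scale_scale (M : Matrix ι ι (MvPolynomial (σ ⊕ σ) R)) (s t : R) :
    (M.map (scale σ t)).map (scale σ s) = M.map (scale σ (s * t)) := by
  ext i j : 1
  simp only [Matrix.map_apply]
  rw [scale_scale]

lemma map_map_scale (M : Matrix ι ι (MvPolynomial (σ ⊕ σ) R)) (t : R) :
    (M.map (scale σ t)).map (map (algebraMap R L)) =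
      (M.map (map (algebraMap R L))).map (scale σ (algebraMap R L t)) := by
  ext i j : 1
  simp only [Matrix.map_apply]
  rw [scale_map]

lemma mem_J_of_conj {e : Matrix ι ι (MvPolynomial σ R)} {he : e * e = e} {t : R}
    {a b : Matrix ι ι (MvPolynomial (σ ⊕ σ) R)}
    (h1 : atLeft e * a = a) (h2 : a * (atSum e).map (scale σ t) = a)
    (h3 : (atSum e).map (scale σ t) * b = b) (h4 : b * atLeft e = b)
    (h5 : a * b = atLeft e) (h6 : b * a = (atSum e).map (scale σ t))
    (h7 : b.map (scale σ (0 : R)) = atLeft e) : t ∈ J e he := by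
  intro C _ _ z y 𝔟 hy
  set ev : MvPolynomial (σ ⊕ σ) R →ₐ[R] C := aeval (Sum.elim z y) with hev
  have e1 : e.map (aeval (R := R) z) = (atLeft e).map ev := by
    ext i j
    simp only [atLeft, Matrix.map_apply]
    rw [← AlgHom.comp_apply]
    congr 1
    ext k
    simp [hev]
  have e2 : e.map (aeval (R := R) (z + t • y)) = ((atSum e).map (scale σ t)).map ev := by
    ext i j
    simp only [atSum, Matrix.map_apply]
    rw [← AlgHom.comp_apply, ← AlgHom.comp_apply]
    congr 1
    ext k
    simp [hev, scale, Algebra.smul_def]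
  have key : ∀ p, Ideal.Quotient.mk 𝔟 (ev p) = Ideal.Quotient.mk 𝔟 (ev (scale σ 0 p)) := by
    intro p
    have : (Ideal.Quotient.mk 𝔟).comp ev.toRingHom =
        (Ideal.Quotient.mk 𝔟).comp (ev.comp (scale σ (0 : R))).toRingHom := by
      apply ringHom_ext
      · intro r; simp
      · rintro (i | i)
        · simp [scale]
        · simp [scale, hev, Ideal.Quotient.eq_zero_iff_mem, hy]
    exact congrArg (fun f => f p) this
  rw [e1, e2]
  refine ⟨a.map ev, b.map ev, ?_, ?_, ?_, ?_, ?_, ?_, ?_⟩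
  iterate 6 rw [← Matrix.map_mul]; simp only [h1, h2, h3, h4, h5, h6]
  ext i j
  simp only [Matrix.map_apply]
  rw [key, key (scale σ t _), scale_scale, zero_mul]
  have h8 := congrFun (congrFun (h7.trans (atSum_map_scale_zero e).symm) i) j
  simp only [Matrix.map_apply] at h8
  rw [h8]

lemma sub_map_eq_zero {κ : Type} {A B : Type} [CommRing A] [CommRing B] (f : A →+* B)
    (M N : Matrix κ κ A) (h : M.map f = N.map f) (i j : κ) : f ((M - N) i j) = 0 := by
  have := congrFun (congrFun h i) j
  simp only [Matrix.map_apply] at this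
  rw [Matrix.sub_apply, map_sub, this, sub_self]

theorem exists_mem_J_of_conj (D : Submonoid R) [IsLocalization D L]
    {e : Matrix ι ι (MvPolynomial σ R)} {he : e * e = e}
    {a b : Matrix ι ι (MvPolynomial (σ ⊕ σ) L)}
    (h1 : (atLeft e).map (map (algebraMap R L)) * a = a)
    (h2 : a * (atSum e).map (map (algebraMap R L)) = a)
    (h3 : (atSum e).map (map (algebraMap R L)) * b = b)
    (h4 : b * (atLeft e).map (map (algebraMap R L)) = b)
    (h5 : a * b = (atLeft e).map (map (algebraMap R L)))
    (h6 : b * a = (atSum e).map (map (algebraMap R L)))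
    (h7 : b.map (scale σ (0 : L)) = (atLeft e).map (map (algebraMap R L))) :
    ∃ t ∈ D, t ∈ J e he := by
  have hE : atLeft e * atLeft e = atLeft e := by
    rw [atLeft, ← Matrix.map_mul, he]
  have h8 : a.map (scale σ (0 : L)) = (atLeft e).map (map (algebraMap R L)) := by
    have h9 := congrArg (fun M => M.map (scale σ (0 : L))) h2
    have h10 := congrArg (fun M => M.map (scale σ (0 : L))) h5
    simp only [Matrix.map_mul, h7] at h9 h10
    rw [← map_zero (algebraMap R L), ← map_map_scale, atSum_map_scale_zero] at h9
    rw [← map_zero (algebraMap R L), ← map_map_scale, atLeft_map_scale] at h10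
    rw [← h10, ← map_zero (algebraMap R L), h9]
  obtain ⟨t, ht, q, hq⟩ := exists_scale_lift_matrix (L := L) D
    (p := fun k : Bool × ι × ι => if k.1 then a k.2.1 k.2.2 else b k.2.1 k.2.2)
    (p0 := fun k => atLeft e k.2.1 k.2.2) (by
      rintro ⟨_ | _, i, j⟩
      · exact congrFun (congrFun h7 i) j
      · exact congrFun (congrFun h8 i) j)
  set a' : Matrix ι ι (MvPolynomial (σ ⊕ σ) R) := fun i j => q (true, i, j) with ha'
  set b' : Matrix ι ι (MvPolynomial (σ ⊕ σ) R) := fun i j => q (false, i, j) with hb'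
  have ha1 : a'.map (map (algebraMap R L)) = a.map (scale σ (algebraMap R L t)) := by
    ext i j : 1; exact (hq (true, i, j)).1
  have hb1 : b'.map (map (algebraMap R L)) = b.map (scale σ (algebraMap R L t)) := by
    ext i j : 1; exact (hq (false, i, j)).1
  have ha2 : a'.map (scale σ (0 : R)) = atLeft e := by
    rw [← atLeft_map_scale e 0]
    ext i j : 1; exact (hq (true, i, j)).2
  have hb2 : b'.map (scale σ (0 : R)) = atLeft e := by
    rw [← atLeft_map_scale e 0]
    ext i j : 1; exact (hq (false, i, j)).2
  have hE2 : (((atSum e).map (scale σ t)).map (scale σ (0 : R))) = atLeft e := by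
    rw [map_scale_scale, zero_mul, atSum_map_scale_zero]
  have hE3 := map_map_scale (L := L) (atSum e) t
  have hE4 := map_map_scale (L := L) (atLeft e) t
  rw [atLeft_map_scale] at hE4
  obtain ⟨u, hu, H⟩ := exists_scale_eq_zero (L := L) D (p := fun k : Fin 6 × ι × ι =>
    (![atLeft e * a' - a', a' * (atSum e).map (scale σ t) - a',
      (atSum e).map (scale σ t) * b' - b', b' * atLeft e - b', a' * b' - atLeft e,
      b' * a' - (atSum e).map (scale σ t)] k.1) k.2.1 k.2.2) (by
      rintro ⟨k, i, j⟩
      fin_cases k <;> refine sub_map_eq_zero (map (algebraMap R L)) _ _ ?_ i j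
      · rw [Matrix.map_mul, ha1, hE4, ← Matrix.map_mul, h1]
      · rw [Matrix.map_mul, ha1, hE3, ← Matrix.map_mul, h2]
      · rw [Matrix.map_mul, hb1, hE3, ← Matrix.map_mul, h3]
      · rw [Matrix.map_mul, hb1, hE4, ← Matrix.map_mul, h4]
      · rw [Matrix.map_mul, ha1, hb1, hE4, ← Matrix.map_mul, h5]
      · rw [Matrix.map_mul, ha1, hb1, hE3, ← Matrix.map_mul, h6]) (by
      rintro ⟨k, i, j⟩
      fin_cases k <;> refine sub_map_eq_zero (scale σ (0 : R)).toRingHom _ _ ?_ i j <;>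
        simp only [AlgHom.toRingHom_eq_coe, RingHom.coe_coe, Matrix.map_mul, ha2, hb2, hE2,
          atLeft_map_scale, hE])
  have H' : ∀ M N : Matrix ι ι (MvPolynomial (σ ⊕ σ) R),
      (∀ i j, scale σ u ((M - N) i j) = 0) → M.map (scale σ u) = N.map (scale σ u) := by
    intro M N h
    ext i j : 1
    have := h i j
    rw [Matrix.sub_apply, map_sub, sub_eq_zero] at this
    exact this
  have r0 := H' _ _ fun i j => H (0, i, j)
  have r1 := H' _ _ fun i j => H (1, i, j)
  have r2 := H' _ _ fun i j => H (2, i, j)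
  have r3 := H' _ _ fun i j => H (3, i, j)
  have r4 := H' _ _ fun i j => H (4, i, j)
  have r5 := H' _ _ fun i j => H (5, i, j)
  simp only [Matrix.map_mul, atLeft_map_scale, map_scale_scale] at r0 r1 r2 r3 r4 r5
  exact ⟨u * t, D.mul_mem hu ht, mem_J_of_conj r0 r1 r2 r3 r4 r5 (by
    rw [map_scale_scale, zero_mul, hb2])⟩

/-- The image of the idempotent `e` is free. -/
def Split {B : Type} [CommRing B] (e : Matrix ι ι B) : Prop :=
  ∃ (r : ℕ) (V : Matrix ι (Fin r) B) (Ψ : Matrix (Fin r) ι B), V * Ψ = e ∧ Ψ * V = 1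

lemma Split.map {B B' : Type} [CommRing B] [CommRing B'] {e : Matrix ι ι B} (h : Split e)
    (f : B →+* B') : Split (e.map f) := by
  obtain ⟨r, V, Ψ, h1, h2⟩ := h
  refine ⟨r, V.map f, Ψ.map f, ?_, ?_⟩
  · rw [← Matrix.map_mul, h1]
  · rw [← Matrix.map_mul, h2, Matrix.map_one _ (map_zero f) (map_one f)]

/-- If `e` splits over `L[Z]` with all the products `V(Z)Ψ(Z')` defined over a localization
of `R`, then the corresponding multiplicative set meets `J e`. -/
theorem exists_mem_J_of_split_of_injective (D : Submonoid R) [IsLocalization D L] {K : Type}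
    [CommRing K] (g : L →+* K) (hg : Function.Injective g)
    {e : Matrix ι ι (MvPolynomial σ R)} {he : e * e = e} {r : ℕ}
    {V : Matrix ι (Fin r) (MvPolynomial σ K)} {Ψ : Matrix (Fin r) ι (MvPolynomial σ K)}
    (h1 : V * Ψ = e.map (map (g.comp (algebraMap R L)))) (h2 : Ψ * V = 1)
    (a b : Matrix ι ι (MvPolynomial (σ ⊕ σ) L))
    (ha : a.map (map g) = V.map (aeval (R := K) fun i => (X (Sum.inl i) : MvPolynomial (σ ⊕ σ) K)) *
      Ψ.map (aeval (R := K) fun i => (X (Sum.inl i) + X (Sum.inr i) : MvPolynomial (σ ⊕ σ) K)))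
    (hb : b.map (map g) = V.map (aeval (R := K) fun i => (X (Sum.inl i) + X (Sum.inr i) :
        MvPolynomial (σ ⊕ σ) K)) *
      Ψ.map (aeval (R := K) fun i => (X (Sum.inl i) : MvPolynomial (σ ⊕ σ) K))) :
    ∃ t ∈ D, t ∈ J e he := by
  set ζ : MvPolynomial σ K →ₐ[K] MvPolynomial (σ ⊕ σ) K :=
    aeval (R := K) fun i => (X (Sum.inl i) : MvPolynomial (σ ⊕ σ) K) with hζ
  set η : MvPolynomial σ K →ₐ[K] MvPolynomial (σ ⊕ σ) K :=
    aeval (R := K) fun i => (X (Sum.inl i) + X (Sum.inr i) : MvPolynomial (σ ⊕ σ) K) with hη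
  have hinj : Function.Injective fun M : Matrix ι ι (MvPolynomial (σ ⊕ σ) L) => M.map (map g) :=
    fun M N h => by
      ext i j : 1
      exact MvPolynomial.map_injective g hg (congrFun (congrFun h i) j)
  have e1 : ((atLeft e).map (map (algebraMap R L))).map (map g) = V.map ζ * Ψ.map ζ := by
    rw [← Matrix.map_mul, h1]
    ext i j : 1
    simp only [atLeft, Matrix.map_apply]
    have : (MvPolynomial.map g).comp ((MvPolynomial.map (algebraMap R L)).comp
        (aeval (R := R) fun i => (X (Sum.inl i) : MvPolynomial (σ ⊕ σ) R)).toRingHom) =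
        ζ.toRingHom.comp (MvPolynomial.map (g.comp (algebraMap R L))) := by
      apply ringHom_ext
      · intro r; simp [hζ]
      · intro i; simp [hζ]
    exact congrArg (fun f => f (e i j)) this
  have e2 : ((atSum e).map (map (algebraMap R L))).map (map g) = V.map η * Ψ.map η := by
    rw [← Matrix.map_mul, h1]
    ext i j : 1
    simp only [atSum, Matrix.map_apply]
    have : (MvPolynomial.map g).comp ((MvPolynomial.map (algebraMap R L)).comp
        (aeval (R := R) fun i => (X (Sum.inl i) + X (Sum.inr i) :
            MvPolynomial (σ ⊕ σ) R)).toRingHom) =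
        η.toRingHom.comp (MvPolynomial.map (g.comp (algebraMap R L))) := by
      apply ringHom_ext
      · intro r; simp [hη]
      · intro i; simp [hη]
    exact congrArg (fun f => f (e i j)) this
  have hζ1 : Ψ.map ζ * V.map ζ = 1 := by
    rw [← Matrix.map_mul, h2, Matrix.map_one _ (map_zero ζ) (map_one ζ)]
  have hη1 : Ψ.map η * V.map η = 1 := by
    rw [← Matrix.map_mul, h2, Matrix.map_one _ (map_zero η) (map_one η)]
  have hs : ∀ {κ κ' : Type} (M : Matrix κ κ' (MvPolynomial σ K)),
      (M.map η).map (scale σ (0 : K)) = M.map ζ := by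
    intro κ κ' M
    ext i j : 1
    simp only [Matrix.map_apply]
    rw [← AlgHom.comp_apply]
    congr 1
    ext k
    simp [hζ, hη, scale]
  have hs' : ∀ {κ κ' : Type} (M : Matrix κ κ' (MvPolynomial σ K)),
      (M.map ζ).map (scale σ (0 : K)) = M.map ζ := by
    intro κ κ' M
    ext i j : 1
    simp only [Matrix.map_apply]
    rw [← AlgHom.comp_apply]
    congr 1
    ext k
    simp [hζ, scale]
  refine exists_mem_J_of_conj D (a := a) (b := b) ?_ ?_ ?_ ?_ ?_ ?_ ?_ <;> apply hinj <;>
    simp only [Matrix.map_mul, e1, e2, ha, hb]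
  · rw [Matrix.mul_assoc, ← Matrix.mul_assoc _ (V.map ζ), hζ1, Matrix.one_mul]
  · rw [Matrix.mul_assoc, ← Matrix.mul_assoc _ (V.map η), hη1, Matrix.one_mul]
  · rw [Matrix.mul_assoc, ← Matrix.mul_assoc _ (V.map η), hη1, Matrix.one_mul]
  · rw [Matrix.mul_assoc, ← Matrix.mul_assoc _ (V.map ζ), hζ1, Matrix.one_mul]
  · rw [Matrix.mul_assoc, ← Matrix.mul_assoc _ (V.map η), hη1, Matrix.one_mul]
  · rw [Matrix.mul_assoc, ← Matrix.mul_assoc _ (V.map ζ), hζ1, Matrix.one_mul]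
  · have : (b.map (scale σ (0 : L))).map (map g) = (b.map (map g)).map (scale σ (0 : K)) := by
      ext i j : 1
      simp only [Matrix.map_apply]
      rw [← map_zero g, scale_map]
    rw [this, hb, Matrix.map_mul, hs, hs']

theorem exists_mem_J_of_split (D : Submonoid R) [IsLocalization D L]
    {e : Matrix ι ι (MvPolynomial σ R)} {he : e * e = e}
    (hs : Split (e.map (map (algebraMap R L)))) : ∃ t ∈ D, t ∈ J e he := by
  obtain ⟨r, V, Ψ, h1, h2⟩ := hs
  refine exists_mem_J_of_split_of_injective D (RingHom.id L) Function.injective_id h1 h2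
    (V.map (aeval (R := L) fun i => (X (Sum.inl i) : MvPolynomial (σ ⊕ σ) L)) *
      Ψ.map (aeval (R := L) fun i => (X (Sum.inl i) + X (Sum.inr i) : MvPolynomial (σ ⊕ σ) L)))
    (V.map (aeval (R := L) fun i => (X (Sum.inl i) + X (Sum.inr i) : MvPolynomial (σ ⊕ σ) L)) *
      Ψ.map (aeval (R := L) fun i => (X (Sum.inl i) : MvPolynomial (σ ⊕ σ) L))) ?_ ?_ <;>
  · ext i j : 1
    rw [Matrix.map_apply, MvPolynomial.map_id]

end JLoc

section Elimination

open Polynomial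

variable {A : Type} [CommRing A]

lemma exists_monic_div (f p : A[X]) (hf : f.Monic) :
    ∃ s r, r ∈ degreeLT A f.natDegree ∧ p = f * s + r := by
  cases subsingleton_or_nontrivial A
  · exact ⟨0, 0, Submodule.zero_mem _, Subsingleton.elim _ _⟩
  · refine ⟨p /ₘ f, p %ₘ f, mem_degreeLT.2 ?_, ?_⟩
    · rw [← degree_eq_natDegree hf.ne_zero]
      exact degree_modByMonic_lt p hf
    · rw [add_comm, modByMonic_add_div]

lemma fg_degreeLT (n : ℕ) : (degreeLT A n).FG := by
  rw [← Module.Finite.iff_fg]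
  exact Module.Finite.equiv (degreeLTEquiv A n).symm

lemma smul_mk_mem_smul {J : Ideal A} {S N : Submodule A A[X]} {p : A[X]}
    (hp : p ∈ J.map (C : A →+* A[X])) (hN : ∀ i ≤ p.natDegree, (X ^ i : A[X]) ∈ N) :
    S.mkQ p ∈ J • N.map S.mkQ := by
  rw [p.as_sum_range_C_mul_X_pow' (Nat.lt_succ_self _), map_sum]
  refine Submodule.sum_mem _ fun i hi => ?_
  rw [← smul_eq_C_mul, map_smul]
  exact Submodule.smul_mem_smul (Ideal.mem_map_C_iff.1 hp i) (Submodule.mem_map_of_mem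
    (hN i (by simpa [Nat.lt_succ_iff] using hi)))

/-- Elimination of the variable from an ideal containing a polynomial which is monic
modulo `J`. -/
lemma exists_C_mem_of_monic_mod {J : Ideal A} {𝔄 : Ideal A[X]} {F : A[X]} (hF : F ∈ 𝔄) {d : ℕ}
    (hd : F.natDegree ≤ d) (hc : F.coeff d - 1 ∈ J) (htop : ∃ g ∈ J.map (C : A →+* A[X]),
        1 - g ∈ 𝔄) :
    ∃ t, t - 1 ∈ J ∧ C t ∈ 𝔄 := by
  obtain ⟨g, hg, hgA⟩ := htop
  set S : Submodule A A[X] := 𝔄.restrictScalars A with hS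
  set N : Submodule A A[X] := degreeLT A (d + 1) with hN
  have hNX : ∀ i ≤ d, (X ^ i : A[X]) ∈ N := fun i hi => by
    rw [hN, mem_degreeLT]
    exact lt_of_le_of_lt (degree_X_pow_le i) (by exact_mod_cast Nat.lt_succ_of_le hi)
  have hmk : ∀ p q : A[X], p - q ∈ 𝔄 → S.mkQ p = S.mkQ q := fun p q h =>
    (Submodule.Quotient.eq S).2 h
  set t' := F.coeff d with ht'
  have key : ∀ k, ∀ p ∈ J.map (C : A →+* A[X]), p.natDegree ≤ d + k →
      S.mkQ (C (t' ^ k) * p) ∈ J • N.map S.mkQ := by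
    intro k
    induction k with
    | zero =>
      intro p hp hpd
      rw [pow_zero, C_1, one_mul]
      exact smul_mk_mem_smul hp fun i hi => hNX i (hi.trans hpd)
    | succ k ih =>
      intro p hp hpd
      set p' := C t' * p - C (p.coeff (d + k + 1)) * (X ^ (k + 1) * F) with hp'
      have h1 : p' ∈ J.map (C : A →+* A[X]) :=
        Ideal.sub_mem _ (Ideal.mul_mem_left _ _ hp) (Ideal.mul_mem_right _ _
          (Ideal.mem_map_of_mem _ (Ideal.mem_map_C_iff.1 hp _)))
      have h2 : p'.natDegree ≤ d + k := by
        rw [natDegree_le_iff_coeff_eq_zero]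
        intro n hn
        rw [hp', coeff_sub, coeff_C_mul, coeff_C_mul]
        rcases Nat.eq_or_lt_of_le (Nat.succ_le_of_lt hn) with h | h
        · have : n = d + (k + 1) := by omega
          subst this
          rw [coeff_X_pow_mul, ← ht', ← add_assoc, mul_comm, sub_self]
        · obtain ⟨l, rfl⟩ : ∃ l, n = l + (k + 1) := ⟨n - (k + 1), by omega⟩
          rw [coeff_X_pow_mul, coeff_eq_zero_of_natDegree_lt (p := p) (by omega),
            coeff_eq_zero_of_natDegree_lt (p := F) (by omega), mul_zero, mul_zero, sub_zero]
      have h3 := ih p' h1 h2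
      rwa [hmk (C (t' ^ k) * p') (C (t' ^ (k + 1)) * p)] at h3
      have : C (t' ^ k) * p' - C (t' ^ (k + 1)) * p =
          - (C (t' ^ k) * C (p.coeff (d + k + 1)) * X ^ (k + 1)) * F := by
        rw [hp', pow_succ t', C_mul]; ring
      rw [this]
      exact Ideal.mul_mem_left _ _ hF
  have hle : N.map S.mkQ ≤ J • N.map S.mkQ := by
    classical
    rw [Submodule.map_le_iff_le_comap]
    refine (degreeLT_eq_span_X_pow (R := A) (n := d + 1)).le.trans (Submodule.span_le.2 ?_)
    intro x hx
    simp only [Finset.coe_image, Set.mem_image, Finset.coe_range, Set.mem_Iio] at hx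
    obtain ⟨i, hi, rfl⟩ := hx
    rw [SetLike.mem_coe, Submodule.mem_comap]
    have h1 : S.mkQ (X ^ i) ∈ N.map S.mkQ := Submodule.mem_map_of_mem (hNX i (by omega))
    obtain ⟨k, hk⟩ : ∃ k, (g * X ^ i).natDegree ≤ d + k := ⟨(g * X ^ i).natDegree, by omega⟩
    have h2 := key k (g * X ^ i) (Ideal.mul_mem_right _ _ hg) hk
    rw [hmk _ (C (t' ^ k) * X ^ i), ← smul_eq_C_mul, map_smul] at h2
    · have h3 : t' ^ k - 1 ∈ J := by
        have := J.mul_mem_right (∑ i ∈ Finset.range k, t' ^ i) hc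
        rwa [mul_comm, geom_sum_mul] at this
      have h4 := Submodule.smul_mem_smul h3 h1
      rw [sub_smul, one_smul] at h4
      simpa using Submodule.sub_mem _ h2 h4
    · rw [← mul_sub, show g * X ^ i - X ^ i = - X ^ i * (1 - g) by ring]
      exact Ideal.mul_mem_left _ _ (Ideal.mul_mem_left _ _ hgA)
  obtain ⟨t, ht, h⟩ := Submodule.exists_sub_one_mem_and_smul_eq_zero_of_fg_of_le_smul J _
    ((fg_degreeLT (d + 1)).map S.mkQ) hle
  refine ⟨t, ht, ?_⟩
  have := h _ (Submodule.mem_map_of_mem (hNX 0 (Nat.zero_le _)))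
  rw [← map_smul, pow_zero, smul_eq_C_mul, mul_one] at this
  exact (Submodule.Quotient.mk_eq_zero S).1 this

variable {ι : Type} [Fintype ι] [DecidableEq ι]

lemma mem_span_range {B : Type} [CommRing B] {v : ι → B} {x : B} :
    x ∈ Ideal.span (Set.range v) ↔ ∃ ψ : ι → B, ψ ⬝ᵥ v = x :=
  Ideal.mem_span_range_iff_exists_fun

/-- A polynomial which is monic of degree `d` modulo `J` decomposes. -/
lemma exists_monic_add {J : Ideal A} {h : A[X]} {d : ℕ} (h1 : h.coeff d - 1 ∈ J)
    (h2 : ∀ k > d, h.coeff k ∈ J) :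
    ∃ g j : A[X], g.Monic ∧ j ∈ J.map (C : A →+* A[X]) ∧ h = g + j ∧ degreeLT A g.natDegree ≤
      degreeLT A d := by
  set l : A[X] := ∑ i ∈ Finset.range d, C (h.coeff i) * X ^ i with hl
  have hld : l.degree < d := by
    rw [← mem_degreeLT, hl]
    refine Submodule.sum_mem _ fun i hi => mem_degreeLT.2 ?_
    exact lt_of_le_of_lt (degree_C_mul_X_pow_le _ _) (by exact_mod_cast Finset.mem_range.1 hi)
  refine ⟨X ^ d + l, h - (X ^ d + l), monic_X_pow_add hld, ?_, by ring, ?_⟩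
  · rw [Ideal.mem_map_C_iff]
    intro n
    rw [coeff_sub, coeff_add, coeff_X_pow]
    rcases lt_trichotomy n d with hn | rfl | hn
    · rw [if_neg hn.ne, zero_add, hl, finsetSum_coeff]
      simp [coeff_C_mul, coeff_X_pow, hn]
    · rwa [if_pos rfl, coeff_eq_zero_of_degree_lt hld, add_zero]
    · rw [if_neg hn.ne', coeff_eq_zero_of_degree_lt (hld.trans (by exact_mod_cast hn)), add_zero,
        sub_zero]
      exact h2 n hn
  · intro p hp
    rw [mem_degreeLT] at *
    refine lt_of_lt_of_le hp ?_
    have : (X ^ d + l : A[X]).degree ≤ (d : WithBot ℕ) := (degree_add_le _ _).trans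
        (max_le (degree_X_pow_le _) hld.le)
    exact Nat.cast_le.2 (natDegree_le_of_degree_le this)

lemma vecMul_dotProduct {B : Type} [CommRing B] {κ : Type} [Fintype κ] (φ : κ → B)
    (e : Matrix κ ι B) (y : ι → B) :
    (φ ᵥ* e) ⬝ᵥ y = φ ⬝ᵥ (e *ᵥ y) := (dotProduct_mulVec φ e y).symm

lemma exists_lift_monic {J : Ideal A} {e : Matrix ι ι A[X]} (he : e * e = e) {φ : ι → A[X]}
    {f : A[X]} (hf : f.Monic) (hfφ : f ∈ Ideal.span (Set.range (φ ᵥ* e))) {w : ι → A[X]}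
    (hw : e *ᵥ w = w) (hO : ∃ ψ : ι → A[X], ψ ⬝ᵥ w - 1 ∈ J.map (C : A →+* A[X])) {d : ℕ}
    (h1 : (φ ⬝ᵥ w).coeff d - 1 ∈ J) (h2 : ∀ k > d, (φ ⬝ᵥ w).coeff k ∈ J) :
    ∃ t t2 : A, ∃ q y : ι → A[X], t - 1 ∈ J ∧ t2 - 1 ∈ J ∧ e *ᵥ y = y ∧ q =
        C t • w + (X : A[X]) • y ∧
      C t2 ∈ Ideal.span (Set.range q) ∧ (φ ⬝ᵥ q).natDegree ≤ d ∧ (φ ⬝ᵥ q).coeff d - 1 ∈ J := by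
  obtain ⟨g, j, hg, hj, hgj, hgd⟩ := exists_monic_add h1 h2
  set 𝔇 := Ideal.span (Set.range (φ ᵥ* e)) with h𝔇
  have hφw : φ ⬝ᵥ w ∈ 𝔇 := mem_span_range.2 ⟨w, by rw [dotProduct_comm, vecMul_dotProduct, hw]⟩
  set S : Submodule A A[X] := 𝔇.restrictScalars A ⊔ degreeLT A d with hS
  have hfg : (⊤ : Submodule A (A[X] ⧸ S)).FG := by
    have : (⊤ : Submodule A (A[X] ⧸ S)) = (degreeLT A f.natDegree).map S.mkQ := by
      refine le_antisymm ?_ le_top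
      rintro x -
      obtain ⟨p, rfl⟩ := Submodule.mkQ_surjective S x
      obtain ⟨s, r, hr, hp⟩ := exists_monic_div f p hf
      refine ⟨r, hr, (Submodule.Quotient.eq S).2 ?_⟩
      refine Submodule.mem_sup_left ?_
      rw [hp, sub_add_cancel_right]
      exact 𝔇.neg_mem (𝔇.mul_mem_right _ hfφ)
    rw [this]
    exact (fg_degreeLT _).map _
  obtain ⟨t, ht, htS⟩ := Submodule.exists_sub_one_mem_and_smul_eq_zero_of_fg_of_le_smul J _ hfg (by
    rintro x -
    obtain ⟨p, rfl⟩ := Submodule.mkQ_surjective S x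
    obtain ⟨s, r, hr, hp⟩ := exists_monic_div g p hg
    have h3 : S.mkQ p = S.mkQ (-(j * s)) := by
      refine (Submodule.Quotient.eq S).2 ?_
      rw [hp, show g * s + r - -(j * s) = (φ ⬝ᵥ w) * s + r by rw [hgj]; ring]
      exact Submodule.add_mem_sup (𝔇.mul_mem_right _ hφw) (hgd hr)
    rw [h3]
    refine Submodule.smul_mono le_rfl le_top (smul_mk_mem_smul (N := ⊤) ?_ fun _ _ => trivial)
    exact neg_mem (Ideal.mul_mem_right _ _ hj))
  have hk : ∀ k : ℕ, ∃ y : ι → A[X], e *ᵥ y = y ∧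
      ∃ l ∈ degreeLT A d, φ ⬝ᵥ y = C t * X ^ k + l := by
    intro k
    have := htS (S.mkQ (X ^ k)) trivial
    rw [← map_smul] at this
    have := (Submodule.Quotient.mk_eq_zero S).1 this
    obtain ⟨a, ha, l, hl, hal⟩ := Submodule.mem_sup.1 this
    obtain ⟨y, hy⟩ := mem_span_range.1 (show a ∈ 𝔇 from ha)
    refine ⟨e *ᵥ y, by rw [mulVec_mulVec, he], -l, Submodule.neg_mem _ hl, ?_⟩
    rw [← vecMul_dotProduct, dotProduct_comm, hy, ← smul_eq_C_mul, ← hal, add_neg_cancel_right]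
  choose y hy l hl hyl using hk
  set F := φ ⬝ᵥ w with hF
  set s := Finset.Ioc d F.natDegree with hs
  set z : ι → A[X] := ∑ k ∈ s, C (-F.coeff k) • y (k - 1) with hz
  have hez : e *ᵥ z = z := by
    rw [hz, mulVec_sum]
    exact Finset.sum_congr rfl fun k _ => by rw [mulVec_smul, hy]
  have hφz : φ ⬝ᵥ z = ∑ k ∈ s, C (-F.coeff k) * (C t * X ^ (k - 1) + l (k - 1)) := by
    rw [hz, dotProduct_sum]
    exact Finset.sum_congr rfl fun k _ => by rw [dotProduct_smul, hyl, smul_eq_mul]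
  set q : ι → A[X] := C t • w + (X : A[X]) • z with hq
  set r : A[X] := ∑ k ∈ s, C (F.coeff k) * l (k - 1) with hr
  have hrd : r ∈ degreeLT A d := Submodule.sum_mem _ fun k _ => by
    rw [← smul_eq_C_mul]; exact Submodule.smul_mem _ _ (hl _)
  have hrJ : ∀ n, r.coeff n ∈ J := by
    rw [← Ideal.mem_map_C_iff]
    exact Ideal.sum_mem _ fun k hk => Ideal.mul_mem_right _ _ (Ideal.mem_map_of_mem _
      (h2 k (Finset.mem_Ioc.1 hk).1))
  have hφq : φ ⬝ᵥ q = C t * (F - ∑ k ∈ s, C (F.coeff k) * X ^ k) - X * r := by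
    rw [hq, dotProduct_add, dotProduct_smul (C t) φ w, dotProduct_smul (X : A[X]) φ z, hφz,
        smul_eq_mul, smul_eq_mul, ← hF,
      mul_sub, Finset.mul_sum, Finset.mul_sum, hr, Finset.mul_sum, sub_sub,
          ← Finset.sum_add_distrib,
      sub_eq_add_neg, ← Finset.sum_neg_distrib]
    congr 1
    refine Finset.sum_congr rfl fun k hk => ?_
    have : X ^ k = (X : A[X]) * X ^ (k - 1) := by
      rw [← pow_succ', Nat.sub_add_cancel]
      have := (Finset.mem_Ioc.1 hk).1
      omega
    rw [this, C_neg]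
    ring
  have hcoeff : ∀ n, (φ ⬝ᵥ q).coeff n = t * (if n ≤ d then F.coeff n else 0) - (X * r).coeff n := by
    intro n
    rw [hφq, coeff_sub, coeff_C_mul, coeff_sub, finsetSum_coeff]
    congr 2
    simp only [coeff_C_mul, coeff_X_pow, mul_ite, mul_one, mul_zero, Finset.sum_ite_eq, hs,
      Finset.mem_Ioc]
    split_ifs with h3 h4 h4
    · omega
    · rw [sub_self]
    · rw [sub_zero]
    · rw [sub_zero, coeff_eq_zero_of_natDegree_lt (by omega)]
  have hXr : ∀ n > d, (X * r).coeff n = 0 := by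
    intro n hn
    obtain ⟨n, rfl⟩ : ∃ m, n = m + 1 := ⟨n - 1, by omega⟩
    rw [coeff_X_mul]
    exact coeff_eq_zero_of_degree_lt (lt_of_lt_of_le (mem_degreeLT.1 hrd) (by
      exact_mod_cast Nat.lt_succ_iff.1 hn))
  have hqd : (φ ⬝ᵥ q).natDegree ≤ d := by
    rw [natDegree_le_iff_coeff_eq_zero]
    intro n hn
    rw [hcoeff, if_neg (by omega), hXr n hn, mul_zero, sub_zero]
  have hqc : (φ ⬝ᵥ q).coeff d - 1 ∈ J := by
    rw [hcoeff, if_pos le_rfl, show t * F.coeff d - (X * r : A[X]).coeff d - 1 =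
      (t - 1) * F.coeff d + (F.coeff d - 1) - (X * r : A[X]).coeff d by ring]
    refine J.sub_mem (J.add_mem (J.mul_mem_right _ ht) h1) ?_
    exact Ideal.mem_map_C_iff.1 (Ideal.mul_mem_left _ X (Ideal.mem_map_C_iff.2 hrJ)) d
  have hφq𝔄 : φ ⬝ᵥ q ∈ Ideal.span (Set.range q) := mem_span_range.2 ⟨φ, rfl⟩
  obtain ⟨t2, ht2, ht2q⟩ := exists_C_mem_of_monic_mod hφq𝔄 hqd hqc (by
    obtain ⟨ψ, hψ⟩ := hO
    refine ⟨1 - ψ ⬝ᵥ q, ?_, ?_⟩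
    · have : 1 - ψ ⬝ᵥ q = - (ψ ⬝ᵥ w - 1) - (C (t - 1) * (ψ ⬝ᵥ w) + X * (ψ ⬝ᵥ z)) := by
        rw [hq, dotProduct_add, dotProduct_smul, dotProduct_smul, smul_eq_mul, smul_eq_mul, C_sub,
          C_1]
        ring
      rw [this]
      refine Ideal.sub_mem _ (neg_mem hψ) (Ideal.add_mem _ (Ideal.mul_mem_right _ _
        (Ideal.mem_map_of_mem _ ht)) (Ideal.mul_mem_left _ _ ?_))
      rw [hz, dotProduct_sum]
      refine Ideal.sum_mem _ fun k hk => ?_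
      rw [dotProduct_smul]
      exact Ideal.mul_mem_right _ _ (Ideal.mem_map_of_mem _ (J.neg_mem
        (h2 k (Finset.mem_Ioc.1 hk).1)))
    · rw [sub_sub_cancel]
      exact mem_span_range.2 ⟨ψ, rfl⟩)
  exact ⟨t, t2, q, z, ht, ht2, hez, rfl, ht2q, hqd, hqc⟩

end Elimination

section Homotopy

variable {ι : Type} [Fintype ι] [DecidableEq ι]

/-- `v` generates the unit ideal. -/
def Um {B : Type} [CommRing B] (v : ι → B) : Prop := ∃ ψ : ι → B, ψ ⬝ᵥ v = 1

lemma um_iff {B : Type} [CommRing B] {v : ι → B} : Um v ↔ Ideal.span (Set.range v) = ⊤ := by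
  rw [Ideal.eq_top_iff_one, mem_span_range]; rfl

lemma comp_dotProduct {B C : Type} [CommRing B] [CommRing C] (f : B →+* C) (v w : ι → B) :
    (f ∘ v) ⬝ᵥ (f ∘ w) = f (v ⬝ᵥ w) := (RingHom.map_dotProduct f v w).symm

lemma map_mulVec_comp {B C : Type} [CommRing B] [CommRing C] {κ : Type} [Fintype κ] (f : B →+* C)
    (e : Matrix κ ι B) (w : ι → B) : e.map f *ᵥ (f ∘ w) = f ∘ (e *ᵥ w) := by
  ext i; exact (RingHom.map_mulVec f e w i).symm

lemma Um.map {B C : Type} [CommRing B] [CommRing C] {v : ι → B} (h : Um v) (f : B →+* C) :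
    Um (f ∘ v) := by
  obtain ⟨ψ, hψ⟩ := h
  exact ⟨f ∘ ψ, by rw [comp_dotProduct, hψ, map_one]⟩

lemma um_of_scaled_homotopy {C : Type} [CommRing C] {T t t2 : C} {e : Matrix ι ι C}
    {U z q : ι → C} {Γ : C →+* C} (hU : e *ᵥ U = U) (hz : e *ᵥ z = z) (hq : q = t • U + T • z)
    (hΓt : Γ t = t) (hΓt2 : Γ t2 = t2) (hΓT : Γ T = t * t2 * T) (hΓ : ∀ c, Γ c - c ∈ Ideal.span {T})
    (hO : ∃ ρ : ι → C, ρ ⬝ᵥ U - 1 ∈ Ideal.span {T}) (ht2 : t2 ∈ Ideal.span (Set.range q))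
    (hconj : ConjMod (Ideal.span {T}) (e.map Γ) e) :
    ∃ v : ι → C, e *ᵥ v = v ∧ Um v ∧ ∀ i, v i - U i ∈ Ideal.span {T} := by
  obtain ⟨a, b, h1, h2, h3, h4, h5, h6, h7⟩ := hconj
  set x : ι → C := Γ ∘ U + (t2 * T) • (Γ ∘ z) with hx
  have hΓx : e.map Γ *ᵥ x = x := by
    rw [hx, mulVec_add, mulVec_smul, map_mulVec_comp, map_mulVec_comp, hU, hz]
  have htx : t • x = Γ ∘ q := by
    ext i
    simp only [hx, hq, Pi.smul_apply, Pi.add_apply, Function.comp, smul_eq_mul, map_add, map_mul,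
      hΓt, hΓT]
    ring
  have hxO : ∀ ψ : ι → C, ψ ⬝ᵥ x ∈ Ideal.span (Set.range x) := fun ψ => mem_span_range.2 ⟨ψ, rfl⟩
  have ht2x : t2 ∈ Ideal.span (Set.range x) := by
    obtain ⟨ψ, hψ⟩ := mem_span_range.1 ht2
    refine mem_span_range.2 ⟨t • (Γ ∘ ψ), ?_⟩
    rw [smul_dotProduct, ← dotProduct_smul, htx, comp_dotProduct, hψ, hΓt2]
  have hux : Um x := by
    rw [um_iff, Ideal.eq_top_iff_one]
    obtain ⟨ρ, hρ⟩ := hO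
    obtain ⟨c, hc⟩ := Ideal.mem_span_singleton'.1 hρ
    have h8 : (Γ ∘ ρ) ⬝ᵥ (Γ ∘ U) = 1 + Γ c * (t * t2 * T) := by
      rw [comp_dotProduct, show ρ ⬝ᵥ U = 1 + c * T by rw [hc]; ring, map_add, map_one, map_mul, hΓT]
    have h9 : (1 : C) = (Γ ∘ ρ) ⬝ᵥ x - (Γ c * (t * T) + T * (Γ ∘ ρ) ⬝ᵥ (Γ ∘ z)) * t2 := by
      rw [hx, dotProduct_add, dotProduct_smul, h8, smul_eq_mul]; ring
    rw [h9]
    exact Ideal.sub_mem _ (hxO _) (Ideal.mul_mem_left _ _ ht2x)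
  refine ⟨b *ᵥ x, by rw [mulVec_mulVec, h3], ?_, ?_⟩
  · obtain ⟨ψ, hψ⟩ := hux
    exact ⟨ψ ᵥ* a, by rw [vecMul_dotProduct, mulVec_mulVec, h5, hΓx, hψ]⟩
  · intro i
    rw [← Ideal.Quotient.eq]
    set π := Ideal.Quotient.mk (Ideal.span {T}) with hπ
    have hπΓ : ∀ c, π (Γ c) = π c := fun c => Ideal.Quotient.eq.2 (hΓ c)
    have hπT : π T = 0 := Ideal.Quotient.eq_zero_iff_mem.2 (Ideal.mem_span_singleton_self T)
    have hπx : π ∘ x = π ∘ U := by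
      ext i; simp [hx, hπT, hπΓ]
    rw [RingHom.map_mulVec, h7, hπx, ← RingHom.map_mulVec, hU]

end Homotopy

section Core

variable {ι : Type} [Fintype ι] [DecidableEq ι] {σ : Type} {R : Type} [CommRing R]

/-- `J` for matrices over `R[T][X_i]`. -/
noncomputable def JT (e : Matrix ι ι (MvPolynomial σ (Polynomial R))) (he : e * e = e) : Ideal R :=
  J (e.map (MvPolynomial.optionEquivRight R σ).symm.toRingEquiv.toRingHom) (map_mul_self he _)

lemma conjMod_of_JT [Finite σ] {e : Matrix ι ι (MvPolynomial σ (Polynomial R))} {he : e * e = e}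
    {C : Type} [CommRing C] [Algebra R C] (ζ η : MvPolynomial σ (Polynomial R) →ₐ[R] C)
    (𝔟 : Ideal C) (h : ∀ x, η x - ζ x ∈ (JT e he).map (algebraMap R C) * 𝔟) :
    ConjMod 𝔟 (e.map ζ) (e.map η) := by
  set g : MvPolynomial (Option σ) R → MvPolynomial σ (Polynomial R) :=
    ⇑(MvPolynomial.optionEquivRight R σ) with hg
  have key := conjMod_of_mem_J (he := map_mul_self he _) (fun i => ζ (g (MvPolynomial.X i)))
    (fun i => η (g (MvPolynomial.X i)) - ζ (g (MvPolynomial.X i))) 𝔟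
    (fun i => h (g (MvPolynomial.X i)))
  have h2 : ∀ ξ : MvPolynomial σ (Polynomial R) →ₐ[R] C,
      (e.map (MvPolynomial.optionEquivRight R σ).symm.toRingEquiv.toRingHom).map
        (MvPolynomial.aeval (R := R) fun i => ξ (g (MvPolynomial.X i))) = e.map ξ := by
    intro ξ
    ext i j
    simp only [Matrix.map_apply]
    have : (MvPolynomial.aeval (R := R) fun i => ξ (g (MvPolynomial.X i))) =
        ξ.comp (MvPolynomial.optionEquivRight R σ).toAlgHom := by
      apply MvPolynomial.algHom_ext
      intro i
      simp [hg]
    rw [this]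
    exact congrArg ξ ((MvPolynomial.optionEquivRight R σ).apply_symm_apply (e i j))
  have h3 : (fun i => ζ (g (MvPolynomial.X i))) +
      (fun i => η (g (MvPolynomial.X i)) - ζ (g (MvPolynomial.X i))) =
      fun i => η (g (MvPolynomial.X i)) := by
    ext i; simp
  rwa [h3, h2, h2] at key

open Polynomial in
theorem exists_um_of_monic_mod [Finite σ] {A : Type} [CommRing A] [Algebra R A]
    (χ : MvPolynomial σ R[X] ≃ₐ[R] A[X]) (hχ : χ (MvPolynomial.C X) = X)
    {e : Matrix ι ι (MvPolynomial σ R[X])} (he : e * e = e) {J : Ideal R} (hJ : J ≤ JT e he)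
    {φ : ι → MvPolynomial σ R[X]} {f : R[X]} (hf : f.Monic)
    (hfφ : MvPolynomial.C f ∈ Ideal.span (Set.range (φ ᵥ* e)))
    {U : ι → MvPolynomial σ R[X]} (hU : e *ᵥ U = U)
    (hUO : ∃ ρ : ι → MvPolynomial σ R[X], ρ ⬝ᵥ U - 1 ∈ Ideal.span {MvPolynomial.C X})
    {v1 : ι → MvPolynomial σ R[X]} (hv1 : e *ᵥ v1 = v1)
    (hv1O : ∃ ψ : ι → MvPolynomial σ R[X], ψ ⬝ᵥ v1 - 1 ∈ J.map (algebraMap R _))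
    (hv1U : ∀ i, v1 i - U i ∈ J.map (algebraMap R _) ⊔ Ideal.span {MvPolynomial.C X}) {d : ℕ}
    (h1 : (χ (φ ⬝ᵥ v1)).coeff d - 1 ∈ J.map (algebraMap R A))
    (h2 : ∀ k > d, (χ (φ ⬝ᵥ v1)).coeff k ∈ J.map (algebraMap R A)) :
    ∃ v : ι → MvPolynomial σ R[X], e *ᵥ v = v ∧ Um v ∧
      ∀ i, v i - U i ∈ Ideal.span {MvPolynomial.C X} := by
  choose j hj x' hx' hjx using fun i => Submodule.mem_sup.1 (hv1U i)
  choose x hx using fun i => Ideal.mem_span_singleton'.1 (hx' i)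
  set w := v1 - e *ᵥ j with hw
  have hej : ∀ i, (e *ᵥ j) i ∈ J.map (algebraMap R (MvPolynomial σ R[X])) := fun i =>
    Ideal.sum_mem _ fun k _ => Ideal.mul_mem_left _ _ (hj k)
  have hew : e *ᵥ w = w := by rw [hw, mulVec_sub, hv1, mulVec_mulVec, he]
  have hwU : w = U + (MvPolynomial.C X : MvPolynomial σ R[X]) • (e *ᵥ x) := by
    have : v1 = U + j + (MvPolynomial.C X : MvPolynomial σ R[X]) • x := by
      ext i : 1
      have h3 := hjx i
      rw [← hx i] at h3
      simp only [Pi.add_apply, Pi.smul_apply, smul_eq_mul]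
      linear_combination -h3
    rw [hw, ← hv1, this, mulVec_add, mulVec_add, hU, mulVec_smul]
    abel
  set g : MvPolynomial σ R[X] →+* A[X] := χ.toRingEquiv.toRingHom with hg
  have hgχ : ∀ x, g x = χ x := fun x => rfl
  have hgJ : ∀ x ∈ J.map (algebraMap R (MvPolynomial σ R[X])),
      g x ∈ (J.map (algebraMap R A)).map (C : A →+* A[X]) := by
    intro x hx
    rw [Ideal.map_map]
    have h3 := Ideal.mem_map_of_mem g hx
    rw [Ideal.map_map] at h3
    convert h3 using 2
    refine RingHom.ext fun r => ?_
    exact (χ.commutes r).symm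
  have hgX : ∀ x ∈ Ideal.span {(MvPolynomial.C X : MvPolynomial σ R[X])},
      g x ∈ Ideal.span {(X : A[X])} := by
    intro x hx
    obtain ⟨y, rfl⟩ := Ideal.mem_span_singleton'.1 hx
    rw [map_mul, hgχ (MvPolynomial.C X), hχ]
    exact Ideal.mul_mem_left _ _ (Ideal.mem_span_singleton_self _)
  have hgf : g (MvPolynomial.C f) = f.map (algebraMap R A) := by
    have : (g.comp MvPolynomial.C) = mapRingHom (algebraMap R A) := by
      apply Polynomial.ringHom_ext
      · intro r
        simpa [hgχ] using χ.commutes r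
      · rw [RingHom.comp_apply, hgχ, hχ]; simp
    exact congrArg (fun h => h f) this
  have hge : e.map g * e.map g = e.map g := map_mul_self he g
  have hφg : (g ∘ φ) ᵥ* e.map g = g ∘ (φ ᵥ* e) := by
    ext i; rw [← RingHom.map_vecMul]; rfl
  obtain ⟨t, t2, q, y, ht, ht2, hy, hq, ht2q, -, -⟩ := exists_lift_monic
    (J := J.map (algebraMap R A)) hge (φ := g ∘ φ) (w := g ∘ w) (f := f.map (algebraMap R A))
    (hf.map _) (by
      obtain ⟨ψ, hψ⟩ := mem_span_range.1 hfφ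
      exact mem_span_range.2 ⟨g ∘ ψ, by rw [hφg, comp_dotProduct, hψ, hgf]⟩)
    (by rw [map_mulVec_comp, hew])
    (by
      obtain ⟨ψ, hψ⟩ := hv1O
      refine ⟨g ∘ ψ, ?_⟩
      rw [comp_dotProduct, ← map_one g, ← map_sub]
      refine hgJ _ ?_
      rw [hw, dotProduct_sub, sub_right_comm]
      exact Ideal.sub_mem _ hψ (Ideal.sum_mem _ fun k _ => Ideal.mul_mem_left _ _ (hej k)))
    (d := d)
    (by
      have h3 := Ideal.mem_map_C_iff.1 (hgJ _ (show φ ⬝ᵥ (e *ᵥ j) ∈ _ from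
        Ideal.sum_mem _ fun k _ => Ideal.mul_mem_left _ _ (hej k))) d
      rw [comp_dotProduct, hw, dotProduct_sub, map_sub, coeff_sub, sub_right_comm]
      exact Ideal.sub_mem _ h1 h3)
    (by
      intro k hk
      have h3 := Ideal.mem_map_C_iff.1 (hgJ _ (show φ ⬝ᵥ (e *ᵥ j) ∈ _ from
        Ideal.sum_mem _ fun k _ => Ideal.mul_mem_left _ _ (hej k))) k
      rw [comp_dotProduct, hw, dotProduct_sub, map_sub, coeff_sub]
      exact Ideal.sub_mem _ (h2 k hk) h3)
  set b := t * t2 with hb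
  have hbJ : b - 1 ∈ J.map (algebraMap R A) := by
    rw [hb, show t * t2 - 1 = (t - 1) * t2 + (t2 - 1) by ring]
    exact Ideal.add_mem _ (Ideal.mul_mem_right _ _ ht) ht2
  set Γ : A[X] →ₐ[A] A[X] := aeval (C b * X) with hΓ
  have hΓsub : ∀ p, Γ p - p ∈ Ideal.span {C (b - 1) * (X : A[X])} := by
    intro p
    rw [Ideal.mem_span_singleton]
    have := sub_dvd_eval_sub (C b * X) (X : A[X]) (p.map C)
    rw [eval_map, eval_map, eval₂_C_X] at this
    rw [C_sub, C_1, sub_mul, one_mul]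
    exact this
  have hconj : ConjMod (Ideal.span {X}) ((e.map g).map Γ) (e.map g) := by
    have := conjMod_of_JT (he := he) ((Γ.restrictScalars R).comp χ.toAlgHom) χ.toAlgHom
      (Ideal.span {X}) (by
        intro x
        rw [← neg_sub]
        refine neg_mem ?_
        have h3 := hΓsub (χ x)
        obtain ⟨c, hc⟩ := Ideal.mem_span_singleton'.1 h3
        change Γ (χ x) - χ x ∈ _
        rw [← hc, mul_left_comm]
        refine Ideal.mul_mem_mul ?_ (Ideal.mul_mem_left _ _ (Ideal.mem_span_singleton_self _))
        have h4 := Ideal.mem_map_of_mem (C : A →+* A[X]) hbJ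
        rw [Ideal.map_map] at h4
        exact Ideal.map_mono hJ h4)
    exact this
  obtain ⟨v, hv, hvu, hvU⟩ := um_of_scaled_homotopy (T := (X : A[X])) (t := C t) (t2 := C t2)
    (e := e.map g) (U := g ∘ U) (z := C t • g ∘ (e *ᵥ x) + y) (q := q) (Γ := Γ.toRingHom)
    (by rw [map_mulVec_comp, hU])
    (by rw [mulVec_add, mulVec_smul, map_mulVec_comp, mulVec_mulVec, he, hy])
    (by
      rw [hq, hwU]
      ext i : 1
      simp only [Pi.add_apply, Pi.smul_apply, Function.comp, smul_eq_mul, map_add, map_mul]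
      rw [hgχ (MvPolynomial.C X), hχ]
      ring)
    (by simp [hΓ]) (by simp [hΓ]) (by simp [hΓ, hb])
    (by
      intro c
      refine Ideal.span_singleton_le_span_singleton.2 (Dvd.intro_left _ rfl) (hΓsub c))
    (by
      obtain ⟨ρ, hρ⟩ := hUO
      refine ⟨g ∘ ρ, ?_⟩
      rw [comp_dotProduct, ← map_one g, ← map_sub]
      exact hgX _ hρ)
    ht2q hconj
  set g' : A[X] →+* MvPolynomial σ R[X] := χ.symm.toRingEquiv.toRingHom with hg'
  have hgg : ∀ x, g' (g x) = x := fun x => χ.symm_apply_apply x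
  refine ⟨g' ∘ v, ?_, hvu.map g', ?_⟩
  · have h3 : (e.map g).map g' = e := by ext1 i j; exact hgg _
    have := map_mulVec_comp g' (e.map g) v
    rwa [h3, hv] at this
  · intro i
    obtain ⟨c, hc⟩ := Ideal.mem_span_singleton'.1 (hvU i)
    have h3 := congrArg g' hc
    rw [map_mul, map_sub, Function.comp, hgg] at h3
    refine Ideal.mem_span_singleton'.2 ⟨g' c, ?_⟩
    rw [← hgg (MvPolynomial.C X), hgχ (MvPolynomial.C X), hχ]
    exact h3

end Core

section SplitBasics

variable {ι : Type} [Fintype ι] [DecidableEq ι] {B : Type} [CommRing B]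

lemma Split.of_fintype {κ : Type} [Fintype κ] [DecidableEq κ] {e : Matrix ι ι B}
    {V : Matrix ι κ B} {Ψ : Matrix κ ι B} (h1 : V * Ψ = e) (h2 : Ψ * V = 1) : Split e := by
  let s := Fintype.equivFin κ
  refine ⟨Fintype.card κ, V.submatrix id s.symm, Ψ.submatrix s.symm id, ?_, ?_⟩
  · rw [Matrix.submatrix_mul_equiv, h1, submatrix_id_id]
  · rw [← Matrix.submatrix_mul _ _ _ id _ Function.bijective_id, h2,
      submatrix_one_equiv]

lemma Split.of_conjMod {𝔟 : Ideal B} {e₁ e₂ : Matrix ι ι B} (h : ConjMod 𝔟 e₁ e₂)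
    (hs : Split e₁) : Split e₂ := by
  obtain ⟨a, b, h1, h2, h3, h4, h5, h6, -⟩ := h
  obtain ⟨r, V, Ψ, h7, h8⟩ := hs
  refine ⟨r, b * V, Ψ * a, ?_, ?_⟩
  · rw [Matrix.mul_assoc, ← Matrix.mul_assoc V, h7, h1, h6]
  · rw [Matrix.mul_assoc, ← Matrix.mul_assoc a, h5, ← h7, Matrix.mul_assoc, h8, Matrix.mul_one, h8]

/-- Splitting off a unimodular element. -/
def sub1 (e : Matrix ι ι B) (q ψ : ι → B) : Matrix ι ι B := e - vecMulVec q ψ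

variable {e : Matrix ι ι B} {q ψ : ι → B}

lemma sub1_mulVec (x : ι → B) : sub1 e q ψ *ᵥ x = e *ᵥ x - (ψ ⬝ᵥ x) • q := by
  rw [sub1, sub_mulVec, vecMulVec_mulVec]
  congr 1
  ext i
  simp [mul_comm]

lemma vecMul_sub1 (x : ι → B) : x ᵥ* sub1 e q ψ = x ᵥ* e - (x ⬝ᵥ q) • ψ := by
  rw [sub1, vecMul_sub, vecMul_vecMulVec]

lemma sub1_mulVec_self (hq : e *ᵥ q = q) (h : ψ ⬝ᵥ q = 1) : sub1 e q ψ *ᵥ q = 0 := by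
  rw [sub1_mulVec, hq, h, one_smul, sub_self]

lemma vecMul_sub1_self (hψ : ψ ᵥ* e = ψ) (h : ψ ⬝ᵥ q = 1) : ψ ᵥ* sub1 e q ψ = 0 := by
  rw [vecMul_sub1, hψ, h, one_smul, sub_self]

lemma mul_sub1 (he : e * e = e) (hq : e *ᵥ q = q) : e * sub1 e q ψ = sub1 e q ψ := by
  rw [sub1, mul_sub, he, mul_vecMulVec, hq]

lemma sub1_mul (he : e * e = e) (hψ : ψ ᵥ* e = ψ) : sub1 e q ψ * e = sub1 e q ψ := by
  rw [sub1, sub_mul, he, vecMulVec_mul, hψ]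

lemma sub1_mul_self (he : e * e = e) (hq : e *ᵥ q = q) (hψ : ψ ᵥ* e = ψ) (h : ψ ⬝ᵥ q = 1) :
    sub1 e q ψ * sub1 e q ψ = sub1 e q ψ := by
  change (e - vecMulVec q ψ) * sub1 e q ψ = _
  rw [sub_mul, mul_sub1 he hq, vecMulVec_mul, vecMul_sub1_self hψ h]
  simp [vecMulVec_eq (Fin 1)]

lemma sub1_map {B' : Type} [CommRing B'] (f : B →+* B') :
    (sub1 e q ψ).map f = sub1 (e.map f) (f ∘ q) (f ∘ ψ) := by
  ext i j
  simp [sub1, vecMulVec_apply]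

lemma exists_dual (hq : e *ᵥ q = q) (hu : Um q) (he : e * e = e) :
    ∃ ψ : ι → B, ψ ᵥ* e = ψ ∧ ψ ⬝ᵥ q = 1 := by
  obtain ⟨ψ, hψ⟩ := hu
  exact ⟨ψ ᵥ* e, by rw [vecMul_vecMul, he], by rw [vecMul_dotProduct, hq, hψ]⟩

lemma Split.of_sub1 (hq : e *ᵥ q = q) (hψ : ψ ᵥ* e = ψ) (h : ψ ⬝ᵥ q = 1)
    (hs : Split (sub1 e q ψ)) : Split e := by
  obtain ⟨r, V, Ψ, h1, h2⟩ := hs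
  have h3 : Ψ *ᵥ q = 0 := by
    have := sub1_mulVec_self hq h
    rw [← h1, ← mulVec_mulVec] at this
    rw [← one_mulVec (Ψ *ᵥ q), ← h2, ← mulVec_mulVec, this, mulVec_zero]
  have h4 : ψ ᵥ* V = 0 := by
    have := vecMul_sub1_self hψ h
    rw [← h1, ← vecMul_vecMul] at this
    rw [← vecMul_one (ψ ᵥ* V), ← h2, ← vecMul_vecMul, this, zero_vecMul]
  refine Split.of_fintype (κ := Unit ⊕ Fin r) (V := fromCols (replicateCol Unit q) V)
    (Ψ := fromRows (replicateRow Unit ψ) Ψ) ?_ ?_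
  · rw [fromCols_mul_fromRows, h1, ← vecMulVec_eq, sub1]
    abel
  · rw [fromRows_mul_fromCols, h2, ← fromBlocks_one]
    congr 1
    · ext i j; simpa [Matrix.mul_apply, dotProduct] using h
    · ext i j; simpa [Matrix.mul_apply, vecMul, dotProduct] using congrFun h4 j
    · ext i j; simpa [Matrix.mul_apply, mulVec, dotProduct] using congrFun h3 i

lemma idem_eq_zero_of_nilpotent (he : e * e = e) (hn : ∀ i j, IsNilpotent (e i j)) : e = 0 := by
  have h1 : IsUnit (1 - e) := by
    rw [Matrix.isUnit_iff_isUnit_det]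
    have h2 : (Ideal.Quotient.mk (nilradical B)) (1 - e).det = 1 := by
      rw [RingHom.map_det, map_sub, map_one]
      have : (Ideal.Quotient.mk (nilradical B)).mapMatrix e = 0 := by
        ext i j
        exact Ideal.Quotient.eq_zero_iff_mem.2 (hn i j)
      rw [this, sub_zero, det_one]
    have h3 : IsNilpotent ((1 - e).det - 1) := by
      rw [← mem_nilradical, ← Ideal.Quotient.eq, h2, map_one]
    simpa using h3.isUnit_add_one
  have h2 : (1 - e) * e = (1 - e) * 0 := by rw [sub_mul, one_mul, he, sub_self, mul_zero]
  exact h1.mul_left_cancel h2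

/-- Splittings lift along surjections with nil kernel. -/
lemma Split.of_nil {B' : Type} [CommRing B'] (f : B →+* B') (hf : Function.Surjective f)
    (hk : ∀ x, f x = 0 → IsNilpotent x) (he : e * e = e) (hs : Split (e.map f)) : Split e := by
  obtain ⟨r, V', Ψ', h1, h2⟩ := hs
  choose g hg using hf
  have hgm : ∀ {α β : Type} (M : Matrix α β B'), (M.map g).map f = M := fun M => by
    ext i j; exact hg _
  set V := e * V'.map g with hV
  set Ψ := Ψ'.map g * e with hΨ
  have hVf : V.map f = V' := by
    rw [hV, Matrix.map_mul, hgm, ← h1, Matrix.mul_assoc, h2, Matrix.mul_one]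
  have hΨf : Ψ.map f = Ψ' := by
    rw [hΨ, Matrix.map_mul, hgm, ← h1, ← Matrix.mul_assoc, h2, Matrix.one_mul]
  have hu : IsUnit (Ψ * V) := by
    rw [Matrix.isUnit_iff_isUnit_det]
    have : f (Ψ * V).det = 1 := by
      rw [RingHom.map_det, RingHom.mapMatrix_apply, Matrix.map_mul, hVf, hΨf, h2, det_one]
    have h3 : IsNilpotent ((Ψ * V).det - 1) := hk _ (by rw [map_sub, this, map_one, sub_self])
    simpa using h3.isUnit_add_one
  obtain ⟨u, hu⟩ := hu
  set W : Matrix (Fin r) (Fin r) B := ↑(u⁻¹) with hW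
  have hWu : W * (Ψ * V) = 1 := by rw [← hu, hW]; exact u.inv_mul
  have heV : e * V = V := by rw [hV, ← Matrix.mul_assoc, he]
  have hΨe : Ψ * e = Ψ := by rw [hΨ, Matrix.mul_assoc, he]
  have hWf : W.map f = 1 := by
    have := congrArg (fun M => M.map f) hWu
    simp only [Matrix.map_mul, hVf, hΨf, h2, Matrix.mul_one] at this
    rw [this]
    exact Matrix.map_one f (map_zero f) (map_one f)
  set e' := V * (W * Ψ) with he'
  have hee' : e * e' = e' := by rw [he', ← Matrix.mul_assoc, heV]
  have he'e : e' * e = e' := by rw [he', Matrix.mul_assoc V, Matrix.mul_assoc W, hΨe]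
  have hee₂ : e' * e' = e' := by
    rw [he', Matrix.mul_assoc, Matrix.mul_assoc W, ← Matrix.mul_assoc Ψ, ← Matrix.mul_assoc W,
      hWu, Matrix.one_mul]
  have h0 : e - e' = 0 := by
    refine idem_eq_zero_of_nilpotent ?_ fun i j => hk _ ?_
    · rw [sub_mul, mul_sub, mul_sub, he, hee', he'e, hee₂, sub_self, sub_zero]
    · have : e'.map f = e.map f := by
        rw [he', Matrix.map_mul (L := V), Matrix.map_mul (L := W), hVf, hWf, hΨf, Matrix.one_mul,
            h1]
      have := congrFun (congrFun this i) j
      simp only [Matrix.map_apply] at this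
      rw [Matrix.sub_apply, map_sub, this, sub_self]
  exact ⟨r, V, W * Ψ, (sub_eq_zero.1 h0).symm, by rw [Matrix.mul_assoc, hWu]⟩

end SplitBasics

section Horrocks

open Polynomial

variable {A : Type} [CommRing A] [IsLocalRing A]

open IsLocalRing in
lemma exists_monic_value {ι : Type} [Fintype ι] [DecidableEq ι] {e : Matrix ι ι A[X]}
    (he : e * e = e) {φ : ι → A[X]} (hφ : φ ᵥ* e = φ) {f : A[X]} (hf : f.Monic)
    (hfφ : f ∈ Ideal.span (Set.range φ)) :
    ∃ (q ψ : ι → A[X]) (h : A[X]), e *ᵥ q = q ∧ ψ ᵥ* e = ψ ∧ ψ ⬝ᵥ q = 1 ∧ φ ⬝ᵥ q = h ∧ h.Monic := by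
  set π : A[X] →+* (ResidueField A)[X] := mapRingHom (residue A) with hπ
  have hπs : Function.Surjective π := map_surjective _ residue_surjective
  have hπk : ∀ p, π p = 0 → ∀ n, p.coeff n ∈ maximalIdeal A := by
    intro p hp n
    rw [← residue_eq_zero_iff, ← coeff_map]
    exact congrArg (fun p => coeff p n) hp
  have hf0 : π f ≠ 0 := (hf.map _).ne_zero
  obtain ⟨d, hdm, hd⟩ : ∃ d : (ResidueField A)[X], d.Monic ∧
      Ideal.span (Set.range (π ∘ φ)) = Ideal.span {d} := by
    obtain ⟨d, hd⟩ := (IsPrincipalIdealRing.principal (Ideal.span (Set.range (π ∘ φ)))).principal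
    have hfd : π f ∈ Ideal.span {d} := by
      rw [Ideal.span, ← hd]
      obtain ⟨ψ, hψ⟩ := mem_span_range.1 hfφ
      exact mem_span_range.2 ⟨π ∘ ψ, by rw [comp_dotProduct, hψ]⟩
    have hd0 : d ≠ 0 := by
      rintro rfl
      exact hf0 (by simpa using hfd)
    refine ⟨d * C (d.leadingCoeff)⁻¹, monic_mul_leadingCoeff_inv hd0, ?_⟩
    rw [Ideal.span_singleton_mul_right_unit]
    · exact hd
    · rw [isUnit_C]
      exact (isUnit_iff_ne_zero.2 (leadingCoeff_ne_zero.2 hd0)).inv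
  obtain ⟨c, hc⟩ := mem_span_range.1 (hd ▸ Ideal.mem_span_singleton_self d :
    d ∈ Ideal.span (Set.range (π ∘ φ)))
  have hρ : ∀ i, ∃ ρ, ρ * d = π (φ i) := fun i => Ideal.mem_span_singleton'.1 (by
    rw [← hd]; exact Ideal.subset_span ⟨i, rfl⟩)
  choose ρ hρ using hρ
  choose g hg using hπs
  have hgc : ∀ v : ι → (ResidueField A)[X], π ∘ (g ∘ v) = v := fun v => by ext1 i; exact hg _
  set w := e *ᵥ (g ∘ c) with hw
  have hew : e *ᵥ w = w := by rw [hw, mulVec_mulVec, he]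
  have hφw : π (φ ⬝ᵥ w) = d := by
    rw [hw, ← vecMul_dotProduct, hφ, ← comp_dotProduct, hgc, dotProduct_comm, hc]
  have hρw : π ((g ∘ ρ) ⬝ᵥ w) = 1 := by
    rw [← comp_dotProduct, hgc]
    refine hdm.isRegular.left (?_ : d * _ = d * 1)
    rw [← hφw, ← comp_dotProduct, mul_one, ← smul_eq_mul, ← smul_dotProduct]
    congr 1
    ext1 i
    rw [comp_dotProduct, hφw, Function.comp_apply, ← hρ i, Pi.smul_apply, smul_eq_mul, mul_comm]
  obtain ⟨t, t2, q, y, ht, ht2, hy, hq, ht2q, hqd, hqc⟩ := exists_lift_monic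
    (J := maximalIdeal A) he (φ := φ) hf (by rwa [hφ]) hew
    ⟨g ∘ ρ, Ideal.mem_map_C_iff.2 (hπk _ (by rw [map_sub, hρw, map_one, sub_self]))⟩
    (d := d.natDegree)
    (by
      rw [← residue_eq_zero_iff, map_sub, ← coeff_map, ← coe_mapRingHom, ← hπ, hφw, map_one,
        hdm.coeff_natDegree, sub_self])
    (fun k hk => by
      rw [← residue_eq_zero_iff, ← coeff_map, ← coe_mapRingHom, ← hπ, hφw]
      exact coeff_eq_zero_of_natDegree_lt hk)
  have hunit : ∀ u : A, u - 1 ∈ maximalIdeal A → IsUnit u := by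
    intro u hu
    by_contra h
    have := (maximalIdeal A).sub_mem ((mem_maximalIdeal u).2 h) hu
    rw [sub_sub_cancel] at this
    exact (Ideal.ne_top_iff_one _).1 (Ideal.IsPrime.ne_top inferInstance) this
  have heq : e *ᵥ q = q := by rw [hq, mulVec_add, mulVec_smul, mulVec_smul, hew, hy]
  have hum : Um q := by
    rw [um_iff]
    exact Ideal.eq_top_of_isUnit_mem _ ht2q (isUnit_C.2 (hunit _ ht2))
  obtain ⟨u, hu⟩ := hunit _ hqc
  have hum' : Um ((C (↑u⁻¹ : A) : A[X]) • q) := by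
    obtain ⟨ψ, hψ⟩ := hum
    refine ⟨(C (u : A) : A[X]) • ψ, ?_⟩
    rw [smul_dotProduct, dotProduct_smul, hψ, smul_eq_mul, smul_eq_mul, mul_one, ← C_mul,
      Units.mul_inv, C_1]
  have heq' : e *ᵥ ((C (↑u⁻¹ : A) : A[X]) • q) = (C (↑u⁻¹ : A) : A[X]) • q := by
    rw [mulVec_smul, heq]
  obtain ⟨ψ, hψe, hψ⟩ := exists_dual heq' hum' he
  refine ⟨_, ψ, _, heq', hψe, hψ, rfl, ?_⟩
  refine monic_of_natDegree_le_of_coeff_eq_one d.natDegree ?_ ?_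
  · rw [dotProduct_smul, smul_eq_mul]
    exact (natDegree_C_mul_le _ _).trans hqd
  · rw [dotProduct_smul, smul_eq_mul, coeff_C_mul, ← hu, Units.inv_mul]

/-- Horrocks' theorem. -/
theorem split_of_monic (r : ℕ) {ι : Type} [Fintype ι] [DecidableEq ι] (e : Matrix ι ι A[X])
    (he : e * e = e) (f : A[X]) (hf : f.Monic) (Φ : Matrix (Fin r) ι A[X])
    (P : Matrix ι (Fin r) A[X]) (h1 : Φ * P = f • (1 : Matrix (Fin r) (Fin r) A[X]))
    (h2 : P * Φ = f • e) (h3 : e * P = P) (h4 : Φ * e = Φ) : Split e := by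
  induction r generalizing e f with
  | zero =>
    refine ⟨0, 0, 0, ?_, Subsingleton.elim _ _⟩
    have h5 : P * Φ = 0 := by ext i j; simp [Matrix.mul_apply]
    ext1 i j
    have := congrFun (congrFun h2 i) j
    rw [h5, Matrix.smul_apply, Matrix.zero_apply, smul_eq_mul] at this
    rw [(hf.mem_nonZeroDivisors.1 _ this.symm), Matrix.zero_mul, Matrix.zero_apply]
  | succ r ih =>
    set φ : ι → A[X] := Φ 0 with hφ
    have hφe : φ ᵥ* e = φ := by
      ext1 j; exact congrFun (congrFun h4 0) j
    have hφP : ∀ j, φ ⬝ᵥ (fun i => P i j) = if j = 0 then f else 0 := by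
      intro j
      have := congrFun (congrFun h1 0) j
      rw [Matrix.smul_apply, one_apply, smul_eq_mul, mul_ite, mul_one, mul_zero] at this
      refine (show φ ⬝ᵥ (fun i => P i j) = (Φ * P) 0 j from rfl).trans (this.trans ?_)
      simp only [eq_comm]
    have hfφ : f ∈ Ideal.span (Set.range φ) :=
      mem_span_range.2 ⟨fun i => P i 0, by rw [dotProduct_comm, hφP, if_pos rfl]⟩
    obtain ⟨q, ψ, h, hq, hψ, hψq, hh, hhm⟩ := exists_monic_value he hφe hf hfφ
    set e' := sub1 e q ψ with he'
    have hqe' : e' *ᵥ q = 0 := sub1_mulVec_self hq hψq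
    have hee₂ : e' * e' = e' := sub1_mul_self he hq hψ hψq
    have hee' : e * e' = e' := mul_sub1 he hq
    have he'e : e' * e = e' := sub1_mul he hψ
    set Φ' : Matrix (Fin r) ι A[X] := h • Φ.submatrix Fin.succ id -
      vecMulVec (Φ.submatrix Fin.succ id *ᵥ q) φ with hΦ'
    set P' : Matrix ι (Fin r) A[X] := P.submatrix id Fin.succ with hP'
    have hΦ'q : Φ' *ᵥ q = 0 := by
      rw [hΦ', sub_mulVec, smul_mulVec, vecMulVec_mulVec, hh]
      ext i : 1
      simp
    have hΦ'e : Φ' * e = Φ' := by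
      rw [hΦ', Matrix.sub_mul, Matrix.smul_mul, vecMulVec_mul, hφe]
      congr 2
      ext1 i j
      exact congrFun (congrFun h4 i.succ) j
    have hΦe : Φ' * e' = Φ' := by
      rw [he', sub1, Matrix.mul_sub, hΦ'e, mul_vecMulVec, hΦ'q]
      simp [vecMulVec_eq (Fin 1)]
    have hφP' : φ ᵥ* P' = 0 := by
      ext j : 1
      have := hφP j.succ
      rw [if_neg (Fin.succ_ne_zero j)] at this
      exact this
    have hsum : P' * Φ.submatrix Fin.succ id = f • e - vecMulVec (fun i => P i 0) φ := by
      rw [← h2]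
      ext1 i j
      rw [Matrix.sub_apply, Matrix.mul_apply, Matrix.mul_apply, Fin.sum_univ_succ, vecMulVec_apply]
      simp [hP', hφ]
    refine Split.of_sub1 hq hψ hψq (ih e' hee₂ (h * f) (hhm.mul hf) Φ' (e' * P') ?_ ?_ ?_ ?_)
    · rw [← Matrix.mul_assoc, hΦe, hΦ', Matrix.sub_mul, vecMulVec_mul, hφP', Matrix.smul_mul]
      ext1 i j
      have := congrFun (congrFun h1 i.succ) j.succ
      rw [Matrix.smul_apply, smul_eq_mul, one_apply] at this
      simp only [Fin.succ_inj] at this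
      simp only [Matrix.sub_apply, Matrix.smul_apply, smul_eq_mul, vecMulVec_apply, Pi.zero_apply,
        mul_zero, sub_zero, mul_assoc, one_apply]
      rw [← this]
      rfl
    · rw [Matrix.mul_assoc, hΦ', Matrix.mul_sub, Matrix.mul_smul, hsum, mul_vecMulVec,
        mulVec_mulVec, hsum,
        sub_mulVec, smul_mulVec, hq, vecMulVec_mulVec, hh]
      have : h • (f • e - vecMulVec (fun i => P i 0) φ) -
          vecMulVec (f • q - MulOpposite.op h • fun i => P i 0) φ =
            (h * f) • e - vecMulVec (f • q) φ := by
        ext1 i j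
        simp [vecMulVec_apply]
        ring
      rw [this, mul_sub, Matrix.mul_smul, he'e, mul_vecMulVec, mulVec_smul, hqe', smul_zero]
      simp [vecMulVec_eq (Fin 1)]
    · rw [← Matrix.mul_assoc, hee₂]
    · exact hΦe

end Horrocks

section Clear

open MvPolynomial

variable {S L : Type} [CommRing S] [CommRing L] [Algebra S L] {σ : Type}

lemma exists_clear (D : Submonoid S) [IsLocalization D L] {κ : Type} [Finite κ]
    (v : κ → MvPolynomial σ L) : ∃ m ∈ D, ∃ v0 : κ → MvPolynomial σ S,
      ∀ k, map (algebraMap S L) (v0 k) = C (algebraMap S L m) * v k := by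
  letI := MvPolynomial.algebraMvPolynomial (σ := σ) (R := S) (S := L)
  have := MvPolynomial.isLocalization (σ := σ) D L
  obtain ⟨⟨b, hb⟩, h⟩ := IsLocalization.exist_integer_multiples_of_finite (D.map (C (σ := σ))) v
  obtain ⟨m, hm, rfl⟩ := hb
  choose v0 hv0 using h
  refine ⟨m, hm, v0, fun k => ?_⟩
  have := hv0 k
  rw [Algebra.smul_def] at this
  have h2 : map (algebraMap S L) (v0 k) = map (algebraMap S L) (C m) * v k := this
  rwa [map_C] at h2

lemma exists_eq_of_map_eq (D : Submonoid S) [IsLocalization D L] {κ : Type} [Finite κ]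
    {v w : κ → MvPolynomial σ S} (h : ∀ k, map (algebraMap S L) (v k) =
        map (algebraMap S L) (w k)) :
    ∃ m ∈ D, ∀ k, C m * v k = C m * w k := by
  letI := MvPolynomial.algebraMvPolynomial (σ := σ) (R := S) (S := L)
  have := MvPolynomial.isLocalization (σ := σ) D L
  have h1 : ∀ k, ∃ m ∈ D, C m * v k = C m * w k := by
    intro k
    obtain ⟨⟨c, hc⟩, hc2⟩ := (IsLocalization.eq_iff_exists (D.map (C (σ := σ)))
      (MvPolynomial σ L)).1 (h k)
    obtain ⟨m, hm, rfl⟩ := hc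
    exact ⟨m, hm, hc2⟩
  choose m hm hmk using h1
  cases nonempty_fintype κ
  refine ⟨∏ k, m k, D.prod_mem fun k _ => hm k, fun k => ?_⟩
  classical
  rw [← Finset.prod_erase_mul _ _ (Finset.mem_univ k), C_mul, mul_assoc, hmk, mul_assoc]

lemma exists_clear_split (D : Submonoid S) [IsLocalization D L] {ι : Type} [Fintype ι]
    [DecidableEq ι] {e : Matrix ι ι (MvPolynomial σ S)} (he : e * e = e)
    (hs : Split (e.map (map (algebraMap S L)))) :
    ∃ δ ∈ D, ∃ (r : ℕ) (V : Matrix ι (Fin r) (MvPolynomial σ S))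
      (Ψ : Matrix (Fin r) ι (MvPolynomial σ S)), e * V = V ∧ Ψ * e = Ψ ∧
      V * Ψ = (C δ : MvPolynomial σ S) • e ∧ Ψ * V = (C δ : MvPolynomial σ S) • 1 := by
  obtain ⟨r, V', Ψ', h1, h2⟩ := hs
  obtain ⟨m1, hm1, V0, hV0⟩ := exists_clear D fun k : ι × Fin r => V' k.1 k.2
  obtain ⟨m2, hm2, Ψ0, hΨ0⟩ := exists_clear D fun k : Fin r × ι => Ψ' k.1 k.2
  set g := algebraMap S L with hg
  set V1 := e * Matrix.of fun i j => V0 (i, j) with hV1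
  set Ψ1 := (Matrix.of fun i j => Ψ0 (i, j)) * e with hΨ1
  have hV1m : V1.map (map g) = (C (g m1) : MvPolynomial σ L) • V' := by
    have : (Matrix.of fun i j => V0 (i, j)).map (map g) = (C (g m1) : MvPolynomial σ L) • V' := by
      ext1 i j; exact hV0 (i, j)
    rw [hV1, Matrix.map_mul, this, Matrix.mul_smul, ← h1, Matrix.mul_assoc, h2, Matrix.mul_one]
  have hΨ1m : Ψ1.map (map g) = (C (g m2) : MvPolynomial σ L) • Ψ' := by
    have : (Matrix.of fun i j => Ψ0 (i, j)).map (map g) = (C (g m2) : MvPolynomial σ L) • Ψ' := by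
      ext1 i j; exact hΨ0 (i, j)
    rw [hΨ1, Matrix.map_mul, this, Matrix.smul_mul, ← h1, ← Matrix.mul_assoc, h2, Matrix.one_mul]
  obtain ⟨m3, hm3, h3⟩ := exists_eq_of_map_eq (L := L) D
    (v := fun k : ι × ι => (V1 * Ψ1) k.1 k.2)
    (w := fun k : ι × ι => ((C (m1 * m2) : MvPolynomial σ S) • e) k.1 k.2) (by
      rintro ⟨i, j⟩
      have : (V1 * Ψ1).map (map g) = ((C (m1 * m2) : MvPolynomial σ S) • e).map (map g) := by
        rw [Matrix.map_mul, hV1m, hΨ1m, Matrix.smul_mul, Matrix.mul_smul, h1, smul_smul]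
        ext1 i j
        simp
      exact congrFun (congrFun this i) j)
  obtain ⟨m4, hm4, h4⟩ := exists_eq_of_map_eq (L := L) D
    (v := fun k : Fin r × Fin r => (Ψ1 * V1) k.1 k.2)
    (w := fun k : Fin r × Fin r => ((C (m1 * m2) : MvPolynomial σ S) • (1 : Matrix (Fin r) (Fin r)
        (MvPolynomial σ S))) k.1 k.2) (by
      rintro ⟨i, j⟩
      have : (Ψ1 * V1).map (map g) =
          ((C (m1 * m2) : MvPolynomial σ S) • (1 : Matrix (Fin r) (Fin r) (MvPolynomial σ S))).map
              (map g) := by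
        rw [Matrix.map_mul, hV1m, hΨ1m, Matrix.smul_mul, Matrix.mul_smul, h2, smul_smul]
        ext1 i j
        rcases eq_or_ne i j with rfl | h <;> simp [*, mul_comm]
      exact congrFun (congrFun this i) j)
  refine ⟨m3 * m4 * (m1 * m2), D.mul_mem (D.mul_mem hm3 hm4) (D.mul_mem hm1 hm2), r,
    (C (m3 * m4) : MvPolynomial σ S) • V1, Ψ1, ?_, ?_, ?_, ?_⟩
  · rw [Matrix.mul_smul, hV1, ← Matrix.mul_assoc, he]
  · rw [hΨ1, Matrix.mul_assoc, he]
  · ext1 i j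
    have := h3 (i, j)
    rw [Matrix.smul_mul]
    simp only [Matrix.smul_apply, smul_eq_mul, C_mul] at this ⊢
    linear_combination C m4 * this
  · ext1 i j
    have := h4 (i, j)
    rw [Matrix.mul_smul]
    simp only [Matrix.smul_apply, smul_eq_mul, C_mul] at this ⊢
    linear_combination C m3 * this

end Clear

lemma split_of_field {K ι : Type} [Field K] [Fintype ι] [DecidableEq ι] {e : Matrix ι ι K}
    (he : e * e = e) : Split e := by
  set W := LinearMap.range e.mulVecLin with hW
  have heW : ∀ x ∈ W, e *ᵥ x = x := by
    rintro _ ⟨y, rfl⟩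
    rw [mulVecLin_apply, mulVec_mulVec, he]
  let b := Module.finBasis K W
  let p : (ι → K) →ₗ[K] W := e.mulVecLin.rangeRestrict
  have hp : W.subtype ∘ₗ p = e.mulVecLin := rfl
  have hp' : p ∘ₗ W.subtype = LinearMap.id := by
    ext1 x
    exact Subtype.ext (heW x x.2)
  refine ⟨Module.finrank K W, LinearMap.toMatrix' (W.subtype ∘ₗ b.equivFun.symm.toLinearMap),
    LinearMap.toMatrix' (b.equivFun.toLinearMap ∘ₗ p), ?_, ?_⟩
  · have : (W.subtype ∘ₗ b.equivFun.symm.toLinearMap) ∘ₗ (b.equivFun.toLinearMap ∘ₗ p) =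
        e.mulVecLin := by
      rw [← hp]
      refine LinearMap.ext fun x => ?_
      simp
    rw [← LinearMap.toMatrix'_comp, this]
    rw [← Matrix.toLin'_apply', LinearMap.toMatrix'_toLin']
  · have : (b.equivFun.toLinearMap ∘ₗ p) ∘ₗ (W.subtype ∘ₗ b.equivFun.symm.toLinearMap) =
        LinearMap.id := by
      refine LinearMap.ext fun x => ?_
      have := LinearMap.congr_fun hp' (b.equivFun.symm x)
      simp only [LinearMap.comp_apply, LinearMap.id_apply, LinearEquiv.coe_coe] at this ⊢
      rw [this, LinearEquiv.apply_symm_apply]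
    rw [← LinearMap.toMatrix'_comp, this, LinearMap.toMatrix'_id]

section Chi

open Polynomial

variable {R σ : Type} [CommRing R]

/-- The change of variables `X_i ↦ X_i + w_i(T)` as an isomorphism `R[T][X] ≃ R[X][T]`. -/
noncomputable def chi (w : σ → R[X]) : MvPolynomial σ R[X] ≃ₐ[R] (MvPolynomial σ R)[X] :=
  AlgEquiv.ofRingEquiv (f := RingEquiv.ofRingHom
    (MvPolynomial.eval₂Hom (mapRingHom (MvPolynomial.C (σ := σ) (R := R)))
      fun i => C (MvPolynomial.X i) + (w i).map MvPolynomial.C)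
    (eval₂RingHom (MvPolynomial.eval₂Hom (MvPolynomial.C.comp C)
      fun i => MvPolynomial.X i - MvPolynomial.C (w i)) (MvPolynomial.C X))
    (by
      apply Polynomial.ringHom_ext'
      · apply MvPolynomial.ringHom_ext
        · intro a; simp
        · intro i; simp
      · simp)
    (by
      have h : ((eval₂RingHom (MvPolynomial.eval₂Hom (MvPolynomial.C.comp C)
          fun i => MvPolynomial.X i - MvPolynomial.C (w i)) (MvPolynomial.C X)).comp
          (mapRingHom (MvPolynomial.C (σ := σ) (R := R)))) = MvPolynomial.C := by
        apply Polynomial.ringHom_ext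
        · intro a; simp
        · simp
      have h' := fun p => congrArg (fun f => f p) h
      apply MvPolynomial.ringHom_ext
      · intro p
        rw [RingHom.comp_apply, MvPolynomial.eval₂Hom_C]
        exact h' p
      · intro i
        rw [RingHom.comp_apply, MvPolynomial.eval₂Hom_X', map_add]
        have := h' (w i)
        simp only [RingHom.comp_apply, coe_mapRingHom] at this
        rw [this]
        simp))
    (fun r => by
      change MvPolynomial.eval₂Hom _ _ (algebraMap R (MvPolynomial σ R[X]) r) = _
      rw [MvPolynomial.algebraMap_apply, MvPolynomial.eval₂Hom_C]
      simp [Polynomial.algebraMap_apply, MvPolynomial.algebraMap_eq])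

lemma chi_C (w : σ → R[X]) (f : R[X]) :
    chi w (MvPolynomial.C f) = f.map (MvPolynomial.C (σ := σ)) :=
  MvPolynomial.eval₂Hom_C _ _ _

lemma chi_X (w : σ → R[X]) (i : σ) :
    chi w (MvPolynomial.X i) = C (MvPolynomial.X i) + (w i).map MvPolynomial.C :=
  MvPolynomial.eval₂Hom_X' _ _ _

lemma chi_C_X (w : σ → R[X]) : chi w (MvPolynomial.C X) = X := by
  rw [chi_C, map_X]

end Chi

section QuillenSuslin

open Polynomial

/-- Splitting over `A[T]` from local splittings, given that the restriction to `T = 0` splits. -/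
lemma split_of_local {A : Type} [CommRing A] {ι : Type} [Fintype ι] [DecidableEq ι]
    {e : Matrix ι ι A[X]} (he : e * e = e)
    (h0 : Split (e.map (evalRingHom (0 : A))))
    (h : ∀ (M : Ideal A) [M.IsMaximal],
      Split (e.map (mapRingHom (algebraMap A (Localization.AtPrime M))))) : Split e := by
  set g : A[X] →+* MvPolynomial Unit A := (MvPolynomial.uniqueAlgEquiv A
      Unit).symm.toRingEquiv.toRingHom
    with hg
  have hgC : ∀ a, g (C a) = MvPolynomial.C a := fun a => by
    simp [hg]
  have hgX : g X = MvPolynomial.X () := by simp [hg]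
  have hJ : J (e.map g) (map_mul_self he g) = ⊤ := by
    by_contra hne
    obtain ⟨M, hM, hJM⟩ := Ideal.exists_le_maximal _ hne
    obtain ⟨t, ht, htJ⟩ := exists_mem_J_of_split (L := Localization.AtPrime M) M.primeCompl
      (he := map_mul_self he g) (by
        have := (h M).map ((MvPolynomial.uniqueAlgEquiv
          (Localization.AtPrime M) Unit).symm.toRingEquiv.toRingHom)
        convert this using 1
        ext1 i j
        have h2 : (MvPolynomial.map (algebraMap A (Localization.AtPrime M))).comp g =
          ((MvPolynomial.uniqueAlgEquiv (Localization.AtPrime M)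
              Unit).symm.toRingEquiv.toRingHom).comp
            (mapRingHom (algebraMap A (Localization.AtPrime M))) := by
          apply Polynomial.ringHom_ext
          · intro a; simp [hgC]
          · simp [hgX]
        exact congrArg (fun f => f (e i j)) h2)
    exact ht (hJM htJ)
  have h1 := conjMod_of_mem_J (he := map_mul_self he g) (0 : Unit → A[X]) (fun _ => X) ⊤
    (fun _ => by rw [hJ, Ideal.map_top, Ideal.mul_top]; trivial)
  have hA : (e.map g).map (MvPolynomial.aeval (R := A) (0 : Unit → A[X])) =
      (e.map (evalRingHom (0 : A))).map (C : A →+* A[X]) := by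
    ext1 i j
    have h2 : (MvPolynomial.aeval (R := A) (0 : Unit → A[X])).toRingHom.comp g =
        (C : A →+* A[X]).comp (evalRingHom (0 : A)) := by
      apply Polynomial.ringHom_ext
      · intro a; simp [hgC]
      · simp [hgX]
    exact congrArg (fun f => f (e i j)) h2
  have hB : (e.map g).map (MvPolynomial.aeval (R := A) ((0 : Unit → A[X]) + fun _ => X)) = e := by
    ext1 i j
    have h2 : (MvPolynomial.aeval (R := A)
        ((0 : Unit → A[X]) + fun _ => X)).toRingHom.comp g = RingHom.id _ := by
      apply Polynomial.ringHom_ext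
      · intro a; simp [hgC]
      · simp [hgX]
    exact congrArg (fun f => f (e i j)) h2
  rw [hA, hB] at h1
  exact Split.of_conjMod h1 (h0.map _)

theorem quillen_suslin_fin (k : ℕ) {K : Type} [Field K] {ι : Type} [Fintype ι] [DecidableEq ι]
    (e : Matrix ι ι (MvPolynomial (Fin k) K)) (he : e * e = e) : Split e := by
  induction k generalizing K ι with
  | zero =>
    have := (split_of_field (map_mul_self he
      (MvPolynomial.isEmptyAlgEquiv K (Fin 0)).toRingEquiv.toRingHom)).map
      (MvPolynomial.isEmptyAlgEquiv K (Fin 0)).symm.toRingEquiv.toRingHom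
    convert this using 1
    ext1 i j
    exact ((MvPolynomial.isEmptyAlgEquiv K (Fin 0)).symm_apply_apply _).symm
  | succ k ih =>
    set g := (MvPolynomial.finSuccEquiv K k).toRingEquiv.toRingHom with hg
    set e1 := e.map g with he1
    have he1' : e1 * e1 = e1 := map_mul_self he _
    suffices Split e1 by
      convert this.map (MvPolynomial.finSuccEquiv K k).symm.toRingEquiv.toRingHom using 1
      ext1 i j
      exact ((MvPolynomial.finSuccEquiv K k).symm_apply_apply _).symm
    set τ1 := (chi (R := K) (0 : Fin k → K[X])).symm.toRingEquiv.toRingHom with hτ1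
    set τ2 := (chi (R := K) (0 : Fin k → K[X])).toRingEquiv.toRingHom with hτ2
    have hττ : ∀ x, τ2 (τ1 x) = x := (chi (R := K) (0 : Fin k → K[X])).apply_symm_apply
    have hτ2C : ∀ f : K[X], τ2 (MvPolynomial.C f) = f.map MvPolynomial.C := chi_C _
    obtain ⟨δ, hδ, r, V, Ψ, hV, hΨ, h1, h2⟩ := exists_clear_split (L := FractionRing K[X])
      (nonZeroDivisors K[X]) (map_mul_self he1' τ1) (ih _ (map_mul_self (map_mul_self he1' τ1) _))
    have hδ0 : δ ≠ 0 := nonZeroDivisors.ne_zero hδ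
    set c := C (δ.leadingCoeff)⁻¹ with hc
    have hf : (δ * c).Monic := monic_mul_leadingCoeff_inv hδ0
    refine split_of_local he1' (ih _ (map_mul_self he1' _)) fun M hM => ?_
    set l := mapRingHom (algebraMap (MvPolynomial (Fin k) K) (Localization.AtPrime M)) with hl
    have hle : ((e1.map τ1).map τ2).map l = e1.map l := by
      ext1 i j
      exact congrArg l (hττ _)
    have hlf : l (τ2 (MvPolynomial.C δ)) * l (τ2 (MvPolynomial.C c)) =
        ((δ * c).map MvPolynomial.C).map
          (algebraMap (MvPolynomial (Fin k) K) (Localization.AtPrime M)) := by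
      rw [← map_mul, ← map_mul, ← map_mul, hτ2C]; rfl
    refine split_of_monic r (e1.map l) (map_mul_self he1' _)
      (((δ * c).map MvPolynomial.C).map
        (algebraMap (MvPolynomial (Fin k) K) (Localization.AtPrime M)))
      ((hf.map _).map _) ((Ψ.map τ2).map l) (l (τ2 (MvPolynomial.C c)) • (V.map τ2).map l)
          ?_ ?_ ?_ ?_
    · rw [Matrix.mul_smul, ← Matrix.map_mul, ← Matrix.map_mul, h2, ← hlf]
      ext1 i j
      rcases eq_or_ne i j with rfl | h <;> simp [mul_comm, *]
    · rw [Matrix.smul_mul, ← Matrix.map_mul, ← Matrix.map_mul, h1, ← hlf, ← hle]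
      ext1 i j
      simp [mul_assoc]
      ring
    · rw [Matrix.mul_smul, ← hle, ← Matrix.map_mul, ← Matrix.map_mul, hV]
    · rw [← hle, ← Matrix.map_mul, ← Matrix.map_mul, hΨ]

theorem quillen_suslin {σ : Type} [Finite σ] {K : Type} [Field K] {ι : Type} [Fintype ι]
    [DecidableEq ι] {e : Matrix ι ι (MvPolynomial σ K)} (he : e * e = e) : Split e := by
  obtain ⟨k, ⟨s⟩⟩ := Finite.exists_equiv_fin σ
  set g := MvPolynomial.renameEquiv K s
  convert (quillen_suslin_fin k _ (map_mul_self he g.toRingEquiv.toRingHom)).map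
    g.symm.toRingEquiv.toRingHom using 1
  ext1 i j
  exact (g.symm_apply_apply _).symm

/-- Modulo nilpotents, the splitting descends from the residue field of a minimal prime. -/
theorem split_atMinimalPrime {σ : Type} [Finite σ] {R : Type} [CommRing R] {ι : Type} [Fintype ι]
    [DecidableEq ι] {e : Matrix ι ι (MvPolynomial σ R)} (he : e * e = e) {𝔭 : Ideal R}
    [𝔭.IsPrime] (hp : 𝔭 ∈ minimalPrimes R) :
    Split (e.map (MvPolynomial.map (algebraMap R (Localization.AtPrime 𝔭)))) := by
  refine Split.of_nil (MvPolynomial.map (IsLocalRing.residue (Localization.AtPrime 𝔭)))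
    (MvPolynomial.map_surjective _ IsLocalRing.residue_surjective) ?_ (map_mul_self he _)
    (quillen_suslin (map_mul_self (map_mul_self he _) _))
  intro x hx
  rw [MvPolynomial.isNilpotent_iff]
  intro i
  have h1 := congrArg (MvPolynomial.coeff i) hx
  rw [MvPolynomial.coeff_map, MvPolynomial.coeff_zero, IsLocalRing.residue_eq_zero_iff] at h1
  obtain ⟨a, s, ha⟩ := IsLocalization.exists_mk'_eq 𝔭.primeCompl (x.coeff i)
  rw [← ha, IsLocalization.AtPrime.mk'_mem_maximal_iff _ 𝔭] at h1
  have h2 : IsNilpotent (algebraMap R (Localization.AtPrime 𝔭) a) := by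
    have : (algebraMap R (Localization.AtPrime 𝔭) a) ∈ nilradical (Localization.AtPrime 𝔭) := by
      rw [nilradical_eq_sInf, Submodule.mem_sInf]
      intro (𝔮 : Ideal _) h𝔮
      have h𝔮' : 𝔮.IsPrime := h𝔮
      have h3 : 𝔮.comap (algebraMap R (Localization.AtPrime 𝔭)) ≤ 𝔭 := by
        intro z hz
        by_contra hzp
        exact h𝔮'.ne_top (Ideal.eq_top_of_isUnit_mem _ hz
          (IsLocalization.map_units (Localization.AtPrime 𝔭) (⟨z, hzp⟩ : 𝔭.primeCompl)))
      exact hp.2 ⟨Ideal.comap_isPrime _ _, bot_le⟩ h3 h1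
    exact this
  rw [← ha, IsLocalization.mk'_eq_mul_mk'_one]
  exact (Commute.all _ _).isNilpotent_mul_right h2

theorem exists_mem_J_of_minimalPrime {σ : Type} [Finite σ] {R : Type} [CommRing R] {ι : Type}
    [Fintype ι] [DecidableEq ι] {e : Matrix ι ι (MvPolynomial σ R)} (he : e * e = e) {𝔭 : Ideal R}
    [𝔭.IsPrime] (hp : 𝔭 ∈ minimalPrimes R) : ¬ J e he ≤ 𝔭 := by
  obtain ⟨t, ht, htJ⟩ := exists_mem_J_of_split (L := Localization.AtPrime 𝔭) 𝔭.primeCompl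
    (he := he) (split_atMinimalPrime he hp)
  exact fun h => ht (h htJ)

end QuillenSuslin

section Rank

variable {B C : Type} [CommRing B] [CommRing C] {ι : Type} [Fintype ι] [DecidableEq ι]

/-- The matrix `e` has rank at least `n` at every point. -/
def RkGE (e : Matrix ι ι B) (n : ℕ) : Prop :=
  ∀ (F : Type) [Field F] (f : B →+* F), n ≤ (e.map f).rank

/-- The matrix `e` has rank at most `n` at every point. -/
def RkLE (e : Matrix ι ι B) (n : ℕ) : Prop :=
  ∀ (F : Type) [Field F] (f : B →+* F), (e.map f).rank ≤ n

lemma RkGE.map {e : Matrix ι ι B} {n : ℕ} (h : RkGE e n) (g : B →+* C) : RkGE (e.map g) n :=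
  fun F _ f => h F (f.comp g)

lemma RkLE.map {e : Matrix ι ι B} {n : ℕ} (h : RkLE e n) (g : B →+* C) : RkLE (e.map g) n :=
  fun F _ f => h F (f.comp g)

lemma RkGE.mono {e : Matrix ι ι B} {n k : ℕ} (h : RkGE e n) (hk : k ≤ n) : RkGE e k :=
  fun F _ f => hk.trans (h F f)

lemma RkGE.transpose {e : Matrix ι ι B} {n : ℕ} (h : RkGE e n) : RkGE eᵀ n := fun F _ f => by
  rw [Matrix.transpose_map, Matrix.rank_transpose]
  exact h F f

lemma rank_add_le {F : Type} [Field F] (M N : Matrix ι ι F) :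
    (M + N).rank ≤ M.rank + N.rank := by
  have h : LinearMap.range (M + N).mulVecLin ≤
      LinearMap.range M.mulVecLin ⊔ LinearMap.range N.mulVecLin := by
    rintro _ ⟨x, rfl⟩
    rw [mulVecLin_apply, add_mulVec]
    exact Submodule.add_mem_sup ⟨x, rfl⟩ ⟨x, rfl⟩
  exact (Submodule.finrank_mono h).trans (Submodule.finrank_add_le_finrank_add_finrank _ _)

lemma RkGE.sub1 {e : Matrix ι ι B} {n : ℕ} (h : RkGE e (n + 1)) (q ψ : ι → B) :
    RkGE (sub1 e q ψ) n := by
  intro F _ f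
  have h1 := h F f
  have h2 : e.map f = (ProjMat.sub1 e q ψ).map f + vecMulVec (f ∘ q) (f ∘ ψ) := by
    ext1 i j
    simp [ProjMat.sub1, vecMulVec_apply]
  have h3 := rank_add_le ((ProjMat.sub1 e q ψ).map f) (vecMulVec (f ∘ q) (f ∘ ψ))
  have h4 := Matrix.rank_vecMulVec_le (f ∘ q) (f ∘ ψ)
  rw [← h2] at h3
  omega

lemma RkLE.sub1 {e : Matrix ι ι B} {n : ℕ} (h : RkLE e (n + 1)) {q ψ : ι → B}
    (hq : e *ᵥ q = q) (hψ : ψ ᵥ* e = ψ) (h1 : ψ ⬝ᵥ q = 1) :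
    RkLE (sub1 e q ψ) n := by
  intro F _ f
  have h2 := h F f
  refine Nat.lt_succ_iff.1 (lt_of_lt_of_le ?_ h2)
  refine Submodule.finrank_lt_finrank_of_lt ?_
  have hs : (ProjMat.sub1 e q ψ) = e * ProjMat.sub1 1 q ψ := by
    rw [ProjMat.sub1, ProjMat.sub1, Matrix.mul_sub, Matrix.mul_one, Matrix.mul_vecMulVec, hq]
  have hz : (f ∘ ψ) ᵥ* (ProjMat.sub1 e q ψ).map f = 0 := by
    have : ψ ᵥ* ProjMat.sub1 e q ψ = 0 := by
      rw [vecMul_sub1, hψ, h1, one_smul, sub_self]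
    have h5 := congrArg (fun v => f ∘ v) this
    ext i
    have := congrFun h5 i
    simpa [RingHom.map_vecMul] using this
  refine lt_of_le_of_ne ?_ fun heq => ?_
  · rintro _ ⟨x, rfl⟩
    refine ⟨(ProjMat.sub1 1 q ψ).map f *ᵥ x, ?_⟩
    rw [mulVecLin_apply, mulVecLin_apply, mulVec_mulVec, ← Matrix.map_mul, ← hs]
  · have hm : f ∘ q ∈ LinearMap.range ((ProjMat.sub1 e q ψ).map f).mulVecLin := by
      rw [heq]
      refine ⟨f ∘ q, ?_⟩
      rw [mulVecLin_apply]
      ext i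
      have := congrArg f (congrFun hq i)
      rw [RingHom.map_mulVec] at this
      exact this
    obtain ⟨x, hx⟩ := hm
    rw [mulVecLin_apply] at hx
    have h6 : (f ∘ ψ) ⬝ᵥ (f ∘ q) = 1 := by
      rw [← RingHom.map_dotProduct, h1, map_one]
    rw [← hx, dotProduct_mulVec, hz, zero_dotProduct] at h6
    exact zero_ne_one h6

/-- An idempotent of rank zero is zero modulo nilpotents, hence zero. -/
lemma eq_zero_of_rkLE {e : Matrix ι ι B} (he : e * e = e) (h : RkLE e 0) : e = 0 := by
  refine idem_eq_zero_of_nilpotent he fun i j => ?_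
  rw [← mem_nilradical, nilradical_eq_sInf, Submodule.mem_sInf]
  intro (𝔮 : Ideal B) h𝔮
  have : 𝔮.IsPrime := h𝔮
  set f := (algebraMap (B ⧸ 𝔮) (FractionRing (B ⧸ 𝔮))).comp (Ideal.Quotient.mk 𝔮)
  have h1 := Nat.le_zero.1 (h _ f)
  have h2 : f (e i j) = 0 := by
    have h3 : (e.map f) *ᵥ Pi.single j 1 ∈ LinearMap.range (e.map f).mulVecLin := ⟨_, rfl⟩
    rw [Submodule.finrank_eq_zero.1 h1, Submodule.mem_bot, mulVec_single_one] at h3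
    exact congrFun h3 i
  rw [RingHom.comp_apply, IsFractionRing.to_map_eq_zero_iff, Ideal.Quotient.eq_zero_iff_mem] at h2
  exact h2

end Rank

section Avoidance

variable {B : Type} [CommRing B]

lemma exists_mem_notMem_of_antichain {s : Set (Ideal B)} (hs : s.Finite)
    (hp : ∀ p ∈ s, p.IsPrime) (ha : ∀ p ∈ s, ∀ q ∈ s, p ≤ q → p = q) (t : Set (Ideal B)) :
    ∃ y : B, (∀ p ∈ s, p ∈ t → y ∈ p) ∧ ∀ p ∈ s, p ∉ t → y ∉ p := by
  classical
  set S := hs.toFinset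
  set I := ∏ p ∈ S.filter (· ∈ t), p with hI
  have hIle : ∀ p ∈ s, p ∈ t → I ≤ p := fun p hps hpt =>
    (Ideal.prod_le_inf).trans (Finset.inf_le (by simp [S, hps, hpt]))
  have : ¬ ((I : Set B) ⊆ ⋃ p ∈ (↑(S.filter (· ∉ t)) : Set (Ideal B)), (p : Set B)) := by
    rw [Ideal.subset_union_prime ⊥ ⊥ (fun p h _ _ => hp p (by simp [S] at h; exact h.1))]
    rintro ⟨p, hpS, hle⟩
    simp only [Finset.mem_filter, Set.Finite.mem_toFinset, S] at hpS
    have := hp p hpS.1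
    obtain ⟨q, hq, hqp⟩ := (Ideal.IsPrime.prod_le this).1 hle
    simp only [Finset.mem_filter, Set.Finite.mem_toFinset, S] at hq
    exact hpS.2 (ha q hq.1 p hpS.1 hqp ▸ hq.2)
  obtain ⟨y, hy, hy2⟩ := Set.not_subset.1 this
  refine ⟨y, fun p hps hpt => hIle p hps hpt hy, fun p hps hpt hyp => hy2 ?_⟩
  simp only [Set.mem_iUnion]
  exact ⟨p, by simp [S, hps, hpt], hyp⟩

lemma minimalPrimes_antichain {I : Ideal B} : ∀ p ∈ I.minimalPrimes, ∀ q ∈ I.minimalPrimes,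
    p ≤ q → p = q := fun _ hp _ hq h => le_antisymm h (hq.2 hp.1 h)

/-- General position: modify `x` along `c` so that the height is large where `c` is invertible. -/
lemma exists_general_position [IsNoetherianRing B] (c : B) {D : ℕ} (x : Fin D → B) :
    ∃ y : Fin D → B, ∀ 𝔮 : Ideal B, 𝔮.IsPrime → (∀ i, x i + c * y i ∈ 𝔮) → c ∉ 𝔮 →
      (D : ℕ∞) ≤ 𝔮.height := by
  induction D with
  | zero => exact ⟨0, fun _ _ _ _ => by simp⟩
  | succ D ih =>
    obtain ⟨y, hy⟩ := ih (x ∘ Fin.castSucc)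
    set I := Ideal.span (Set.range fun i => x (Fin.castSucc i) + c * y i)
    set s := {p ∈ I.minimalPrimes | c ∉ p}
    obtain ⟨z, hz1, hz2⟩ := exists_mem_notMem_of_antichain (s := s)
      ((Ideal.finite_minimalPrimes_of_isNoetherianRing _ I).subset (Set.sep_subset _ _))
      (fun p h => h.1.1.1) (fun p hp q hq h => minimalPrimes_antichain p hp.1 q hq.1 h)
      {p | x (Fin.last D) ∉ p}
    refine ⟨Fin.snoc y z, fun 𝔮 h𝔮 hmem hc => ?_⟩
    have hmem1 : ∀ i, x (Fin.castSucc i) + c * y i ∈ 𝔮 := fun i => by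
      simpa using hmem (Fin.castSucc i)
    have hmem2 : x (Fin.last D) + c * z ∈ 𝔮 := by simpa using hmem (Fin.last D)
    obtain ⟨p, hp, hpq⟩ := Ideal.exists_minimalPrimes_le (I := I) (J := 𝔮)
      (Ideal.span_le.2 (by rintro _ ⟨i, rfl⟩; exact hmem1 i))
    have hpp := hp.1.1
    have hcp : c ∉ p := fun h => hc (hpq h)
    have h1 := hy p hpp (fun i => hp.1.2 (Ideal.subset_span ⟨i, rfl⟩)) hcp
    have hnot : x (Fin.last D) + c * z ∉ p := by
      intro h
      by_cases hx : x (Fin.last D) ∈ p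
      · have := (Ideal.add_mem_iff_right _ hx).1 h
        exact (hpp.mem_or_mem this).elim hcp (hz2 p ⟨hp, hcp⟩ (by simpa using hx))
      · have hzp : z ∈ p := hz1 p ⟨hp, hcp⟩ hx
        exact hx ((Ideal.add_mem_iff_left _ (p.mul_mem_left c hzp)).1 h)
    have hlt : p < 𝔮 := lt_of_le_of_ne hpq fun h => hnot (h ▸ hmem2)
    have := Ideal.height_add_one_le_of_lt_of_isPrime hlt
    push_cast
    exact (add_le_add_left h1 1).trans this

end Avoidance

section GenCoord

open MvPolynomial

/-- Generic coordinates: over a Noetherian ring, a projective module of rank at least `D` over a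
polynomial ring becomes free generically on the base, modulo nilpotents. -/
theorem exists_generic_coordinates {R σ ι : Type} [CommRing R] [IsNoetherianRing R] [Finite σ]
    [Fintype ι] [DecidableEq ι] {e : Matrix ι ι (MvPolynomial σ R)} (he : e * e = e) {D : ℕ}
    (hD : RkGE e D) : ∃ (s : R) (p : Fin D → ι → MvPolynomial σ R)
      (φ : Fin D → ι → MvPolynomial σ R), (∀ 𝔭 ∈ minimalPrimes R, s ∉ 𝔭) ∧
      (∀ i, e *ᵥ p i = p i) ∧ (∀ i, φ i ᵥ* e = φ i) ∧
      ∀ i j, IsNilpotent (φ i ⬝ᵥ p j - if i = j then C s else 0) := by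
  classical
  have hfin : (minimalPrimes R).Finite := minimalPrimes.finite_of_isNoetherianRing R
  have hpr : ∀ 𝔭 ∈ minimalPrimes R, 𝔭.IsPrime := fun 𝔭 h => h.1.1
  have hloc : ∀ 𝔭 : minimalPrimes R, ∃ (δ : R) (p φ : Fin D → ι → MvPolynomial σ R), δ ∉ 𝔭.1 ∧
      (∀ i, e *ᵥ p i = p i) ∧ (∀ i, φ i ᵥ* e = φ i) ∧
      ∀ i j, φ i ⬝ᵥ p j = if i = j then C δ else 0 := by
    rintro ⟨𝔭, h𝔭⟩
    have := hpr 𝔭 h𝔭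
    obtain ⟨δ, hδ, r, V, Ψ, hV, hΨ, h1, h2⟩ := exists_clear_split
      (L := Localization.AtPrime 𝔭) 𝔭.primeCompl he (split_atMinimalPrime he h𝔭)
    have hr : D ≤ r := by
      set f : MvPolynomial σ R →+* FractionRing (R ⧸ 𝔭) := eval₂Hom
        ((algebraMap (R ⧸ 𝔭) (FractionRing (R ⧸ 𝔭))).comp (Ideal.Quotient.mk 𝔭)) 0 with hf
      have hfδ : f (C δ) ≠ 0 := by
        rw [hf, eval₂Hom_C, RingHom.comp_apply, Ne, IsFractionRing.to_map_eq_zero_iff,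
          Ideal.Quotient.eq_zero_iff_mem]
        exact hδ
      have h3 : e.map f = (f (C δ))⁻¹ • (V.map f * Ψ.map f) := by
        rw [← Matrix.map_mul, h1]
        ext1 i j
        simp [hfδ]
      calc D ≤ (e.map f).rank := hD _ f
        _ = (((f (C δ))⁻¹ • V.map f) * Ψ.map f).rank := by rw [h3, Matrix.smul_mul]
        _ ≤ ((f (C δ))⁻¹ • V.map f).rank := Matrix.rank_mul_le_left _ _
        _ ≤ r := by simpa using Matrix.rank_le_card_width ((f (C δ))⁻¹ • V.map f)
    refine ⟨δ, fun i k => V k (Fin.castLE hr i), fun i k => Ψ (Fin.castLE hr i) k, hδ,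
      fun i => ?_, fun i => ?_, fun i j => ?_⟩
    · ext k : 1
      exact congrFun (congrFun hV k) (Fin.castLE hr i)
    · ext k : 1
      exact congrFun (congrFun hΨ (Fin.castLE hr i)) k
    · have := congrFun (congrFun h2 (Fin.castLE hr i)) (Fin.castLE hr j)
      rw [Matrix.smul_apply, Matrix.one_apply] at this
      refine Eq.trans this ?_
      by_cases hij : i = j <;> simp [hij]
  choose δ p φ hδ hp hφ hpφ using hloc
  have hc : ∀ 𝔭 : minimalPrimes R, ∃ c : R, (∀ 𝔮 ∈ minimalPrimes R, 𝔮 ≠ 𝔭.1 → c ∈ 𝔮) ∧ c ∉ 𝔭.1 := by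
    intro 𝔭
    obtain ⟨c, h1, h2⟩ := exists_mem_notMem_of_antichain hfin hpr minimalPrimes_antichain {𝔭.1}ᶜ
    exact ⟨c, fun 𝔮 hq hne => h1 𝔮 hq hne, h2 𝔭.1 𝔭.2 (by simp)⟩
  choose c hc1 hc2 using hc
  have := hfin.fintype
  have hnil : ∀ 𝔭 𝔮 : minimalPrimes R, 𝔭 ≠ 𝔮 → ∀ x : MvPolynomial σ R,
      IsNilpotent (C (c 𝔭) * C (c 𝔮) * x) := by
    intro 𝔭 𝔮 hne x
    refine (Commute.all _ _).isNilpotent_mul_right ?_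
    rw [← C_mul]
    refine IsNilpotent.map (r := c 𝔭 * c 𝔮) ?_ C
    rw [← mem_nilradical, nilradical, ← Ideal.sInf_minimalPrimes, Submodule.mem_sInf]
    intro (𝔫 : Ideal R) h𝔫
    by_cases h : 𝔫 = 𝔭.1
    · exact Ideal.mul_mem_left _ _ (hc1 𝔮 𝔫 h𝔫 fun h' => hne (Subtype.ext (h.symm.trans h')))
    · exact Ideal.mul_mem_right _ _ (hc1 𝔭 𝔫 h𝔫 h)
  refine ⟨∑ 𝔭, c 𝔭 ^ 2 * δ 𝔭, fun i => ∑ 𝔭, (C (c 𝔭) : MvPolynomial σ R) • p 𝔭 i,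
    fun i => ∑ 𝔭, (C (c 𝔭) : MvPolynomial σ R) • φ 𝔭 i, ?_, ?_, ?_, ?_⟩
  · intro 𝔭 h𝔭 hmem
    have := hpr 𝔭 h𝔭
    rw [← Finset.add_sum_erase _ _ (Finset.mem_univ (⟨𝔭, h𝔭⟩ : minimalPrimes R))] at hmem
    have h2 : ∑ 𝔮 ∈ Finset.univ.erase (⟨𝔭, h𝔭⟩ : minimalPrimes R), c 𝔮 ^ 2 * δ 𝔮 ∈ 𝔭 := by
      refine sum_mem fun 𝔮 h𝔮 => Ideal.mul_mem_right _ _ (Ideal.pow_mem_of_mem _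
        (hc1 𝔮 𝔭 h𝔭 fun h => (Finset.ne_of_mem_erase h𝔮) (Subtype.ext h.symm)) 2 two_pos)
    have h3 := (Ideal.add_mem_iff_left _ h2).1 hmem
    exact (this.mem_or_mem h3).elim (fun h => hc2 ⟨𝔭, h𝔭⟩ (this.mem_of_pow_mem _ h)) (hδ ⟨𝔭, h𝔭⟩)
  · intro i
    rw [mulVec_sum]
    exact Finset.sum_congr rfl fun 𝔭 _ => by rw [mulVec_smul, hp]
  · intro i
    rw [sum_vecMul]
    exact Finset.sum_congr rfl fun 𝔭 _ => by rw [smul_vecMul, hφ]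
  · intro i j
    have h1 : (∑ 𝔭, (C (c 𝔭) : MvPolynomial σ R) • φ 𝔭 i) ⬝ᵥ
        (∑ 𝔮, (C (c 𝔮) : MvPolynomial σ R) • p 𝔮 j) -
        (if i = j then C (∑ 𝔭, c 𝔭 ^ 2 * δ 𝔭) else 0) =
        ∑ 𝔭, ∑ 𝔮, if 𝔭 = 𝔮 then 0 else C (c 𝔭) * C (c 𝔮) * (φ 𝔭 i ⬝ᵥ p 𝔮 j) := by
      have h2 : (if i = j then C (∑ 𝔭, c 𝔭 ^ 2 * δ 𝔭) else 0 : MvPolynomial σ R) =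
          ∑ 𝔭, ∑ 𝔮, if 𝔭 = 𝔮 then C (c 𝔭) * C (c 𝔮) * (φ 𝔭 i ⬝ᵥ p 𝔮 j) else 0 := by
        simp only [Finset.sum_ite_eq, Finset.mem_univ, if_true, hpφ]
        by_cases hij : i = j
        · simp [hij, pow_two]
        · simp [hij]
      rw [h2, sum_dotProduct, ← Finset.sum_sub_distrib]
      refine Finset.sum_congr rfl fun 𝔭 _ => ?_
      rw [dotProduct_sum, ← Finset.sum_sub_distrib]
      refine Finset.sum_congr rfl fun 𝔮 _ => ?_
      rw [smul_dotProduct, dotProduct_smul, smul_eq_mul, smul_eq_mul, ← mul_assoc]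
      by_cases h : 𝔭 = 𝔮 <;> simp [h]
    rw [h1]
    refine isNilpotent_sum fun 𝔭 _ => isNilpotent_sum fun 𝔮 _ => ?_
    by_cases h : 𝔭 = 𝔮
    · simp [h]
    · rw [if_neg h]
      exact hnil 𝔭 𝔮 h _

end GenCoord

section Height

open Polynomial

variable {C' : Type} [CommRing C'] [IsNoetherianRing C']

attribute [local instance] Polynomial.algebra Polynomial.isLocalization in
lemma height_le_height_comap_add_one (I : Ideal C'[X]) [I.IsPrime] :
    I.height ≤ (I.comap C).height + 1 := by
  set 𝔭 := I.comap C with h𝔭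
  set L := Localization.AtPrime 𝔭
  have disj : Disjoint (𝔭.primeCompl.map C : Set C'[X]) I := by
    refine Set.disjoint_left.mpr fun a ⟨b, hb⟩ ha ↦ hb.1 ?_
    rw [SetLike.mem_coe, h𝔭, Ideal.mem_comap, hb.2]
    exact ha
  have h1 := IsLocalization.height_map_of_disjoint (S := L[X]) (𝔭.primeCompl.map C) I disj
  have h2 : (I.map (algebraMap C'[X] L[X])).IsPrime :=
    IsLocalization.isPrime_of_isPrime_disjoint (𝔭.primeCompl.map C) _ _ ‹_› disj
  have h3 := Ideal.height_le_ringKrullDim_of_isPrime (I := I.map (algebraMap C'[X] L[X]))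
  rw [h1, Polynomial.ringKrullDim_of_isNoetherianRing,
    IsLocalization.AtPrime.ringKrullDim_eq_height 𝔭 L] at h3
  exact_mod_cast h3

lemma height_le_of_leadingCoeff_le (I : Ideal C'[X]) [hI : I.IsPrime] (𝔔 : Ideal C') [𝔔.IsPrime]
    (h : I.leadingCoeff ≤ 𝔔) : I.height ≤ 𝔔.height := by
  set 𝔭 := I.comap C with h𝔭
  have hle : 𝔭 ≤ I.leadingCoeff := fun x hx =>
    (I.mem_leadingCoeff x).2 ⟨C x, hx, leadingCoeff_C x⟩
  by_cases heq : 𝔭 = I.leadingCoeff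
  · have h1 : I = 𝔭.map C := (Ideal.map_C_comap_of_comap_eq_leadingCoeff I heq).symm
    have h2 : I.height ≤ 𝔭.height := by
      set M := 𝔭.comap (evalRingHom (0 : C')) with hM
      have hMp : M.IsPrime := Ideal.comap_isPrime _ _
      have hMC : M.comap C = 𝔭 := by
        ext x; simp [hM, Ideal.mem_comap]
      have hlt : I < M := by
        refine lt_of_le_of_ne ?_ fun h' => ?_
        · rw [h1, Ideal.map_le_iff_le_comap, hMC]
        · have hX : (X : C'[X]) ∈ M := by simp [hM, Ideal.mem_comap]
          rw [← h', h1, Ideal.mem_map_C_iff] at hX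
          have h1 := hX 1
          rw [coeff_X_one] at h1
          have : 𝔭.IsPrime := Ideal.comap_isPrime _ _
          exact this.ne_top ((Ideal.eq_top_iff_one _).2 h1)
      have h3 := Ideal.height_add_one_le_of_lt_of_isPrime hlt
      have h4 := height_le_height_comap_add_one M
      rw [hMC] at h4
      exact (ENat.add_le_add_iff_right (by simp)).1 (h3.trans h4)
    exact h2.trans (Ideal.height_mono (hle.trans h))
  · have hp : 𝔭.IsPrime := Ideal.comap_isPrime _ _
    have hlt : 𝔭 < 𝔔 := lt_of_lt_of_le (lt_of_le_of_ne hle heq) h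
    exact (height_le_height_comap_add_one I).trans (Ideal.height_add_one_le_of_lt_of_isPrime hlt)

/-- A prime of `R[T]` of height larger than the dimension of `R` contains a monic polynomial. -/
lemma exists_monic_mem_of_height {I : Ideal C'[X]} [I.IsPrime]
    (h : ringKrullDim C' < I.height) : ∃ f ∈ I, f.Monic := by
  have h1 : I.leadingCoeff = ⊤ := by
    by_contra hne
    obtain ⟨M, hM, hIM⟩ := Ideal.exists_le_maximal _ hne
    have h2 := height_le_of_leadingCoeff_le I M hIM
    have h3 := Ideal.height_le_ringKrullDim_of_isPrime (I := M)
    exact absurd (h.trans_le ((WithBot.coe_le_coe.2 h2).trans h3)) (lt_irrefl _)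
  obtain ⟨f, hf, hf1⟩ := (I.mem_leadingCoeff 1).1 (h1 ▸ trivial)
  exact ⟨f, hf, hf1⟩

end Height

section Suslin

open Polynomial Filter

variable {R : Type} [CommRing R]

/-- Suslin's change of variables with rapidly growing weights. -/
noncomputable def chiR (R : Type) [CommRing R] (m r : ℕ) :
    MvPolynomial (Fin m) R[X] ≃ₐ[R] (MvPolynomial (Fin m) R)[X] :=
  chi fun i => X ^ r ^ (m - i)

lemma natDegree_chiR_le (m : ℕ) (c : MvPolynomial (Fin m) R[X]) :
    ∃ K : ℕ, ∀ r : ℕ, 1 ≤ r → (chiR R m r c).natDegree ≤ K * r ^ m := by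
  induction c using MvPolynomial.induction_on with
  | C f =>
    refine ⟨f.natDegree, fun r hr => ?_⟩
    rw [chiR, chi_C]
    exact (natDegree_map_le).trans (Nat.le_mul_of_pos_right _ (by positivity))
  | add p q hp hq =>
    obtain ⟨K1, h1⟩ := hp
    obtain ⟨K2, h2⟩ := hq
    refine ⟨K1 + K2, fun r hr => ?_⟩
    rw [map_add, add_mul]
    refine (natDegree_add_le _ _).trans (max_le ?_ ?_)
    · exact (h1 r hr).trans (Nat.le_add_right _ _)
    · exact (h2 r hr).trans (Nat.le_add_left _ _)
  | mul_X p i hp =>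
    obtain ⟨K, h⟩ := hp
    refine ⟨K + 1, fun r hr => ?_⟩
    rw [map_mul, add_mul, one_mul]
    refine natDegree_mul_le.trans (add_le_add (h r hr) ?_)
    rw [chiR, chi_X, Polynomial.map_pow, map_X]
    refine (natDegree_add_le _ _).trans (max_le (by simp) ?_)
    exact (natDegree_X_pow_le _).trans (Nat.pow_le_pow_right hr (Nat.sub_le _ _))

lemma chiR_finSuccEquiv_symm (m r : ℕ) (p : (MvPolynomial (Fin m) R[X])[X]) :
    chiR R (m + 1) r ((MvPolynomial.finSuccEquiv R[X] m).symm p) =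
      p.eval₂ ((mapRingHom (MvPolynomial.rename (R := R) (Fin.succ (n := m))).toRingHom).comp
        (chiR R m r).toRingEquiv.toRingHom)
        (X ^ r ^ (m + 1) + C (MvPolynomial.X 0)) := by
  have h : ((chiR R (m + 1) r).toRingEquiv.toRingHom.comp
      (MvPolynomial.finSuccEquiv R[X] m).symm.toRingEquiv.toRingHom) =
      eval₂RingHom ((mapRingHom (MvPolynomial.rename (R := R) (Fin.succ (n := m))).toRingHom).comp
        (chiR R m r).toRingEquiv.toRingHom) (X ^ r ^ (m + 1) + C (MvPolynomial.X 0)) := by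
    apply Polynomial.ringHom_ext'
    · apply MvPolynomial.ringHom_ext
      · intro f
        have h1 : (MvPolynomial.finSuccEquiv R[X] m).symm (C (MvPolynomial.C f)) =
            MvPolynomial.C f := by
          rw [AlgEquiv.symm_apply_eq, MvPolynomial.finSuccEquiv_apply, MvPolynomial.eval₂Hom_C]
          rfl
        change chiR R (m + 1) r ((MvPolynomial.finSuccEquiv R[X] m).symm
          (C (MvPolynomial.C f))) = eval₂ _ _ (C (MvPolynomial.C f))
        rw [h1, eval₂_C]
        change _ = mapRingHom _ (chiR R m r (MvPolynomial.C f))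
        rw [chiR, chi_C, chiR, chi_C, coe_mapRingHom, Polynomial.map_map]
        congr 1
        ext1 a
        simp
      · intro i
        have h1 : (MvPolynomial.finSuccEquiv R[X] m).symm (C (MvPolynomial.X i)) =
            MvPolynomial.X i.succ := by
          rw [AlgEquiv.symm_apply_eq, MvPolynomial.finSuccEquiv_X_succ]
        change chiR R (m + 1) r ((MvPolynomial.finSuccEquiv R[X] m).symm
          (C (MvPolynomial.X i))) = eval₂ _ _ (C (MvPolynomial.X i))
        rw [h1, eval₂_C]
        change _ = mapRingHom _ (chiR R m r (MvPolynomial.X i))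
        rw [chiR, chi_X, chiR, chi_X]
        simp
    · have h1 : (MvPolynomial.finSuccEquiv R[X] m).symm X = MvPolynomial.X 0 := by
        rw [AlgEquiv.symm_apply_eq, MvPolynomial.finSuccEquiv_X_zero]
      change chiR R (m + 1) r ((MvPolynomial.finSuccEquiv R[X] m).symm X) = eval₂ _ _ X
      rw [h1, eval₂_X, chiR, chi_X]
      simp [add_comm]
  exact congrArg (fun f => f p) h

lemma monic_eval₂ {S S' : Type} [CommRing S] [CommRing S'] (g : S →+* S'[X]) (Y : S'[X])
    (hY : Y.Monic) (p : S[X]) (hp : (g p.leadingCoeff).Monic)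
    (hdeg : ∀ j, (g (p.coeff j)).natDegree < Y.natDegree) : (p.eval₂ g Y).Monic := by
  rcases subsingleton_or_nontrivial S' with h | h
  · exact Subsingleton.elim _ _
  rw [eval₂_eq_sum_range, Finset.sum_range_succ, add_comm]
  have hm : (g (p.coeff p.natDegree) * Y ^ p.natDegree).Monic := hp.mul (hY.pow _)
  refine hm.add_of_left ?_
  have h1 : (g (p.coeff p.natDegree) * Y ^ p.natDegree).degree =
      (((g p.leadingCoeff).natDegree + p.natDegree * Y.natDegree : ℕ) : WithBot ℕ) := by
    rw [degree_eq_natDegree hm.ne_zero]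
    exact congrArg _ ((Monic.natDegree_mul hp (hY.pow _)).trans (by rw [hY.natDegree_pow]))
  rw [h1]
  refine lt_of_lt_of_le (mem_degreeLT.1 (sum_mem (S := degreeLT S' (p.natDegree * Y.natDegree))
    fun j hj => mem_degreeLT.2 ?_)) (WithBot.coe_le_coe.2 (Nat.le_add_left _ _))
  refine degree_le_natDegree.trans_lt (WithBot.coe_lt_coe.2 ?_)
  calc (g (p.coeff j) * Y ^ j).natDegree ≤ (g (p.coeff j)).natDegree + j * Y.natDegree :=
        natDegree_mul_le.trans (Nat.add_le_add_left (natDegree_pow_le) _)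
    _ < Y.natDegree + j * Y.natDegree := Nat.add_lt_add_right (hdeg j) _
    _ = (j + 1) * Y.natDegree := by ring
    _ ≤ p.natDegree * Y.natDegree := Nat.mul_le_mul_right _ (Finset.mem_range.1 hj)

/-- The ideal contains an element which becomes monic after all large changes of variables. -/
def Lmi {m : ℕ} (I : Ideal (MvPolynomial (Fin m) R[X])) : Prop :=
  ∃ h ∈ I, ∀ᶠ r in atTop, (chiR R m r h).Monic

lemma lmi_of_monic {m : ℕ} {I : Ideal (MvPolynomial (Fin m) R[X])} {f : R[X]} (hf : f.Monic)
    (h : MvPolynomial.C f ∈ I) : Lmi I :=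
  ⟨_, h, Eventually.of_forall fun r => by rw [chiR, chi_C]; exact hf.map _⟩

lemma lmi_of_minimalPrimes [IsNoetherianRing R] {m : ℕ} {I : Ideal (MvPolynomial (Fin m) R[X])}
    (h : ∀ p ∈ I.minimalPrimes, Lmi p) : Lmi I := by
  choose x hx hx1 using fun p : I.minimalPrimes => h p.1 p.2
  have := (Ideal.finite_minimalPrimes_of_isNoetherianRing _ I).fintype
  have h1 : ∏ p, x p ∈ I.radical := by
    rw [← Ideal.sInf_minimalPrimes, Submodule.mem_sInf]
    intro (p : Ideal _) hp
    exact Ideal.mem_of_dvd _ (Finset.dvd_prod_of_mem x (Finset.mem_univ ⟨p, hp⟩)) (hx ⟨p, hp⟩)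
  obtain ⟨k, hk⟩ := h1
  refine ⟨_, hk, ?_⟩
  filter_upwards [eventually_all.2 hx1] with r hr
  rw [map_pow, map_prod]
  exact (monic_prod_of_monic _ _ fun p _ => hr p).pow _

lemma exists_comap_height {A B : Type} [CommRing A] [CommRing B] (g : A →+* B)
    (hg : Function.Bijective g) (𝔮 : Ideal B)
    [𝔮.IsPrime] : ∃ I : Ideal A, I.IsPrime ∧ I.height = 𝔮.height ∧ ∀ x, x ∈ I ↔ g x ∈ 𝔮 :=
  ⟨𝔮.comap g, Ideal.comap_isPrime g 𝔮, RingEquiv.height_comap (RingEquiv.ofBijective g hg) 𝔮,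
    fun _ => Iff.rfl⟩

/-- Suslin's theorem on primes of large height. -/
theorem lmi_of_height [IsNoetherianRing R] (m : ℕ) (𝔮 : Ideal (MvPolynomial (Fin m) R[X]))
    [h𝔮 : 𝔮.IsPrime] (h : ringKrullDim R < 𝔮.height) : Lmi 𝔮 := by
  induction m with
  | zero =>
    set g := (MvPolynomial.isEmptyAlgEquiv R[X] (Fin 0)).symm
    have hp : (𝔮.comap g.toRingEquiv).IsPrime := Ideal.comap_isPrime g.toRingEquiv 𝔮
    obtain ⟨f, hf, hf1⟩ := exists_monic_mem_of_height (I := 𝔮.comap g.toRingEquiv)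
      (by rwa [RingEquiv.height_comap])
    exact lmi_of_monic hf1 hf
  | succ m ih =>
    obtain ⟨I, hp, hIh, hI⟩ := exists_comap_height
      (A := (MvPolynomial (Fin m) R[X])[X]) (B := MvPolynomial (Fin (m + 1)) R[X])
      (MvPolynomial.finSuccEquiv R[X] m).symm.toRingEquiv.toRingHom
      (MvPolynomial.finSuccEquiv R[X] m).symm.bijective 𝔮
    obtain ⟨c, hc, hc1⟩ := lmi_of_minimalPrimes (I := I.leadingCoeff) fun p hp => by
      have := hp.1.1
      refine ih p (h.trans_le ?_)
      rw [← hIh]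
      exact_mod_cast height_le_of_leadingCoeff_le I p hp.1.2
    obtain ⟨p, hpI, rfl⟩ := (I.mem_leadingCoeff c).1 hc
    refine ⟨(MvPolynomial.finSuccEquiv R[X] m).symm p, (hI p).1 hpI, ?_⟩
    choose K hK using fun j => natDegree_chiR_le m (p.coeff j)
    filter_upwards [hc1, eventually_ge_atTop (1 + (Finset.range (p.natDegree + 1)).sup K)]
      with r hr1 hr2
    rw [chiR_finSuccEquiv_symm]
    have hr0 : 1 ≤ r := le_trans (Nat.le_add_right _ _) hr2
    rcases subsingleton_or_nontrivial R with hR | hR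
    · exact Subsingleton.elim _ _
    have hYd : (X ^ r ^ (m + 1) + C (MvPolynomial.X 0) :
        (MvPolynomial (Fin (m + 1)) R)[X]).natDegree = r ^ (m + 1) := natDegree_X_pow_add_C
    refine monic_eval₂ _ _ (monic_X_pow_add_C _ (by positivity)) p (hr1.map _) fun j => ?_
    rw [hYd]
    refine lt_of_le_of_lt (natDegree_map_le) ?_
    change (chiR R m r (p.coeff j)).natDegree < _
    by_cases hj : j ∈ Finset.range (p.natDegree + 1)
    · refine lt_of_le_of_lt (hK j r hr0) ?_
      rw [pow_succ', Nat.mul_lt_mul_right (by positivity)]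
      have := Finset.le_sup (f := K) hj
      omega
    · rw [coeff_eq_zero_of_natDegree_lt (by simpa using hj), map_zero, natDegree_zero]
      positivity

end Suslin

section Dim

/-- The Krull dimension is less than `D`, expressed by heights of primes. -/
def DimLT (A : Type) [CommRing A] (D : ℕ) : Prop :=
  ∀ p : Ideal A, p.IsPrime → p.height < D

variable {A : Type} [CommRing A]

lemma dimLT_of_ringKrullDim_le {n : ℕ} (h : ringKrullDim A ≤ n) : DimLT A (n + 1) := by
  intro p hp
  have := (ringKrullDim_le_iff_height_le (n : WithBot ℕ∞)).1 h hp
  have h1 : p.height ≤ (n : ℕ∞) := by exact_mod_cast this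
  exact h1.trans_lt (by exact_mod_cast Nat.lt_succ_self n)

lemma DimLT.subsingleton (h : DimLT A 0) : Subsingleton A := by
  by_contra hA
  rw [not_subsingleton_iff_nontrivial] at hA
  obtain ⟨M, hM⟩ := Ideal.exists_maximal A
  have := h M hM.isPrime
  simp at this

lemma DimLT.ringKrullDim_le {D : ℕ} (h : DimLT A (D + 1)) : ringKrullDim A ≤ D := by
  rw [ringKrullDim_le_iff_height_le]
  intro p hp
  have := h p hp
  have h1 : p.height ≤ (D : ℕ∞) := by
    refine Order.le_of_lt_add_one ?_
    exact_mod_cast this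
  exact_mod_cast h1

lemma DimLT.ringKrullDim_lt {D : ℕ} (h : DimLT A D) {x : ℕ∞} (hx : (D : ℕ∞) ≤ x) :
    ringKrullDim A < x := by
  cases D with
  | zero =>
    have := h.subsingleton
    rw [ringKrullDim_eq_bot_of_subsingleton]
    exact WithBot.bot_lt_coe _
  | succ D =>
    refine h.ringKrullDim_le.trans_lt ?_
    have : (D : ℕ∞) < x := lt_of_lt_of_le (by exact_mod_cast Nat.lt_succ_self D) hx
    exact_mod_cast this

lemma DimLT.quotient {D : ℕ} (h : DimLT A (D + 1)) {I : Ideal A}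
    (hI : ∀ 𝔭 ∈ minimalPrimes A, ¬ I ≤ 𝔭) : DimLT (A ⧸ I) D := by
  have key : ∀ (n : ℕ) (Q : Ideal (A ⧸ I)) [Q.IsPrime],
      (Q.comap (Ideal.Quotient.mk I)).height ≤ n → Q.height < n := by
    intro n
    induction n with
    | zero =>
      intro Q _ hQ
      have h0 : (Q.comap (Ideal.Quotient.mk I)).height = 0 := by simpa using hQ
      have hp : (Q.comap (Ideal.Quotient.mk I)).IsPrime := Ideal.comap_isPrime _ _
      refine absurd ?_ (hI _ (Ideal.height_eq_zero_iff.1 h0))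
      intro x hx
      rw [Ideal.mem_comap, Ideal.Quotient.eq_zero_iff_mem.2 hx]
      exact Q.zero_mem
    | succ n ih =>
      intro Q _ hQ
      have h1 : Q.height ≤ n := by
        rw [Ideal.height_le_iff]
        intro q hq hlt
        apply ih
        have hp : (Q.comap (Ideal.Quotient.mk I)).IsPrime := Ideal.comap_isPrime _ _
        have hp' : (q.comap (Ideal.Quotient.mk I)).IsPrime := Ideal.comap_isPrime _ _
        have hlt' : q.comap (Ideal.Quotient.mk I) < Q.comap (Ideal.Quotient.mk I) :=
          (Ideal.comap_mono hlt.le).lt_of_not_ge fun hle => hlt.not_ge <|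
            (Ideal.comap_le_comap_iff_of_surjective _ Ideal.Quotient.mk_surjective _ _).1 hle
        have := (Ideal.height_le_iff.1 hQ) _ hp' hlt'
        refine Order.le_of_lt_add_one ?_
        exact_mod_cast this
      exact h1.trans_lt (by exact_mod_cast Nat.lt_succ_self n)
  intro Q hQ
  apply key
  have hp : (Q.comap (Ideal.Quotient.mk I)).IsPrime := Ideal.comap_isPrime _ _
  have := h _ hp
  refine Order.le_of_lt_add_one ?_
  exact_mod_cast this

end Dim

section WLmi

open Polynomial Filter

variable {R S : Type} [CommRing R] [CommRing S]

/-- Base change on `R[T][X_i]`. -/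
noncomputable def mapB (σ : Type) (g : R →+* S) :
    MvPolynomial σ R[X] →+* MvPolynomial σ S[X] := MvPolynomial.map (mapRingHom g)

lemma mapB_surjective (σ : Type) {g : R →+* S} (hg : Function.Surjective g) :
    Function.Surjective (mapB σ g) :=
  MvPolynomial.map_surjective _ (map_surjective g hg)

@[simp] lemma mapB_C (σ : Type) (g : R →+* S) (f : R[X]) :
    mapB σ g (MvPolynomial.C f) = MvPolynomial.C (f.map g) := by
  simp [mapB]

lemma ker_mapB (σ : Type) (g : R →+* S) :
    RingHom.ker (mapB σ g) = (RingHom.ker g).map (algebraMap R (MvPolynomial σ R[X])) := by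
  rw [mapB, MvPolynomial.ker_map, Polynomial.ker_mapRingHom, Ideal.map_map]
  rfl

lemma chiR_mapB (g : R →+* S) (m r : ℕ) (x : MvPolynomial (Fin m) R[X]) :
    chiR S m r (mapB _ g x) = (chiR R m r x).map (MvPolynomial.map g) := by
  have : ((chiR S m r).toRingEquiv.toRingHom.comp (mapB _ g)) =
      (mapRingHom (MvPolynomial.map g)).comp (chiR R m r).toRingEquiv.toRingHom := by
    apply MvPolynomial.ringHom_ext
    · intro f
      change chiR S m r (mapB _ g (MvPolynomial.C f)) =
        (chiR R m r (MvPolynomial.C f)).map (MvPolynomial.map g)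
      rw [mapB_C, chiR, chiR, chi_C, chi_C, Polynomial.map_map, Polynomial.map_map]
      congr 1
      ext1 a
      simp
    · intro i
      change chiR S m r (mapB _ g (MvPolynomial.X i)) =
        (chiR R m r (MvPolynomial.X i)).map (MvPolynomial.map g)
      have : mapB (Fin m) g (MvPolynomial.X i) = MvPolynomial.X i := by simp [mapB]
      rw [this, chiR, chiR, chi_X, chi_X]
      simp
  exact congrArg (fun f => f x) this

/-- For all large `r` the ideal contains an element which is monic in the coordinates `chiR`. -/
def WLmi {m : ℕ} (I : Ideal (MvPolynomial (Fin m) R[X])) : Prop :=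
  ∀ᶠ r in atTop, ∃ h ∈ I, (chiR R m r h).Monic

lemma Lmi.wLmi {m : ℕ} {I : Ideal (MvPolynomial (Fin m) R[X])} (h : Lmi I) : WLmi I := by
  obtain ⟨x, hx, hx1⟩ := h
  filter_upwards [hx1] with r hr
  exact ⟨x, hx, hr⟩

lemma WLmi.mono {m : ℕ} {I I' : Ideal (MvPolynomial (Fin m) R[X])} (h : WLmi I) (hle : I ≤ I') :
    WLmi I' := by
  filter_upwards [h] with r hr
  obtain ⟨x, hx, hx1⟩ := hr
  exact ⟨x, hle hx, hx1⟩

lemma wLmi_of_primes [IsNoetherianRing R] {m : ℕ} {I : Ideal (MvPolynomial (Fin m) R[X])}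
    (h : ∀ p : Ideal (MvPolynomial (Fin m) R[X]), p.IsPrime → I ≤ p → WLmi p) : WLmi I := by
  have := (Ideal.finite_minimalPrimes_of_isNoetherianRing _ I).fintype
  have h' : ∀ p : I.minimalPrimes, WLmi p.1 := fun p => h p.1 p.2.1.1 p.2.1.2
  filter_upwards [eventually_all.2 h'] with r hr
  choose x hx hx1 using hr
  have h1 : ∏ p, x p ∈ I.radical := by
    rw [← Ideal.sInf_minimalPrimes, Submodule.mem_sInf]
    intro (p : Ideal _) hp
    exact Ideal.mem_of_dvd _ (Finset.dvd_prod_of_mem x (Finset.mem_univ ⟨p, hp⟩)) (hx ⟨p, hp⟩)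
  obtain ⟨k, hk⟩ := h1
  refine ⟨_, hk, ?_⟩
  rw [map_pow, map_prod]
  exact (monic_prod_of_monic _ _ fun p _ => hx1 p).pow _

lemma wLmi_of_quotient {m : ℕ} {I : Ideal (MvPolynomial (Fin m) R[X])} {K : Ideal R}
    (h : WLmi (I.map (mapB (Fin m) (Ideal.Quotient.mk K)))) :
    WLmi (I ⊔ K.map (algebraMap R (MvPolynomial (Fin m) R[X]))) := by
  filter_upwards [h] with r hr
  obtain ⟨y, hy, hy1⟩ := hr
  obtain ⟨x, hx, rfl⟩ := (Ideal.mem_map_iff_of_surjective _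
    (mapB_surjective _ Ideal.Quotient.mk_surjective)).1 hy
  rw [chiR_mapB] at hy1
  set d := ((chiR R m r x).map (MvPolynomial.map (Ideal.Quotient.mk K))).natDegree
  have hk : ∀ c : MvPolynomial (Fin m) R, MvPolynomial.map (Ideal.Quotient.mk K) c = 0 →
      c ∈ K.map (algebraMap R (MvPolynomial (Fin m) R)) := by
    intro c hc
    have : c ∈ RingHom.ker (MvPolynomial.map (σ := Fin m) (Ideal.Quotient.mk K)) := hc
    rw [MvPolynomial.ker_map, Ideal.mk_ker] at this
    exact this
  obtain ⟨g, j, hg, hj, hgj, -⟩ := exists_monic_add (h := chiR R m r x) (d := d)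
    (J := K.map (algebraMap R (MvPolynomial (Fin m) R)))
    (hk _ (by
      rw [map_sub, ← coeff_map, map_one, sub_eq_zero]
      exact hy1)) (fun k hkd => hk _ (by
      rw [← coeff_map]
      exact coeff_eq_zero_of_natDegree_lt hkd))
  refine ⟨x - (chiR R m r).symm j, Ideal.sub_mem _ (Ideal.mem_sup_left hx)
    (Ideal.mem_sup_right ?_), ?_⟩
  · have := Ideal.mem_map_of_mem (chiR R m r).symm.toRingEquiv.toRingHom hj
    rw [Ideal.map_map, Ideal.map_map] at this
    convert this using 2
    ext1 a
    · exact ((chiR R m r).symm.commutes a).symm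
    · rfl
  · rw [map_sub, AlgEquiv.apply_symm_apply, hgj, add_sub_cancel_right]
    exact hg

end WLmi

section Monic

open Polynomial Filter

lemma exists_generic_coordinates_T {R σ ι : Type} [CommRing R] [IsNoetherianRing R] [Finite σ]
    [Fintype ι] [DecidableEq ι] {e : Matrix ι ι (MvPolynomial σ R[X])} (he : e * e = e) {D : ℕ}
    (hD : RkGE e D) : ∃ (s : R) (p : Fin D → ι → MvPolynomial σ R[X])
      (φ : Fin D → ι → MvPolynomial σ R[X]), (∀ 𝔭 ∈ minimalPrimes R, s ∉ 𝔭) ∧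
      (∀ i, e *ᵥ p i = p i) ∧ (∀ i, φ i ᵥ* e = φ i) ∧
      ∀ i j, IsNilpotent (φ i ⬝ᵥ p j -
        if i = j then algebraMap R (MvPolynomial σ R[X]) s else 0) := by
  set τ := (MvPolynomial.optionEquivRight R σ).toRingEquiv.toRingHom with hτ
  set τ' := (MvPolynomial.optionEquivRight R σ).symm.toRingEquiv.toRingHom with hτ'
  have hττ : ∀ x, τ (τ' x) = x := fun x => (MvPolynomial.optionEquivRight R σ).apply_symm_apply x
  have hτC : ∀ s, τ (MvPolynomial.C s) = algebraMap R (MvPolynomial σ R[X]) s := fun s =>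
    (MvPolynomial.optionEquivRight R σ).commutes s
  have hee : (e.map τ').map τ = e := by
    ext1 i j
    exact hττ _
  obtain ⟨s, p, φ, h1, h2, h3, h4⟩ := exists_generic_coordinates (map_mul_self he τ')
    (hD.map τ')
  refine ⟨s, fun i => τ ∘ p i, fun i => τ ∘ φ i, h1, fun i => ?_, fun i => ?_, fun i j => ?_⟩
  · have := congrArg (fun v => τ ∘ v) (h2 i)
    simp only [← map_mulVec_comp, hee] at this
    exact this
  · have := congrArg (fun v => τ ∘ v) (h3 i)
    have h5 : τ ∘ (φ i ᵥ* e.map τ') = (τ ∘ φ i) ᵥ* (e.map τ').map τ := by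
      ext k : 1
      exact RingHom.map_vecMul τ _ _ k
    simp only [h5, hee] at this
    exact this
  · have := (h4 i j).map τ
    rw [map_sub, ← comp_dotProduct, apply_ite τ, map_zero, hτC] at this
    exact this

lemma map_span_range {B C ι : Type} [CommRing B] [CommRing C] (g : B →+* C) (x : ι → B) :
    (Ideal.span (Set.range x)).map g = Ideal.span (Set.range (g ∘ x)) := by
  rw [Ideal.map_span, Set.range_comp]

variable {m : ℕ} {ι : Type} [Fintype ι] [DecidableEq ι]

/-- A general translate of `x` by multiples of `a` has a monic element in its content ideal. -/
theorem exists_wLmi (D : ℕ) : ∀ (R : Type) [CommRing R] [IsNoetherianRing R]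
    {e : Matrix ι ι (MvPolynomial (Fin m) R[X])} (_ : e * e = e) (_ : DimLT R D) (_ : RkGE e D)
    {x : ι → MvPolynomial (Fin m) R[X]} (_ : e *ᵥ x = x) {a : MvPolynomial (Fin m) R[X]}
    {f : R[X]} (_ : f.Monic)
    (_ : MvPolynomial.C f ∈ Ideal.span {a} ⊔ Ideal.span (Set.range x)),
    ∃ y, e *ᵥ y = y ∧ WLmi (Ideal.span (Set.range (x + a • y))) := by
  induction D with
  | zero =>
    intro R _ _ e he hdim hrk x hx a f hf hfx
    have := hdim.subsingleton
    exact ⟨0, by simp, Eventually.of_forall fun r => ⟨0, Ideal.zero_mem _,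
      Subsingleton.elim _ _⟩⟩
  | succ D ih =>
    intro R _ _ e he hdim hrk x hx a f hf hfx
    obtain ⟨s, p, φ, hs, hp, hφ, hφp⟩ := exists_generic_coordinates_T he hrk
    set S := algebraMap R (MvPolynomial (Fin m) R[X]) s with hS
    set K := Ideal.span {s} with hK
    set g := mapB (Fin m) (Ideal.Quotient.mk K) with hg
    have hgs : Function.Surjective g := mapB_surjective _ Ideal.Quotient.mk_surjective
    have hdim' : DimLT (R ⧸ K) D := hdim.quotient fun 𝔭 h𝔭 hle =>
      hs 𝔭 h𝔭 (hle (Ideal.mem_span_singleton_self s))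
    have hfx' : MvPolynomial.C (f.map (Ideal.Quotient.mk K)) ∈
        Ideal.span {g a} ⊔ Ideal.span (Set.range (g ∘ x)) := by
      have := Ideal.mem_map_of_mem g hfx
      rwa [Ideal.map_sup, map_span_range, Ideal.map_span, Set.image_singleton, hg, mapB_C] at this
    obtain ⟨y', hy', hW⟩ := ih (R ⧸ K) (map_mul_self he g) hdim' ((hrk.mono D.le_succ).map g)
      (x := g ∘ x) (by rw [map_mulVec_comp, hx]) (hf.map _) hfx'
    choose y1 hy1 using fun k => hgs (y' k)
    have hy1' : g ∘ y1 = y' := funext hy1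
    set y0 := e *ᵥ y1 with hy0
    have hey0 : e *ᵥ y0 = y0 := by rw [hy0, mulVec_mulVec, he]
    have hgy0 : g ∘ y0 = y' := by rw [hy0, ← map_mulVec_comp, hy1', hy']
    set x1 := x + a • y0 with hx1
    have hW1 : WLmi (Ideal.span (Set.range x1) ⊔
        K.map (algebraMap R (MvPolynomial (Fin m) R[X]))) := by
      apply wLmi_of_quotient
      have : g ∘ x1 = g ∘ x + g a • y' := by
        ext k : 1
        simp [hx1, ← hgy0]
      rwa [← hg, map_span_range, this]
    obtain ⟨Y, hY⟩ := exists_general_position (a * S ^ 2) fun i => φ i ⬝ᵥ x1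
    set z := ∑ i, Y i • p i with hz
    have hez : e *ᵥ z = z := by
      rw [hz, mulVec_sum]
      simp only [mulVec_smul, hp]
    refine ⟨y0 + S • z, by rw [mulVec_add, mulVec_smul, hez, hey0], ?_⟩
    have hxx : x + a • (y0 + S • z) = x1 + (a * S) • z := by
      rw [hx1, smul_add, smul_smul, add_assoc]
    refine wLmi_of_primes fun 𝔮 h𝔮 hle => ?_
    have hmem : ∀ k, (x + a • (y0 + S • z)) k ∈ 𝔮 := fun k =>
      hle (Ideal.subset_span ⟨k, rfl⟩)
    by_cases ha : a ∈ 𝔮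
    · refine (lmi_of_monic hf ?_).wLmi
      refine (sup_le ?_ ?_ : _ ≤ 𝔮) hfx
      · rwa [Ideal.span_singleton_le_iff_mem]
      · rw [Ideal.span_le]
        rintro _ ⟨k, rfl⟩
        have := hmem k
        rw [Pi.add_apply, Pi.smul_apply, smul_eq_mul] at this
        exact (Ideal.add_mem_iff_left _ (𝔮.mul_mem_right _ ha)).1 this
    by_cases hS𝔮 : S ∈ 𝔮
    · refine hW1.mono (sup_le ?_ ?_)
      · rw [Ideal.span_le]
        rintro _ ⟨k, rfl⟩
        have := hmem k
        rw [hxx, Pi.add_apply, Pi.smul_apply, smul_eq_mul] at this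
        exact (Ideal.add_mem_iff_left _ (𝔮.mul_mem_right _ (𝔮.mul_mem_left _ hS𝔮))).1 this
      · rw [hK, Ideal.map_span, Set.image_singleton, Ideal.span_singleton_le_iff_mem]
        exact hS𝔮
    · refine (lmi_of_height m 𝔮 (hdim.ringKrullDim_lt (hY 𝔮 h𝔮 (fun i => ?_) ?_))).wLmi
      · have h1 : φ i ⬝ᵥ (x + a • (y0 + S • z)) ∈ 𝔮 :=
          Ideal.sum_mem _ fun k _ => 𝔮.mul_mem_left _ (hmem k)
        have h2 : φ i ⬝ᵥ z - Y i * S ∈ 𝔮 := by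
          have : φ i ⬝ᵥ z - Y i * S = ∑ j, Y j * (φ i ⬝ᵥ p j - if i = j then S else 0) := by
            simp [hz, dotProduct_sum, mul_sub, Finset.sum_sub_distrib]
          rw [this]
          refine Ideal.sum_mem _ fun j _ => 𝔮.mul_mem_left _ ?_
          obtain ⟨n, hn⟩ := hφp i j
          exact h𝔮.mem_of_pow_mem n (by rw [hn]; exact 𝔮.zero_mem)
        rw [hxx, dotProduct_add, dotProduct_smul, smul_eq_mul] at h1
        have h3 := 𝔮.sub_mem h1 (𝔮.mul_mem_left (a * S) h2)
        convert h3 using 1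
        ring
      · intro h
        rcases h𝔮.mem_or_mem h with h | h
        · exact ha h
        · exact hS𝔮 (h𝔮.mem_of_pow_mem _ h)

end Monic

section Lift

open Polynomial Filter

variable {m : ℕ} {ι : Type} [Fintype ι] [DecidableEq ι] {R : Type} [CommRing R]
  [IsNoetherianRing R]

lemma exists_um_monic {D : ℕ} {e : Matrix ι ι (MvPolynomial (Fin m) R[X])} (he : e * e = e)
    (hdim : DimLT R D) (hrk : RkGE e (D + 1)) {φ : ι → MvPolynomial (Fin m) R[X]} {f : R[X]}
    (hf : f.Monic) (hfφ : MvPolynomial.C f ∈ Ideal.span (Set.range (φ ᵥ* e)))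
    {U : ι → MvPolynomial (Fin m) R[X]}
    (hN : ∃ v, e *ᵥ v = v ∧ Um v ∧ ∀ i, v i - U i ∈ Ideal.span {MvPolynomial.C X}) :
    ∃ (v : ι → MvPolynomial (Fin m) R[X]) (r : ℕ), e *ᵥ v = v ∧ Um v ∧
      (∀ i, v i - U i ∈ Ideal.span {MvPolynomial.C X}) ∧ (chiR R m r (φ ⬝ᵥ v)).Monic := by
  obtain ⟨v, hv, hvu, hvU⟩ := hN
  obtain ⟨ψ, hψ, hψv⟩ := exists_dual hv hvu he
  set a := φ ⬝ᵥ v with ha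
  set e' := sub1 e v ψ with he'
  have hee₂ : e' * e' = e' := sub1_mul_self he hv hψ hψv
  set x := φ ᵥ* e' with hx
  have hxe : x ᵥ* e' = x := by rw [hx, vecMul_vecMul, hee₂]
  have hfx : MvPolynomial.C f ∈ Ideal.span {a} ⊔ Ideal.span (Set.range x) := by
    refine (Ideal.span_le.2 ?_ : Ideal.span (Set.range (φ ᵥ* e)) ≤ _) hfφ
    rintro _ ⟨k, rfl⟩
    have : (φ ᵥ* e) k = ψ k * a + x k := by
      rw [hx, he', vecMul_sub1]
      simp [ha]
      ring
    rw [this]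
    exact Submodule.add_mem_sup (Ideal.mul_mem_left _ _ (Ideal.mem_span_singleton_self a))
      (Ideal.subset_span ⟨k, rfl⟩)
  obtain ⟨y, hy, hW⟩ := exists_wLmi D R (e := e'ᵀ) (by rw [← transpose_mul, hee₂]) hdim
    (hrk.sub1 v ψ).transpose (x := x) (by rw [mulVec_transpose, hxe]) hf hfx
  rw [mulVec_transpose] at hy
  obtain ⟨r, h, hh, hh1⟩ := hW.exists
  obtain ⟨ξ, hξ⟩ := mem_span_range.1 hh
  set q := e' *ᵥ ξ with hq
  have hxq : (x + a • y) ⬝ᵥ q = h := by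
    rw [hq, ← vecMul_dotProduct, add_vecMul, smul_vecMul, hxe, hy, dotProduct_comm, hξ]
  have heq : e *ᵥ q = q := by rw [hq, mulVec_mulVec, he', mul_sub1 he hv]
  have hψq : ψ ⬝ᵥ q = 0 := by
    rw [hq, ← vecMul_dotProduct, he', vecMul_sub1_self hψ hψv, zero_dotProduct]
  have hyv : y ⬝ᵥ v = 0 := by
    rw [← hy, vecMul_dotProduct, he', sub1_mulVec_self hv hψv, dotProduct_zero]
  have he'q : e' *ᵥ q = q := by rw [hq, mulVec_mulVec, hee₂]
  have hφq : φ ⬝ᵥ q = x ⬝ᵥ q := by rw [hx, vecMul_dotProduct, he'q]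
  set k := (chiR R m r a).natDegree + 1 with hk
  set T : MvPolynomial (Fin m) R[X] := MvPolynomial.C X with hT
  refine ⟨(1 + T ^ k * (y ⬝ᵥ q)) • v + T ^ k • q, r, ?_, ⟨ψ - y, ?_⟩, fun i => ?_, ?_⟩
  · rw [mulVec_add, mulVec_smul, mulVec_smul, hv, heq]
  · simp only [dotProduct_add, dotProduct_smul, sub_dotProduct, hψv, hψq, hyv, smul_eq_mul]
    ring
  · have hTk : T ^ k ∈ Ideal.span {T} := Ideal.pow_mem_of_mem _ (Ideal.mem_span_singleton_self T) _
      (Nat.succ_pos _)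
    have := (Ideal.span {T}).add_mem (hvU i)
      ((Ideal.span {T}).mul_mem_right ((y ⬝ᵥ q) * v i + q i) hTk)
    convert this using 1
    simp
    ring
  · have h1 : φ ⬝ᵥ ((1 + T ^ k * (y ⬝ᵥ q)) • v + T ^ k • q) = a + T ^ k * h := by
      rw [dotProduct_add, dotProduct_smul, dotProduct_smul, hφq, ← hxq, add_dotProduct,
        smul_dotProduct]
      simp only [smul_eq_mul]
      ring
    rw [h1, map_add, map_mul, map_pow, hT, chiR, chi_C_X, ← chiR]
    cases subsingleton_or_nontrivial (MvPolynomial (Fin m) R) with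
    | inl h => exact Subsingleton.elim _ _
    | inr h =>
      refine ((monic_X_pow k).mul hh1).add_of_right ?_
      rw [hh1.degree_mul, degree_X_pow, degree_eq_natDegree hh1.ne_zero]
      refine degree_le_natDegree.trans_lt ?_
      rw [← Nat.cast_add, Nat.cast_lt]
      omega

lemma mem_map_of_map_mk_eq_zero {R σ : Type} [CommRing R] {K : Ideal R} {c : MvPolynomial σ R}
    (hc : MvPolynomial.map (Ideal.Quotient.mk K) c = 0) :
    c ∈ K.map (algebraMap R (MvPolynomial σ R)) := by
  have : c ∈ RingHom.ker (MvPolynomial.map (σ := σ) (Ideal.Quotient.mk K)) := hc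
  rw [MvPolynomial.ker_map, Ideal.mk_ker] at this
  exact this

lemma mem_map_of_mapB_mk_eq_zero {R σ : Type} [CommRing R] {K : Ideal R} {c : MvPolynomial σ R[X]}
    (hc : mapB σ (Ideal.Quotient.mk K) c = 0) :
    c ∈ K.map (algebraMap R (MvPolynomial σ R[X])) := by
  have : c ∈ RingHom.ker (mapB σ (Ideal.Quotient.mk K)) := hc
  rwa [ker_mapB, Ideal.mk_ker] at this

/-- Lifting a unimodular element from `R ⧸ J`, where `J` is contained in the Quillen ideal. -/
lemma exists_um_of_quotient {D : ℕ} {e : Matrix ι ι (MvPolynomial (Fin m) R[X])} (he : e * e = e)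
    {φ : ι → MvPolynomial (Fin m) R[X]} {f : R[X]} (hf : f.Monic)
    (hfφ : MvPolynomial.C f ∈ Ideal.span (Set.range (φ ᵥ* e)))
    {U : ι → MvPolynomial (Fin m) R[X]} (hU : e *ᵥ U = U)
    (hUO : ∃ ρ, ρ ⬝ᵥ U - 1 ∈ Ideal.span {MvPolynomial.C X})
    {J : Ideal R} (hJ : J ≤ JT e he) (hdim : DimLT (R ⧸ J) D) (hrk : RkGE e (D + 1))
    (hN : ∀ {e : Matrix ι ι (MvPolynomial (Fin m) (R ⧸ J)[X])} (_ : e * e = e)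
      (_ : DimLT (R ⧸ J) D) (_ : RkGE e D)
      {φ : ι → MvPolynomial (Fin m) (R ⧸ J)[X]} {f : (R ⧸ J)[X]} (_ : f.Monic)
      (_ : MvPolynomial.C f ∈ Ideal.span (Set.range (φ ᵥ* e)))
      {U : ι → MvPolynomial (Fin m) (R ⧸ J)[X]} (_ : e *ᵥ U = U)
      (_ : ∃ ρ, ρ ⬝ᵥ U - 1 ∈ Ideal.span {MvPolynomial.C X}),
      ∃ v, e *ᵥ v = v ∧ Um v ∧ ∀ i, v i - U i ∈ Ideal.span {MvPolynomial.C X}) :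
    ∃ v, e *ᵥ v = v ∧ Um v ∧ ∀ i, v i - U i ∈ Ideal.span {MvPolynomial.C X} := by
  set g := mapB (Fin m) (Ideal.Quotient.mk J) with hg
  have hgs : Function.Surjective g := mapB_surjective _ Ideal.Quotient.mk_surjective
  have hgX : g (MvPolynomial.C X) = MvPolynomial.C X := by rw [hg, mapB_C, Polynomial.map_X]
  have hφe : (g ∘ φ) ᵥ* e.map g = g ∘ (φ ᵥ* e) := by
    ext k : 1
    exact (RingHom.map_vecMul g _ _ k).symm
  have hf' : MvPolynomial.C (f.map (Ideal.Quotient.mk J)) ∈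
      Ideal.span (Set.range ((g ∘ φ) ᵥ* e.map g)) := by
    have := Ideal.mem_map_of_mem g hfφ
    rwa [map_span_range, ← hφe, hg, mapB_C, ← hg] at this
  have hU' : e.map g *ᵥ (g ∘ U) = g ∘ U := by rw [map_mulVec_comp, hU]
  have hUO' : ∃ ρ, ρ ⬝ᵥ (g ∘ U) - 1 ∈ Ideal.span {MvPolynomial.C X} := by
    obtain ⟨ρ, hρ⟩ := hUO
    refine ⟨g ∘ ρ, ?_⟩
    have := Ideal.mem_map_of_mem g hρ
    rwa [Ideal.map_span, Set.image_singleton, hgX, map_sub, map_one, ← comp_dotProduct] at this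
  have he' := map_mul_self he g
  have hrk' := hrk.map g
  obtain ⟨v', r, hv', ⟨ψ', hψ'⟩, hvU', hmon⟩ := exists_um_monic he' hdim hrk' (hf.map _) hf'
    (hN he' hdim (hrk'.mono D.le_succ) (hf.map _) hf' hU' hUO')
  choose w hw using fun k => hgs (v' k)
  choose ψ hψ using fun k => hgs (ψ' k)
  have hw' : g ∘ w = v' := funext hw
  set v1 := e *ᵥ w with hv1
  have hgv1 : g ∘ v1 = v' := by rw [hv1, ← map_mulVec_comp, hw', hv']
  have hmon' : ((chiR R m r (φ ⬝ᵥ v1)).map (MvPolynomial.map (Ideal.Quotient.mk J))).Monic := by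
    rw [← chiR_mapB, ← hg, ← comp_dotProduct, hgv1]
    exact hmon
  refine exists_um_of_monic_mod (chiR R m r) (chi_C_X _) he hJ hf hfφ hU hUO (v1 := v1)
    (by rw [hv1, mulVec_mulVec, he]) ⟨ψ, mem_map_of_mapB_mk_eq_zero ?_⟩ (fun i => ?_)
    (d := ((chiR R m r (φ ⬝ᵥ v1)).map (MvPolynomial.map (Ideal.Quotient.mk J))).natDegree)
    (mem_map_of_map_mk_eq_zero ?_) (fun k hk => mem_map_of_map_mk_eq_zero ?_)
  · rw [← hg, map_sub, map_one, ← comp_dotProduct, hgv1, show g ∘ ψ = ψ' from funext hψ, hψ',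
      sub_self]
  · obtain ⟨c', hc'⟩ := Ideal.mem_span_singleton'.1 (hvU' i)
    obtain ⟨c, rfl⟩ := hgs c'
    have h1 : v1 i - U i - c * MvPolynomial.C X ∈
        J.map (algebraMap R (MvPolynomial (Fin m) R[X])) := by
      refine mem_map_of_mapB_mk_eq_zero ?_
      have h2 : g (v1 i) = v' i := congrFun hgv1 i
      rw [← hg, map_sub, map_sub, map_mul, hgX, hc', h2]
      simp
    have h3 := Submodule.add_mem_sup h1 (Ideal.mul_mem_left (Ideal.span {MvPolynomial.C X}) c
      (Ideal.mem_span_singleton_self (MvPolynomial.C X)))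
    rwa [sub_add_cancel] at h3
  · rw [map_sub, ← coeff_map, map_one, sub_eq_zero]
    exact hmon'
  · rw [← coeff_map]
    exact coeff_eq_zero_of_natDegree_lt hk

theorem exists_um_of_monic (D : ℕ) : ∀ (R : Type) [CommRing R] [IsNoetherianRing R]
    {e : Matrix ι ι (MvPolynomial (Fin m) R[X])} (_ : e * e = e) (_ : DimLT R D) (_ : RkGE e D)
    {φ : ι → MvPolynomial (Fin m) R[X]} {f : R[X]} (_ : f.Monic)
    (_ : MvPolynomial.C f ∈ Ideal.span (Set.range (φ ᵥ* e)))
    {U : ι → MvPolynomial (Fin m) R[X]} (_ : e *ᵥ U = U)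
    (_ : ∃ ρ, ρ ⬝ᵥ U - 1 ∈ Ideal.span {MvPolynomial.C X}),
    ∃ v, e *ᵥ v = v ∧ Um v ∧ ∀ i, v i - U i ∈ Ideal.span {MvPolynomial.C X} := by
  induction D with
  | zero =>
    intro R _ _ e he hdim hrk φ f hf hfφ U hU hUO
    have := hdim.subsingleton
    exact ⟨U, hU, ⟨0, Subsingleton.elim _ _⟩, fun i => by rw [sub_self]; exact Ideal.zero_mem _⟩
  | succ D ih =>
    intro R _ _ e he hdim hrk φ f hf hfφ U hU hUO
    exact exists_um_of_quotient he hf hfφ hU hUO (J := JT e he) le_rfl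
      (hdim.quotient fun 𝔭 h𝔭 => by
        have := h𝔭.1.1
        exact exists_mem_J_of_minimalPrime _ h𝔭) hrk
      fun he' h1 h2 φ' f' hf' hφ' U' hU' hUO' => ih _ he' h1 h2 hf' hφ' hU' hUO'

end Lift

section Loc

variable {S L : Type} [CommRing S] [CommRing L] [Algebra S L] {σ : Type}

lemma map_vecMul_comp {B C ι : Type} [CommRing B] [CommRing C] [Fintype ι] (f : B →+* C)
    (e : Matrix ι ι B) (w : ι → B) : (f ∘ w) ᵥ* e.map f = f ∘ (w ᵥ* e) := by
  ext k : 1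
  exact (RingHom.map_vecMul f _ _ k).symm

/-- A unimodular element over a localization gives an element of the denominator set in the
content ideal of some element. -/
lemma exists_mem_content_of_um (D : Submonoid S) [IsLocalization D L] {ι : Type} [Fintype ι]
    [DecidableEq ι] {e : Matrix ι ι (MvPolynomial σ S)} {v : ι → MvPolynomial σ L}
    (hv : e.map (MvPolynomial.map (algebraMap S L)) *ᵥ v = v) (hu : Um v) :
    ∃ δ ∈ D, ∃ φ v0 : ι → MvPolynomial σ S, φ ⬝ᵥ (e *ᵥ v0) = MvPolynomial.C δ := by
  obtain ⟨ψ, hψ⟩ := hu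
  obtain ⟨m1, hm1, v0, hv0⟩ := exists_clear D v
  obtain ⟨m2, hm2, ψ0, hψ0⟩ := exists_clear D ψ
  set g := MvPolynomial.map (σ := σ) (algebraMap S L) with hg
  have h1 : g ∘ v0 = g (MvPolynomial.C m1) • v := by
    ext k : 1
    rw [hg, MvPolynomial.map_C]
    exact hv0 k
  have h2 : g ∘ ψ0 = g (MvPolynomial.C m2) • ψ := by
    ext k : 1
    rw [hg, MvPolynomial.map_C]
    exact hψ0 k
  have h3 : g (ψ0 ⬝ᵥ (e *ᵥ v0)) = g (MvPolynomial.C (m1 * m2)) := by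
    rw [← comp_dotProduct, ← map_mulVec_comp, h1, h2, mulVec_smul, hv, smul_dotProduct,
      dotProduct_smul, hψ, MvPolynomial.C_mul, map_mul]
    simp [mul_comm]
  obtain ⟨m3, hm3, h4⟩ := exists_eq_of_map_eq (L := L) D (κ := Unit)
    (v := fun _ => ψ0 ⬝ᵥ (e *ᵥ v0)) (w := fun _ => MvPolynomial.C (m1 * m2)) fun _ => h3
  refine ⟨m3 * (m1 * m2), D.mul_mem hm3 (D.mul_mem hm1 hm2),
      (MvPolynomial.C m3 : MvPolynomial σ S) • ψ0, v0, ?_⟩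
  rw [smul_dotProduct, smul_eq_mul, h4 (), MvPolynomial.C_mul, MvPolynomial.C_mul,
      MvPolynomial.C_mul]

open Polynomial in
/-- The monic polynomials. -/
def monics (R : Type) [CommRing R] : Submonoid R[X] where
  carrier := {f | f.Monic}
  mul_mem' := Monic.mul
  one_mem' := monic_one

open Polynomial in
lemma DimLT.locMonic {R : Type} [CommRing R] [IsNoetherianRing R] {D : ℕ} (h : DimLT R D)
    (L : Type) [CommRing L] [Algebra R[X] L] [IsLocalization (monics R) L] : DimLT L D := by
  intro q hq
  by_contra hlt
  rw [not_lt] at hlt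
  rw [← IsLocalization.height_under (monics R) q] at hlt
  have hp : (q.under R[X]).IsPrime := Ideal.comap_isPrime _ _
  obtain ⟨f, hf, hfm⟩ := exists_monic_mem_of_height (h.ringKrullDim_lt hlt)
  exact hq.ne_top (Ideal.eq_top_of_isUnit_mem _ (Ideal.mem_comap.1 hf)
    (IsLocalization.map_units L (⟨f, hfm⟩ : monics R)))

end Loc

section Free

open Polynomial

variable {ι : Type} [Fintype ι] [DecidableEq ι]

/-- Serre's splitting theorem. -/
theorem exists_um_of_dimLT (D : ℕ) : ∀ (R : Type) [CommRing R] [IsNoetherianRing R]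
    {e : Matrix ι ι R} (_ : e * e = e) (_ : DimLT R D) (_ : RkGE e D),
    ∃ v, e *ᵥ v = v ∧ Um v := by
  induction D with
  | zero =>
    intro R _ _ e he hdim hrk
    have := hdim.subsingleton
    exact ⟨0, Subsingleton.elim _ _, 0, Subsingleton.elim _ _⟩
  | succ D ih =>
    intro R _ _ e he hdim hrk
    set τ := (MvPolynomial.isEmptyAlgEquiv R (Fin 0)).toRingEquiv.toRingHom with hτ
    have hτC : ∀ s, τ (MvPolynomial.C s) = s := fun s => by
      exact (MvPolynomial.isEmptyAlgEquiv R (Fin 0)).commutes s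
    have hee : (e.map (MvPolynomial.C (σ := Fin 0))).map τ = e := by
      ext1 i j
      exact hτC _
    obtain ⟨s, p', φ', hs, hp', hφ', hφp'⟩ := exists_generic_coordinates
      (map_mul_self he (MvPolynomial.C (σ := Fin 0))) (hrk.map _)
    set p := fun i => τ ∘ p' i
    set φ := fun i => τ ∘ φ' i
    have hp : ∀ i, e *ᵥ p i = p i := fun i => by
      have := congrArg (fun v => τ ∘ v) (hp' i)
      simp only [← map_mulVec_comp, hee] at this
      exact this
    have hφp : ∀ i j, IsNilpotent (φ i ⬝ᵥ p j - if i = j then s else 0) := fun i j => by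
      have := (hφp' i j).map τ
      rw [map_sub, ← comp_dotProduct, apply_ite τ, map_zero, hτC] at this
      exact this
    set K := Ideal.span {s} with hK
    set g := Ideal.Quotient.mk K with hg
    have hdim' : DimLT (R ⧸ K) D := hdim.quotient fun 𝔭 h𝔭 hle =>
      hs 𝔭 h𝔭 (hle (Ideal.mem_span_singleton_self s))
    obtain ⟨y', hy', ψ', hψ'⟩ := ih (R ⧸ K) (map_mul_self he g) hdim'
      ((hrk.mono D.le_succ).map g)
    choose y1 hy1 using fun k => Ideal.Quotient.mk_surjective (y' k)
    choose ψ hψ using fun k => Ideal.Quotient.mk_surjective (ψ' k)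
    have hy1' : g ∘ y1 = y' := funext hy1
    have hψ1 : g ∘ ψ = ψ' := funext hψ
    set x1 := e *ᵥ y1 with hx1
    have hx1e : e *ᵥ x1 = x1 := by rw [hx1, mulVec_mulVec, he]
    have hψx : ψ ⬝ᵥ x1 - 1 ∈ K := by
      rw [← Ideal.Quotient.eq_zero_iff_mem, ← hg, map_sub, map_one, ← comp_dotProduct, hx1,
        ← map_mulVec_comp, hy1', hy', hψ1, hψ', sub_self]
    obtain ⟨Y, hY⟩ := exists_general_position (s ^ 2) fun i => φ i ⬝ᵥ x1
    set z := ∑ i, Y i • p i with hz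
    have hez : e *ᵥ z = z := by
      rw [hz, mulVec_sum]
      simp only [mulVec_smul, hp]
    refine ⟨x1 + s • z, by rw [mulVec_add, mulVec_smul, hez, hx1e], um_iff.2 ?_⟩
    by_contra hne
    obtain ⟨𝔮, h𝔮', hle⟩ := Ideal.exists_le_maximal _ hne
    have h𝔮 := h𝔮'.isPrime
    have hmem : ∀ k, (x1 + s • z) k ∈ 𝔮 := fun k => hle (Ideal.subset_span ⟨k, rfl⟩)
    by_cases hs𝔮 : s ∈ 𝔮
    · have hx : ψ ⬝ᵥ x1 ∈ 𝔮 := Ideal.sum_mem _ fun k _ => 𝔮.mul_mem_left _ <| by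
        have := hmem k
        rw [Pi.add_apply, Pi.smul_apply, smul_eq_mul] at this
        exact (Ideal.add_mem_iff_left _ (𝔮.mul_mem_right _ hs𝔮)).1 this
      have h1 := 𝔮.sub_mem hx ((Ideal.span_singleton_le_iff_mem 𝔮).2 hs𝔮 hψx)
      rw [sub_sub_cancel] at h1
      exact h𝔮.ne_top ((Ideal.eq_top_iff_one _).2 h1)
    · refine absurd (hdim 𝔮 h𝔮) (not_lt.2 (hY 𝔮 h𝔮 (fun i => ?_)
        fun h => hs𝔮 (h𝔮.mem_of_pow_mem _ h)))
      have h1 : φ i ⬝ᵥ (x1 + s • z) ∈ 𝔮 :=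
        Ideal.sum_mem _ fun k _ => 𝔮.mul_mem_left _ (hmem k)
      have h2 : φ i ⬝ᵥ z - Y i * s ∈ 𝔮 := by
        have : φ i ⬝ᵥ z - Y i * s = ∑ j, Y j * (φ i ⬝ᵥ p j - if i = j then s else 0) := by
          simp [hz, dotProduct_sum, mul_sub, Finset.sum_sub_distrib]
        rw [this]
        refine Ideal.sum_mem _ fun j _ => 𝔮.mul_mem_left _ ?_
        obtain ⟨n, hn⟩ := hφp i j
        exact h𝔮.mem_of_pow_mem n (by rw [hn]; exact 𝔮.zero_mem)
      rw [dotProduct_add, dotProduct_smul, smul_eq_mul] at h1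
      have h3 := 𝔮.sub_mem h1 (𝔮.mul_mem_left s h2)
      convert h3 using 1
      ring

/-- Transport of the existence of a unimodular element along an isomorphism. -/
lemma exists_um_of_bijective {A B : Type} [CommRing A] [CommRing B] (τ : A →+* B)
    (hτ : Function.Bijective τ) {e : Matrix ι ι A}
    (h : ∃ v, e.map τ *ᵥ v = v ∧ Um v) : ∃ v, e *ᵥ v = v ∧ Um v := by
  obtain ⟨v, hv, ψ, hψ⟩ := h
  choose w hw using fun k => hτ.2 (v k)
  choose ξ hξ using fun k => hτ.2 (ψ k)
  have hw' : τ ∘ w = v := funext hw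
  have hξ' : τ ∘ ξ = ψ := funext hξ
  refine ⟨w, ?_, ξ, hτ.1 ?_⟩
  · have := hv
    rw [← hw', map_mulVec_comp] at this
    exact funext fun k => hτ.1 (congrFun this k)
  · rw [← comp_dotProduct, hw', hξ', hψ, map_one]

lemma map_eval_zero_sub_mem {R σ : Type} [CommRing R] (x : MvPolynomial σ R[X]) :
    x - MvPolynomial.map C (MvPolynomial.map (evalRingHom 0) x) ∈
      Ideal.span {(MvPolynomial.C X : MvPolynomial σ R[X])} := by
  induction x using MvPolynomial.induction_on with
  | C f =>
    rw [MvPolynomial.map_C, MvPolynomial.map_C, ← MvPolynomial.C_sub, Ideal.mem_span_singleton]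
    refine map_dvd MvPolynomial.C ?_
    rw [X_dvd_iff]
    simp [coeff_zero_eq_eval_zero]
  | add p q hp hq =>
    rw [map_add, map_add, add_sub_add_comm]
    exact Ideal.add_mem _ hp hq
  | mul_X p i hp =>
    rw [map_mul, map_mul, MvPolynomial.map_X, MvPolynomial.map_X, ← sub_mul]
    exact Ideal.mul_mem_right _ _ hp

/-- Unimodular elements over polynomial rings in the stable range. -/
theorem exists_um_mvPolynomial {D : ℕ} (k : ℕ) : ∀ (R : Type) [CommRing R] [IsNoetherianRing R]
    {e : Matrix ι ι (MvPolynomial (Fin k) R)} (_ : e * e = e) (_ : DimLT R D) (_ : RkGE e D),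
    ∃ v, e *ᵥ v = v ∧ Um v := by
  induction k with
  | zero =>
    intro R _ _ e he hdim hrk
    set τ := (MvPolynomial.isEmptyAlgEquiv R (Fin 0)).toRingEquiv.toRingHom with hτ
    refine exists_um_of_bijective τ (MvPolynomial.isEmptyAlgEquiv R (Fin 0)).bijective ?_
    exact exists_um_of_dimLT D R (map_mul_self he τ) hdim (hrk.map τ)
  | succ k ih =>
    intro R _ _ e he hdim hrk
    set τ : MvPolynomial (Fin (k + 1)) R →+* MvPolynomial (Fin k) R[X] :=
      (chi (σ := Fin k) (R := R) (fun _ => 0)).symm.toRingEquiv.toRingHom.comp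
        (MvPolynomial.finSuccEquiv R k).toRingEquiv.toRingHom with hτ
    refine exists_um_of_bijective τ ?_ ?_
    · exact (chi (σ := Fin k) (R := R) (fun _ => 0)).symm.bijective.comp
        (MvPolynomial.finSuccEquiv R k).bijective
    replace he := map_mul_self he τ
    replace hrk := hrk.map τ
    generalize e.map τ = e at he hrk
    set ε := MvPolynomial.map (σ := Fin k) (evalRingHom (0 : R))
    set γ := MvPolynomial.map (σ := Fin k) (C : R →+* R[X])
    obtain ⟨u0, hu0, ρ, hρ⟩ := ih R (map_mul_self he ε) hdim (hrk.map ε)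
    set U := e *ᵥ (γ ∘ u0) with hU
    have hsub : ∀ i, (e *ᵥ (γ ∘ u0) - γ ∘ u0) i ∈
        Ideal.span {(MvPolynomial.C X : MvPolynomial (Fin k) R[X])} := by
      intro i
      have h1 : γ ∘ u0 = (e.map ε).map γ *ᵥ (γ ∘ u0) := by rw [map_mulVec_comp, hu0]
      have h2 : (e *ᵥ (γ ∘ u0) - γ ∘ u0) i =
          ((e - (e.map ε).map γ) *ᵥ (γ ∘ u0)) i := by
        rw [sub_mulVec, ← h1]
      rw [h2]
      exact Ideal.sum_mem _ fun j _ => Ideal.mul_mem_right _ _ (map_eval_zero_sub_mem (e i j))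
    set L := Localization (monics R)
    have : IsNoetherianRing L := IsLocalization.isNoetherianRing (monics R) L inferInstance
    obtain ⟨v, hv, hvu⟩ := ih L (map_mul_self he (MvPolynomial.map (algebraMap R[X] L)))
      (hdim.locMonic L) (hrk.map _)
    obtain ⟨f, hf, φ, v0, hφ⟩ := exists_mem_content_of_um (monics R) hv hvu
    obtain ⟨v, hv, hvu, -⟩ := exists_um_of_monic D R he hdim hrk (φ := φ) (f := f) hf
      (mem_span_range.2 ⟨v0, by rw [dotProduct_comm, vecMul_dotProduct, hφ]⟩) (U := U)
      (by rw [hU, mulVec_mulVec, he]) ⟨γ ∘ ρ, by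
        have h1 : (γ ∘ ρ) ⬝ᵥ U - 1 = (γ ∘ ρ) ⬝ᵥ (U - γ ∘ u0) := by
          rw [dotProduct_sub, comp_dotProduct, hρ, map_one]
        rw [h1]
        exact Ideal.sum_mem _ fun i _ => Ideal.mul_mem_left _ _ (hsub i)⟩
    exact ⟨v, hv, hvu⟩

end Free

section Descent

variable {C κ : Type} [CommRing C] [Fintype κ] [DecidableEq κ]

lemma span_entries_of_rkGE {e : Matrix κ κ C} (h : RkGE e 1) :
    Ideal.span (Set.range fun p : κ × κ => e p.1 p.2) = ⊤ := by
  by_contra hne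
  obtain ⟨𝔪, h𝔪, hle⟩ := Ideal.exists_le_maximal _ hne
  letI := Ideal.Quotient.field 𝔪
  have h1 := h (C ⧸ 𝔪) (Ideal.Quotient.mk 𝔪)
  have h2 : e.map (Ideal.Quotient.mk 𝔪) = 0 := by
    ext i j
    exact Ideal.Quotient.eq_zero_iff_mem.mpr
      (hle (Ideal.subset_span (Set.mem_range_self (f := fun p : κ × κ => e p.1 p.2) (i, j))))
  rw [h2, Matrix.rank_zero] at h1
  omega

lemma vecMulVec_mul_self_of {q ψ : κ → C} (h : ψ ⬝ᵥ q = 0) (a b : C) :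
    (1 + vecMulVec (a • q) ψ) * (1 + vecMulVec (b • q) ψ) = 1 + vecMulVec ((a + b) • q) ψ := by
  rw [Matrix.mul_add, Matrix.add_mul, Matrix.add_mul, vecMulVec_mul_vecMulVec]
  simp only [h, zero_smul, add_smul, Matrix.add_vecMulVec, smul_vecMulVec, mul_one, one_mul,
    dotProduct_smul, smul_zero, Matrix.vecMulVec_zero]
  abel

lemma transvection_inv {q ψ : κ → C} (h : ψ ⬝ᵥ q = 0) :
    (1 - vecMulVec q ψ) * (1 + vecMulVec q ψ) = 1 := by
  have := vecMulVec_mul_self_of h (-1) 1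
  simpa [sub_eq_add_neg] using this

lemma transvection_comm {e : Matrix κ κ C} {q ψ : κ → C} (hq : e *ᵥ q = q) (hψ : ψ ᵥ* e = ψ) :
    e * (1 + vecMulVec q ψ) = (1 + vecMulVec q ψ) * e := by
  rw [Matrix.mul_add, Matrix.add_mul, mul_vecMulVec, vecMulVec_mul, hq, hψ, mul_one, one_mul]

lemma transvection_mulVec (q ψ w : κ → C) :
    (1 + vecMulVec q ψ) *ᵥ w = w + (ψ ⬝ᵥ w) • q := by
  rw [Matrix.add_mulVec, one_mulVec, vecMulVec_mulVec]
  ext i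
  simp [mul_comm]

/-- Automorphisms of `im e` carrying `w` to `(1 - α) w` modulo `𝔫²`. -/
def Adj (e : Matrix κ κ C) (𝔫 : Ideal C) (w : κ → C) (α : C) : Prop :=
  ∃ g h : Matrix κ κ C, h * g = 1 ∧ e * g = g * e ∧
    ∀ i, (g *ᵥ w - (1 - α) • w) i ∈ 𝔫 ^ 2

lemma Adj.add {e : Matrix κ κ C} {𝔫 : Ideal C} {w : κ → C} {α β : C} (hα : α ∈ 𝔫) (hβ : β ∈ 𝔫)
    (h1 : Adj e 𝔫 w α) (h2 : Adj e 𝔫 w β) : Adj e 𝔫 w (α + β) := by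
  obtain ⟨g1, k1, hk1, hc1, hg1⟩ := h1
  obtain ⟨g2, k2, hk2, hc2, hg2⟩ := h2
  refine ⟨g1 * g2, k2 * k1, ?_, ?_, fun i => ?_⟩
  · rw [Matrix.mul_assoc, ← Matrix.mul_assoc k1, hk1, one_mul, hk2]
  · rw [← Matrix.mul_assoc, hc1, Matrix.mul_assoc, hc2, Matrix.mul_assoc]
  · have : (g1 * g2) *ᵥ w - (1 - (α + β)) • w = g1 *ᵥ (g2 *ᵥ w - (1 - β) • w)
        + (1 - β) • (g1 *ᵥ w - (1 - α) • w) + (α * β) • w := by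
      rw [mulVec_sub, mulVec_mulVec, mulVec_smul]
      ext i
      simp only [Pi.add_apply, Pi.sub_apply, Pi.smul_apply, smul_eq_mul]
      ring
    rw [this]
    refine Ideal.add_mem _ (Ideal.add_mem _ ?_ ?_) ?_
    · exact Ideal.sum_mem _ fun j _ => Ideal.mul_mem_left _ _ (hg2 j)
    · exact Ideal.mul_mem_left _ _ (hg1 i)
    · exact Ideal.mul_mem_right _ _ (by rw [pow_two]; exact Ideal.mul_mem_mul hα hβ)

lemma Adj.zero {e : Matrix κ κ C} {𝔫 : Ideal C} {w : κ → C} : Adj e 𝔫 w 0 :=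
  ⟨1, 1, one_mul _, by simp, fun i => by simp⟩

/-- If the complement of `w` in `im e` contains `q` and its dual contains `l`, multiplication by
`1 - β * l(q)` is realised on `w` by an automorphism, modulo squares. -/
lemma adj_of_complement {e : Matrix κ κ C} {𝔫 : Ideal C} {w ψ q l : κ → C}
    (hw : e *ᵥ w = w) (hψ : ψ ᵥ* e = ψ) (h1 : ψ ⬝ᵥ w = 1) (hq : e *ᵥ q = q) (hψq : ψ ⬝ᵥ q = 0)
    (hl : l ᵥ* e = l) (hlw : l ⬝ᵥ w = 0) {β : C} (hβ : β ∈ 𝔫) :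
    Adj e 𝔫 w (β * (l ⬝ᵥ q)) := by
  set γ := β * (l ⬝ᵥ q) with hγ
  have hγ𝔫 : γ ∈ 𝔫 := Ideal.mul_mem_right _ _ hβ
  have e1 : l ⬝ᵥ (-β • w) = 0 := by rw [dotProduct_smul, hlw, smul_zero]
  have e2 : ψ ⬝ᵥ (-(1 + γ) • q) = 0 := by rw [dotProduct_smul, hψq, smul_zero]
  set g1 := 1 + vecMulVec q ψ
  set g2 := 1 + vecMulVec (-β • w) l
  set g3 := 1 + vecMulVec (-(1 + γ) • q) ψ
  have c1 : e * g1 = g1 * e := transvection_comm hq hψ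
  have c2 : e * g2 = g2 * e := transvection_comm (by rw [mulVec_smul, hw]) hl
  have c3 : e * g3 = g3 * e := transvection_comm (by rw [mulVec_smul, hq]) hψ
  refine ⟨g3 * (g2 * g1), (1 - vecMulVec q ψ) * ((1 - vecMulVec (-β • w) l) *
    (1 - vecMulVec (-(1 + γ) • q) ψ)), ?_, ?_, fun i => ?_⟩
  · rw [Matrix.mul_assoc, Matrix.mul_assoc, ← Matrix.mul_assoc _ g3, transvection_inv e2, one_mul,
      ← Matrix.mul_assoc _ g2, transvection_inv e1, one_mul, transvection_inv hψq]
  · rw [← Matrix.mul_assoc, c3, Matrix.mul_assoc, ← Matrix.mul_assoc e, c2, Matrix.mul_assoc, c1]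
    simp only [Matrix.mul_assoc]
  · have : (g3 * (g2 * g1)) *ᵥ w - (1 - γ) • w = (γ ^ 2) • q := by
      rw [← mulVec_mulVec, ← mulVec_mulVec, transvection_mulVec, transvection_mulVec,
        transvection_mulVec]
      simp only [dotProduct_add, dotProduct_smul, h1, hlw, hψq, smul_eq_mul]
      ext i
      simp only [Pi.add_apply, Pi.sub_apply, Pi.smul_apply, smul_eq_mul]
      rw [hγ]
      ring
    rw [this]
    exact Ideal.mul_mem_right _ _ (Ideal.pow_mem_pow hγ𝔫 2)

lemma adj_of_rkGE {e : Matrix κ κ C} (he : e * e = e) (hr : RkGE e 2) {𝔫 : Ideal C}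
    {w ψ : κ → C} (hw : e *ᵥ w = w) (hψ : ψ ᵥ* e = ψ) (h1 : ψ ⬝ᵥ w = 1) {α : C} (hα : α ∈ 𝔫) :
    Adj e 𝔫 w α := by
  have hspan := span_entries_of_rkGE (RkGE.sub1 hr w ψ)
  have hee : sub1 e w ψ * sub1 e w ψ = sub1 e w ψ := sub1_mul_self he hw hψ h1
  have key : ∀ y ∈ Ideal.span (Set.range fun p : κ × κ => sub1 e w ψ p.1 p.2),
      ∀ α ∈ 𝔫, Adj e 𝔫 w (α * y) := by
    intro y hy
    induction hy using Submodule.span_induction with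
    | mem y hy =>
      obtain ⟨⟨i, j⟩, rfl⟩ := hy
      intro α hα
      have h2 : sub1 e w ψ i j = (sub1 e w ψ i) ⬝ᵥ (fun k => sub1 e w ψ k j) := by
        conv_lhs => rw [← hee]
        rfl
      have hcol : (fun k => sub1 e w ψ k j) = sub1 e w ψ *ᵥ Pi.single j 1 := by
        ext k; simp
      have hrow : sub1 e w ψ i = Pi.single i 1 ᵥ* sub1 e w ψ := by
        ext k; simp
      change Adj e 𝔫 w (α * sub1 e w ψ i j)
      rw [h2]
      refine adj_of_complement hw hψ h1 ?_ ?_ ?_ ?_ hα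
      · rw [hcol, mulVec_mulVec, mul_sub1 he hw]
      · rw [hcol, dotProduct_mulVec, vecMul_sub1_self hψ h1, zero_dotProduct]
      · rw [hrow, vecMul_vecMul, sub1_mul he hψ]
      · rw [hrow, ← dotProduct_mulVec, sub1_mulVec_self hw h1, dotProduct_zero]
    | zero => intro α _; rw [mul_zero]; exact Adj.zero
    | add x y _ _ hx hy =>
      intro α hα
      rw [mul_add]
      exact Adj.add (Ideal.mul_mem_right _ _ hα) (Ideal.mul_mem_right _ _ hα) (hx α hα) (hy α hα)
    | smul a x _ hx =>
      intro α hα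
      rw [smul_eq_mul, ← mul_assoc]
      exact hx _ (Ideal.mul_mem_right _ _ hα)
  simpa using key 1 (hspan ▸ Submodule.mem_top) α hα

/-- A unimodular element of `im e` congruent to `w1` modulo `𝔫` can be corrected to one congruent
to `w1` modulo `𝔫²`. -/
lemma exists_um_sub_mem_sq {e : Matrix κ κ C} (he : e * e = e) (hr : RkGE e 2) (𝔫 : Ideal C)
    {w w1 : κ → C} (hw : e *ᵥ w = w) (hu : Um w) (hw1 : e *ᵥ w1 = w1)
    (hww : ∀ i, w i - w1 i ∈ 𝔫) :
    ∃ w', e *ᵥ w' = w' ∧ Um w' ∧ ∀ i, w' i - w1 i ∈ 𝔫 ^ 2 := by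
  obtain ⟨ψ, hψ, h1⟩ := exists_dual hw hu he
  set ν := w - w1 with hν
  set α := ψ ⬝ᵥ ν with hα
  have hα𝔫 : α ∈ 𝔫 := Ideal.sum_mem _ fun i _ => Ideal.mul_mem_left _ _ (hww i)
  set w2 := w1 + α • w with hw2
  have h2 : ψ ⬝ᵥ w2 = 1 := by
    rw [hw2, dotProduct_add, dotProduct_smul, h1, hα, hν, dotProduct_sub, h1]
    simp
  have hw2e : e *ᵥ w2 = w2 := by rw [hw2, mulVec_add, mulVec_smul, hw, hw1]
  obtain ⟨g, k, hk, hc, hg⟩ := adj_of_rkGE he hr hw2e hψ h2 hα𝔫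
  refine ⟨g *ᵥ w2, by rw [mulVec_mulVec, hc, ← mulVec_mulVec, hw2e], ⟨ψ ᵥ* k, ?_⟩, fun i => ?_⟩
  · rw [← dotProduct_mulVec, mulVec_mulVec, hk, one_mulVec, h2]
  · have : (g *ᵥ w2) i - w1 i = (g *ᵥ w2 - (1 - α) • w2) i + (α * (w i - w1 i) - α * α * w i) := by
      simp only [Pi.sub_apply, Pi.smul_apply, smul_eq_mul, hw2, Pi.add_apply]
      ring
    rw [this]
    refine Ideal.add_mem _ (hg i) (Ideal.sub_mem _ ?_ (Ideal.mul_mem_right _ _ ?_))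
    · rw [pow_two]; exact Ideal.mul_mem_mul hα𝔫 (hww i)
    · rw [pow_two]; exact Ideal.mul_mem_mul hα𝔫 hα𝔫

lemma exists_um_of_sq_le_range {B : Type} [CommRing B] (ι : B →+* C) (hι : Function.Injective ι)
    (𝔫 : Ideal C) (h1 : ∀ x, ∃ b, x - ι b ∈ 𝔫) (h2 : ∀ x ∈ 𝔫 ^ 2, ∃ b, ι b = x)
    {e : Matrix κ κ B} (he : e * e = e) (hr : RkGE e 2)
    (h : ∃ w, e.map ι *ᵥ w = w ∧ Um w) : ∃ v, e *ᵥ v = v ∧ Um v := by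
  obtain ⟨w, hw, hu⟩ := h
  choose p0 hp0 using fun i => h1 (w i)
  have hw1 : e.map ι *ᵥ (ι ∘ (e *ᵥ p0)) = ι ∘ (e *ᵥ p0) := by
    rw [map_mulVec_comp, mulVec_mulVec, he]
  obtain ⟨w', hw', ⟨μ, hμ⟩, hww⟩ := exists_um_sub_mem_sq (map_mul_self he ι) (hr.map ι) 𝔫 hw hu hw1
    (fun i => by
      have : w i - (ι ∘ (e *ᵥ p0)) i = (e.map ι *ᵥ (w - ι ∘ p0)) i := by
        rw [mulVec_sub, hw, map_mulVec_comp]; rfl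
      rw [this]
      exact Ideal.sum_mem _ fun j _ => Ideal.mul_mem_left _ _ (hp0 j))
  choose d hd using fun i => h2 _ (hww i)
  set v := e *ᵥ p0 + d with hv
  have hwv : w' = ι ∘ v := by
    ext i
    simp only [hv, Function.comp, Pi.add_apply, map_add, hd]
    ring
  refine ⟨v, ?_, ?_⟩
  · have : ι ∘ (e *ᵥ v) = ι ∘ v := by rw [← map_mulVec_comp, ← hwv, hw']
    exact hι.comp_left this
  · choose b hb using fun k => h1 (μ k)
    set c := 1 - b ⬝ᵥ v with hc
    have hιc : ι c = ∑ k, (μ k - ι (b k)) * ι (v k) := by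
      rw [hc, map_sub, map_one, ← hμ, hwv, ← comp_dotProduct]
      simp only [dotProduct, sub_mul, Finset.sum_sub_distrib, Function.comp]
    have hcn : ι c ∈ 𝔫 := by
      rw [hιc]
      exact Ideal.sum_mem _ fun k _ => Ideal.mul_mem_right _ _ (hb k)
    choose y hy using fun k => h2 (ι c * (μ k - ι (b k)))
      (by rw [pow_two]; exact Ideal.mul_mem_mul hcn (hb k))
    have hcc : c * c = y ⬝ᵥ v := by
      apply hι
      rw [map_mul]
      conv_lhs => rw [hιc, Finset.mul_sum]
      rw [← comp_dotProduct]
      simp only [dotProduct, Function.comp, hy]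
      refine Finset.sum_congr rfl fun k _ => ?_
      rw [hιc, mul_assoc]
    refine ⟨c • b + b + y, ?_⟩
    rw [add_dotProduct, add_dotProduct, smul_dotProduct, ← hcc, smul_eq_mul]
    have : b ⬝ᵥ v = 1 - c := by rw [hc]; ring
    rw [this]
    ring

lemma exists_um_of_pow_le_range (j : ℕ) : ∀ {B C : Type} [CommRing B] [CommRing C] (ι : B →+* C)
    (_ : Function.Injective ι) (𝔫 : Ideal C) (_ : ∀ x, ∃ b, x - ι b ∈ 𝔫)
    (_ : ∀ x ∈ 𝔫 ^ (2 ^ j), ∃ b, ι b = x) {e : Matrix κ κ B} (_ : e * e = e) (_ : RkGE e 2)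
    (_ : ∃ w, e.map ι *ᵥ w = w ∧ Um w), ∃ v, e *ᵥ v = v ∧ Um v := by
  induction j with
  | zero =>
    intro B C _ _ ι hι 𝔫 h1 h2 e he hr h
    refine exists_um_of_sq_le_range ι hι 𝔫 h1 (fun x hx => h2 x ?_) he hr h
    rw [pow_zero]
    exact Ideal.pow_le_pow_right (by norm_num) hx
  | succ j IH =>
    intro B C _ _ ι hι 𝔫 h1 h2 e he hr h
    let S : Subring C :=
      { carrier := {x | ∃ b, x - ι b ∈ 𝔫 ^ 2}
        mul_mem' := by
          rintro x y ⟨b, hb⟩ ⟨c, hc⟩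
          refine ⟨b * c, ?_⟩
          rw [show x * y - ι (b * c) = (x - ι b) * y + ι b * (y - ι c) by rw [map_mul]; ring]
          exact Ideal.add_mem _ (Ideal.mul_mem_right _ _ hb) (Ideal.mul_mem_left _ _ hc)
        one_mem' := ⟨1, by simp⟩
        add_mem' := by
          rintro x y ⟨b, hb⟩ ⟨c, hc⟩
          refine ⟨b + c, ?_⟩
          rw [show x + y - ι (b + c) = (x - ι b) + (y - ι c) by rw [map_add]; ring]
          exact Ideal.add_mem _ hb hc
        zero_mem' := ⟨0, by simp⟩
        neg_mem' := by
          rintro x ⟨b, hb⟩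
          refine ⟨-b, ?_⟩
          rw [show -x - ι (-b) = -(x - ι b) by rw [map_neg]; ring]
          exact neg_mem hb }
    have hmem : ∀ b, ι b ∈ S := fun b => ⟨b, by simp⟩
    let ι' : B →+* S := ι.codRestrict S hmem
    have hcomp : S.subtype.comp ι' = ι := by ext; rfl
    have hsq : ∀ x ∈ 𝔫 ^ 2, x ∈ S := fun x hx => ⟨0, by simpa using hx⟩
    refine IH ι' (fun a b hab => hι (congrArg Subtype.val hab)) ((𝔫 ^ 2).comap S.subtype)
      (fun x => ?_) (fun x hx => ?_) he hr ?_
    · obtain ⟨b, hb⟩ := x.2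
      exact ⟨b, hb⟩
    · have hx' : (x : C) ∈ 𝔫 ^ (2 ^ (j + 1)) := by
        have := Ideal.le_comap_pow S.subtype (K := 𝔫 ^ 2) (2 ^ j) hx
        rw [← pow_mul] at this
        rw [pow_succ, mul_comm]
        exact this
      obtain ⟨b, hb⟩ := h2 _ hx'
      exact ⟨b, Subtype.ext hb⟩
    · refine exists_um_of_sq_le_range S.subtype Subtype.val_injective 𝔫 (fun x => ?_)
        (fun x hx => ⟨⟨x, hsq x hx⟩, rfl⟩) (map_mul_self he ι') (hr.map ι') ?_
      · obtain ⟨b, hb⟩ := h1 x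
        exact ⟨ι' b, hb⟩
      · rw [Matrix.map_map, ← RingHom.coe_comp, hcomp]
        exact h

lemma mapB_injective (σ : Type) {R S : Type} [CommRing R] [CommRing S] {g : R →+* S}
    (hg : Function.Injective g) : Function.Injective (mapB σ g) :=
  MvPolynomial.map_injective _ (Polynomial.map_injective _ hg)

lemma mem_map_CC {σ S : Type} [CommRing S] (I : Ideal S) (x : MvPolynomial σ (Polynomial S)) :
    x ∈ (I.map (Polynomial.C : S →+* Polynomial S)).map
      (MvPolynomial.C : Polynomial S →+* MvPolynomial σ (Polynomial S)) ↔
      ∀ d i, (x.coeff d).coeff i ∈ I := by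
  rw [MvPolynomial.mem_map_C_iff]
  exact forall_congr' fun d => Ideal.mem_map_C_iff

lemma exists_mapB_eq {σ R S : Type} [CommRing R] [CommRing S] (g : R →+* S)
    (x : MvPolynomial σ (Polynomial S)) (h : ∀ d i, ∃ r, g r = (x.coeff d).coeff i) :
    ∃ y, mapB σ g y = x := by
  have h1 : x ∈ Set.range (MvPolynomial.map (σ := σ) (Polynomial.mapRingHom g)) := by
    rw [MvPolynomial.mem_range_map_iff_coeffs_subset]
    rintro c hc
    obtain ⟨d, _, rfl⟩ := MvPolynomial.mem_coeffs_iff.mp hc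
    have : x.coeff d ∈ (Polynomial.mapRingHom g).range := by
      rw [Polynomial.mem_map_range]
      exact fun i => h d i
    exact this
  exact h1

lemma exists_um_of_nilpotent_extension {σ R S : Type} [CommRing R] [CommRing S] (g : R →+* S)
    (hg : Function.Injective g) (𝔫 : Ideal S) (h1 : ∀ x, ∃ b, x - g b ∈ 𝔫) (k : ℕ)
    (h2 : ∀ x ∈ 𝔫 ^ k, ∃ b, g b = x) {e : Matrix κ κ (MvPolynomial σ (Polynomial R))}
    (he : e * e = e) (hr : RkGE e 2) (h : ∃ w, e.map (mapB σ g) *ᵥ w = w ∧ Um w) :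
    ∃ v, e *ᵥ v = v ∧ Um v := by
  refine exists_um_of_pow_le_range k (mapB σ g) (mapB_injective σ hg)
    ((𝔫.map (Polynomial.C : S →+* Polynomial S)).map
      (MvPolynomial.C : Polynomial S →+* MvPolynomial σ (Polynomial S))) (fun x => ?_)
    (fun x hx => ?_) he hr h
  · choose b hb using h1
    have h3 : ∃ y, x - mapB σ g y ∈ (𝔫.map (Polynomial.C : S →+* Polynomial S)).map
      (MvPolynomial.C : Polynomial S →+* MvPolynomial σ (Polynomial S)) := by
      have hsurj := mapB_surjective (R := R) σ (g := (Ideal.Quotient.mk 𝔫).comp g) (by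
        intro y
        obtain ⟨y, rfl⟩ := Ideal.Quotient.mk_surjective y
        exact ⟨b y, (Ideal.Quotient.eq.mpr (hb y)).symm⟩)
      obtain ⟨y, hy⟩ := hsurj (mapB σ (Ideal.Quotient.mk 𝔫) x)
      refine ⟨y, ?_⟩
      rw [mem_map_CC]
      intro d i
      rw [← Ideal.Quotient.eq_zero_iff_mem]
      have h4 := congrArg (fun z => (MvPolynomial.coeff d z).coeff i) hy
      simp only [mapB, MvPolynomial.coeff_map, Polynomial.coe_mapRingHom, Polynomial.coeff_map,
        RingHom.comp_apply] at h4
      simp only [mapB, MvPolynomial.coeff_sub, Polynomial.coeff_sub, map_sub,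
        MvPolynomial.coeff_map, Polynomial.coe_mapRingHom, Polynomial.coeff_map, h4, sub_self]
    exact h3
  · rw [← Ideal.map_pow, ← Ideal.map_pow, mem_map_CC] at hx
    refine exists_mapB_eq g x fun d i => h2 _ (Ideal.pow_le_pow_right ?_ (hx d i))
    exact Nat.lt_two_pow_self.le

end Descent

section Kronecker

open Polynomial

variable {O K : Type} [CommRing O] [CommRing K] [Algebra O K]

/-- The content of a polynomial over an `O`-algebra, as an `O`-submodule. -/
def cont (O : Type) {K : Type} [CommRing O] [CommRing K] [Algebra O K] (f : K[X]) :
    Submodule O K := Submodule.span O (Set.range f.coeff)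

lemma coeff_mem_cont (f : K[X]) (i : ℕ) : f.coeff i ∈ cont O f :=
  Submodule.subset_span ⟨i, rfl⟩

lemma cont_le {f : K[X]} {M : Submodule O K} : cont O f ≤ M ↔ ∀ i, f.coeff i ∈ M := by
  rw [cont, Submodule.span_le]
  exact Set.range_subset_iff

lemma cont_fg (f : K[X]) : (cont O f).FG :=
  Submodule.fg_span ((f.finite_range_coeff))

lemma cont_zero : cont O (0 : K[X]) = 0 := by
  rw [Submodule.zero_eq_bot, eq_bot_iff, cont_le]
  simp

lemma cont_le_divX (f : K[X]) : cont O f ≤ Submodule.span O {f.coeff 0} + cont O f.divX := by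
  rw [cont_le]
  rintro (_ | i)
  · exact Submodule.mem_sup_left (Submodule.mem_span_singleton_self _)
  · exact Submodule.mem_sup_right (by rw [← coeff_divX]; exact coeff_mem_cont _ _)

lemma divX_cont_le (f : K[X]) : cont O f.divX ≤ cont O f :=
  cont_le.mpr fun i => by rw [coeff_divX]; exact coeff_mem_cont _ _

lemma coeff_zero_cont_le (f : K[X]) : Submodule.span O {f.coeff 0} ≤ cont O f := by
  rw [Submodule.span_singleton_le_iff_mem]; exact coeff_mem_cont _ _

lemma cont_mul_divX_le (f g : K[X]) :
    cont O (f * g.divX) ≤ cont O (f * g) + Submodule.span O {g.coeff 0} * cont O f := by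
  rw [cont_le]
  intro i
  have h : (f * g.divX).coeff i = (f * g).coeff (i + 1) - g.coeff 0 * f.coeff (i + 1) := by
    conv_rhs => rw [← divX_mul_X_add g]
    rw [mul_add, ← mul_assoc, coeff_add, coeff_mul_X, coeff_mul_C]
    simp [mul_comm]
  rw [h]
  exact sub_mem (Submodule.mem_sup_left (coeff_mem_cont _ _))
    (Submodule.mem_sup_right (Submodule.mul_mem_mul (Submodule.mem_span_singleton_self _)
      (coeff_mem_cont _ _)))

lemma add_pow_succ_le (A B : Submodule O K) (n : ℕ) :
    (A + B) ^ (n + 1) ≤ A * (A + B) ^ n + B ^ (n + 1) := by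
  induction n with
  | zero => simp
  | succ n ih =>
    calc (A + B) ^ (n + 2) = A * (A + B) ^ (n + 1) + B * (A + B) ^ (n + 1) := by
          rw [pow_succ' _ (n + 1), add_mul]
      _ ≤ A * (A + B) ^ (n + 1) + B * (A * (A + B) ^ n + B ^ (n + 1)) := by gcongr
      _ = A * (A + B) ^ (n + 1) + (A * (B * (A + B) ^ n) + B ^ (n + 2)) := by ring
      _ ≤ A * (A + B) ^ (n + 1) + (A * ((A + B) * (A + B) ^ n) + B ^ (n + 2)) := by
          gcongr; exact le_sup_right
      _ = A * (A + B) ^ (n + 1) + A * (A + B) ^ (n + 1) + B ^ (n + 2) := by ring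
      _ = _ := by rw [Submodule.add_eq_sup (A * _) (A * _), sup_idem]

/-- The Dedekind–Mertens lemma. -/
lemma dedekind_mertens (n : ℕ) : ∀ (f g : K[X]), g.natDegree ≤ n →
    cont O f ^ (n + 1) * cont O g ≤ cont O f ^ n * cont O (f * g) := by
  induction n with
  | zero =>
    intro f g hg
    rw [Polynomial.eq_C_of_natDegree_le_zero hg, zero_add, pow_one, pow_zero, one_mul,
      Submodule.mul_le]
    intro x hx y hy
    have hx' : cont O f ≤ (cont O (f * C (g.coeff 0))).comap
        (LinearMap.mulRight O (g.coeff 0)) := by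
      rw [cont_le]
      intro i
      rw [Submodule.mem_comap, LinearMap.mulRight_apply, ← coeff_mul_C]
      exact coeff_mem_cont _ _
    have hy' : cont O (C (g.coeff 0)) ≤ Submodule.span O {g.coeff 0} := by
      rw [cont_le]
      intro i
      rw [coeff_C]
      split_ifs
      · exact Submodule.mem_span_singleton_self _
      · exact zero_mem _
    obtain ⟨c, rfl⟩ := Submodule.mem_span_singleton.mp (hy' hy)
    rw [mul_smul_comm]
    exact Submodule.smul_mem _ _ (hx' hx)
  | succ n IH =>
    intro f g hg
    have key : ∀ d : ℕ, ∀ f : K[X], f.degree < d →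
        cont O f ^ (n + 2) * cont O g ≤ cont O f ^ (n + 1) * cont O (f * g) := by
      intro d
      induction d with
      | zero =>
        intro f hf
        have : f = 0 := Polynomial.degree_eq_bot.mp (by
          simpa [Nat.WithBot.lt_zero_iff] using hf)
        rw [this, cont_zero, pow_succ, mul_zero, zero_mul]
        exact bot_le
      | succ d IHd =>
        intro f hf
        set F := cont O f
        set H := cont O (f * g)
        set A := Submodule.span O {f.coeff 0}
        set B := Submodule.span O {g.coeff 0}
        have hAF : A ≤ F := coeff_zero_cont_le f
        have hAB : A * B ≤ H := by
          rw [Submodule.span_mul_span, Set.singleton_mul_singleton, ← mul_coeff_zero]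
          exact coeff_zero_cont_le _
        have e1 : A * (F ^ (n + 1) * cont O g) ≤ F ^ (n + 1) * H := by
          have hg' : F ^ (n + 1) * cont O g.divX ≤ F ^ n * (H + B * F) :=
            (IH f g.divX (by rw [natDegree_divX_eq_natDegree_tsub_one]; omega)).trans
              (mul_le_mul_right (cont_mul_divX_le f g) _)
          calc A * (F ^ (n + 1) * cont O g)
              ≤ A * (F ^ (n + 1) * (B + cont O g.divX)) := by gcongr; exact cont_le_divX g
            _ = (A * B) * F ^ (n + 1) + A * (F ^ (n + 1) * cont O g.divX) := by ring
            _ ≤ (A * B) * F ^ (n + 1) + A * (F ^ n * (H + B * F)) := by gcongr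
            _ = (A * B) * F ^ (n + 1) + (A * F ^ n * H + (A * B) * F ^ (n + 1)) := by ring
            _ ≤ H * F ^ (n + 1) + (F * F ^ n * H + H * F ^ (n + 1)) := by gcongr
            _ = F ^ (n + 1) * H + F ^ (n + 1) * H + F ^ (n + 1) * H := by ring
            _ = _ := by simp only [Submodule.add_eq_sup, sup_idem]
        have hF' : cont O f.divX ≤ F := divX_cont_le f
        have e2 : cont O f.divX ^ (n + 2) * cont O g ≤ F ^ (n + 1) * H := by
          calc cont O f.divX ^ (n + 2) * cont O g
              ≤ cont O f.divX ^ (n + 1) * cont O (f.divX * g) := IHd _ (by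
                by_cases hf0 : f = 0
                · rw [hf0, divX_zero, degree_zero]; exact WithBot.bot_lt_coe _
                · have := degree_divX_lt hf0
                  rw [degree_eq_natDegree hf0] at hf this
                  exact lt_of_lt_of_le this (by
                    have h2 : f.natDegree < d + 1 := by exact_mod_cast hf
                    exact_mod_cast Nat.le_of_lt_succ h2))
            _ ≤ F ^ (n + 1) * (H + A * cont O g) := by
                gcongr
                rw [mul_comm f.divX]
                refine (cont_mul_divX_le g f).trans ?_
                rw [mul_comm g f]
            _ = F ^ (n + 1) * H + A * (F ^ (n + 1) * cont O g) := by ring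
            _ ≤ F ^ (n + 1) * H + F ^ (n + 1) * H := by gcongr
            _ = _ := by simp only [Submodule.add_eq_sup, sup_idem]
        have hsum : F = A + cont O f.divX :=
          le_antisymm (cont_le_divX f) (sup_le hAF hF')
        calc F ^ (n + 2) * cont O g
            ≤ (A * F ^ (n + 1) + cont O f.divX ^ (n + 2)) * cont O g := by
              gcongr
              have := add_pow_succ_le A (cont O f.divX) (n + 1)
              rw [← hsum] at this
              exact this
          _ = A * (F ^ (n + 1) * cont O g) + cont O f.divX ^ (n + 2) * cont O g := by ring
          _ ≤ F ^ (n + 1) * H + F ^ (n + 1) * H := by gcongr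
          _ = _ := by simp only [Submodule.add_eq_sup, sup_idem]
    exact key (f.natDegree + 1) f (by
      exact_mod_cast lt_of_le_of_lt degree_le_natDegree (by exact_mod_cast Nat.lt_succ_self _))

lemma isIntegral_of_mul_le {M : Submodule O K} (hM : M.FG) {x : K} {n : ℕ}
    (hx : ∀ y ∈ M, x * y ∈ M) (hn : x ^ n ∈ M) : IsIntegral O x := by
  haveI : Module.Finite O M := Module.Finite.iff_fg.mpr hM
  let μ : M →ₗ[O] M := (LinearMap.mulLeft O x).restrict hx
  obtain ⟨p, hp, hpμ⟩ := LinearMap.exists_monic_and_aeval_eq_zero O μ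
  have h1 : ∀ (q : O[X]) (y : M), ((aeval μ q) y : K) = aeval x q * y := by
    intro q y
    induction q using Polynomial.induction_on with
    | C a => simp [Algebra.smul_def]
    | add p q hp hq => simp [add_mul, hp, hq]
    | monomial k a ih =>
      have : ∀ k : ℕ, ∀ y : M, ((μ ^ k) y : K) = x ^ k * y := by
        intro k
        induction k with
        | zero => simp
        | succ k ih =>
          intro y
          rw [pow_succ, Module.End.mul_apply, ih]
          change x ^ k * (x * y) = _
          ring
      simp [this, Algebra.smul_def, mul_assoc]
  refine ⟨p * X ^ n, hp.mul (monic_X_pow n), ?_⟩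
  rw [← aeval_def, map_mul, map_pow, aeval_X]
  have := h1 p ⟨x ^ n, hn⟩
  rw [hpμ] at this
  simpa using this.symm

/-- Kronecker's theorem: if `f * g` has coefficients in `O`, products of coefficients of `f` and
`g` are integral over `O`. -/
lemma kronecker {f g : K[X]} (h : ∀ i, ∃ c, algebraMap O K c = (f * g).coeff i) (i j : ℕ) :
    IsIntegral O (f.coeff i * g.coeff j) := by
  set n := g.natDegree
  have h1 : cont O (f * g) ≤ 1 := by
    rw [cont_le]
    intro i
    obtain ⟨c, hc⟩ := h i
    exact Submodule.mem_one.mpr ⟨c, hc⟩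
  have h2 : cont O f ^ (n + 1) * cont O g ≤ cont O f ^ n :=
    (dedekind_mertens n f g le_rfl).trans ((mul_le_mul_right h1 _).trans (mul_one _).le)
  refine isIntegral_of_mul_le (M := cont O f ^ n * cont O g ^ n)
    (((cont_fg f).pow n).mul ((cont_fg g).pow n)) (n := n) (fun y hy => ?_) ?_
  · have h3 : (cont O f * cont O g) * (cont O f ^ n * cont O g ^ n) ≤
        cont O f ^ n * cont O g ^ n := by
      calc (cont O f * cont O g) * (cont O f ^ n * cont O g ^ n)
          = (cont O f ^ (n + 1) * cont O g) * cont O g ^ n := by ring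
        _ ≤ _ := by gcongr
    exact h3 (Submodule.mul_mem_mul
      (Submodule.mul_mem_mul (coeff_mem_cont _ _) (coeff_mem_cont _ _)) hy)
  · rw [mul_pow]
    exact Submodule.mul_mem_mul (Submodule.pow_mem_pow _ (coeff_mem_cont _ _) n)
      (Submodule.pow_mem_pow _ (coeff_mem_cont _ _) n)

lemma kronecker_of_isIntegral {f g : K[X]} (h : ∀ i, IsIntegral O ((f * g).coeff i)) (i j : ℕ) :
    IsIntegral O (f.coeff i * g.coeff j) := by
  have : IsIntegral (integralClosure O K) (f.coeff i * g.coeff j) :=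
    kronecker (fun i => ⟨⟨_, h i⟩, rfl⟩) i j
  exact isIntegral_trans _ this

lemma mvKronecker_fin (k : ℕ) : ∀ {f g : MvPolynomial (Fin k) K}
    (_ : ∀ d, IsIntegral O ((f * g).coeff d)) (a b : Fin k →₀ ℕ),
    IsIntegral O (f.coeff a * g.coeff b) := by
  induction k with
  | zero =>
    intro f g h a b
    have h0 := h 0
    rw [Subsingleton.elim a 0, Subsingleton.elim b 0]
    rw [← MvPolynomial.constantCoeff_eq, map_mul] at h0
    exact h0
  | succ k IH =>
    intro f g h a b
    letI : Algebra (MvPolynomial (Fin k) O) (MvPolynomial (Fin k) K) :=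
      MvPolynomial.algebraMvPolynomial
    have h1 : ∀ i, IsIntegral (MvPolynomial (Fin k) O)
        ((MvPolynomial.finSuccEquiv K k f * MvPolynomial.finSuccEquiv K k g).coeff i) := by
      intro i
      rw [← map_mul, MvPolynomial.isIntegral_iff_isIntegral_coeff]
      intro d
      rw [MvPolynomial.finSuccEquiv_coeff_coeff]
      exact h _
    have h2 := kronecker_of_isIntegral h1 (a 0) (b 0)
    rw [MvPolynomial.isIntegral_iff_isIntegral_coeff] at h2
    have h3 := IH h2 a.tail b.tail
    rwa [MvPolynomial.finSuccEquiv_coeff_coeff, MvPolynomial.finSuccEquiv_coeff_coeff,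
      Finsupp.cons_tail, Finsupp.cons_tail] at h3

lemma mvKronecker {σ : Type} [Finite σ] {f g : MvPolynomial σ K}
    (h : ∀ d, IsIntegral O ((f * g).coeff d)) (a b : σ →₀ ℕ) :
    IsIntegral O (f.coeff a * g.coeff b) := by
  obtain ⟨k, ⟨ε⟩⟩ := Finite.exists_equiv_fin σ
  have h1 : ∀ d, IsIntegral O ((MvPolynomial.rename ε f * MvPolynomial.rename ε g).coeff d) := by
    intro d
    have : d = Finsupp.mapDomain ε (Finsupp.mapDomain ε.symm d) := by
      rw [← Finsupp.mapDomain_comp]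
      simp
    rw [← map_mul, this, MvPolynomial.coeff_rename_mapDomain _ ε.injective]
    exact h _
  have := mvKronecker_fin k h1 (Finsupp.mapDomain ε a) (Finsupp.mapDomain ε b)
  rwa [MvPolynomial.coeff_rename_mapDomain _ ε.injective,
    MvPolynomial.coeff_rename_mapDomain _ ε.injective] at this

end Kronecker

section Residue

open MvPolynomial

variable {ι σ : Type} [Fintype ι] [DecidableEq ι]

lemma coeff_mul_coeff_of_split {k F : Type} [Field k] [Field F] (f : k →+* F)
    {e : Matrix ι ι (MvPolynomial σ k)} {r : ℕ} {V : Matrix ι (Fin r) (MvPolynomial σ k)}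
    {Ψ : Matrix (Fin r) ι (MvPolynomial σ k)} (h1 : V * Ψ = e) (h2 : Ψ * V = 1)
    {a b : ι → MvPolynomial σ F} {u : F} (hu : u ≠ 0)
    (ha : e.map (MvPolynomial.map f) *ᵥ a = a) (hb : b ᵥ* e.map (MvPolynomial.map f) = b)
    (hab : vecMulVec a b = (C u : MvPolynomial σ F) • e.map (MvPolynomial.map f)) (i j : ι)
    (α β : σ →₀ ℕ) :
    (a i).coeff α * (b j).coeff β = u * f (∑ l, (V i l).coeff α * (Ψ l j).coeff β) := by
  set VF := V.map (MvPolynomial.map f)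
  set ΨF := Ψ.map (MvPolynomial.map f)
  have h1' : VF * ΨF = e.map (MvPolynomial.map f) := by rw [← Matrix.map_mul, h1]
  have h2' : ΨF * VF = 1 := by
    rw [← Matrix.map_mul, h2, Matrix.map_one _ (map_zero _) (map_one _)]
  set μ := ΨF *ᵥ a
  set ν := b ᵥ* VF
  have hμν : vecMulVec μ ν = (C u : MvPolynomial σ F) • (1 : Matrix (Fin r) (Fin r) _) := by
    rw [← mul_vecMulVec, ← vecMulVec_mul, hab, ← h1', Matrix.smul_mul, Matrix.mul_smul,
      Matrix.mul_assoc, h2', Matrix.mul_one, h2']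
  have hμ : VF *ᵥ μ = a := by rw [mulVec_mulVec, h1', ha]
  have hν : ν ᵥ* ΨF = b := by rw [vecMul_vecMul, h1', hb]
  have hlm : ∀ l m, μ l * ν m = if l = m then C u else 0 := by
    intro l m
    have := congrFun (congrFun hμν l) m
    rw [vecMulVec_apply, Matrix.smul_apply, one_apply, smul_eq_mul] at this
    rw [this]
    split_ifs <;> simp
  have hunit : ∀ l, IsUnit (μ l * ν l) := by
    intro l
    rw [hlm, if_pos rfl]
    exact (IsUnit.mk0 u hu).map C
  have hc : ∀ l, ∃ c, μ l = C c := fun l => by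
    obtain ⟨c, _, hc⟩ := isUnit_iff_eq_C_of_isReduced.mp (isUnit_of_mul_isUnit_left (hunit l))
    exact ⟨c, hc⟩
  have hd : ∀ l, ∃ c, ν l = C c := fun l => by
    obtain ⟨c, _, hc⟩ := isUnit_iff_eq_C_of_isReduced.mp (isUnit_of_mul_isUnit_right (hunit l))
    exact ⟨c, hc⟩
  choose c hc using hc
  choose d hd using hd
  have hcd : ∀ l m, c l * d m = if l = m then u else 0 := by
    intro l m
    apply C_injective σ F
    rw [map_mul, ← hc, ← hd, hlm]
    split_ifs <;> simp
  have h3 : (a i).coeff α = ∑ l, f ((V i l).coeff α) * c l := by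
    rw [← congrFun hμ i]
    simp only [mulVec, dotProduct, coeff_sum, hc]
    refine Finset.sum_congr rfl fun l _ => ?_
    rw [mul_comm, coeff_C_mul, show coeff α (VF i l) = f _ from coeff_map _ _ _, mul_comm]
  have h4 : (b j).coeff β = ∑ l, d l * f ((Ψ l j).coeff β) := by
    rw [← congrFun hν j]
    simp only [vecMul, dotProduct, coeff_sum, hd]
    refine Finset.sum_congr rfl fun l _ => ?_
    rw [coeff_C_mul, show coeff β (ΨF l j) = f _ from coeff_map _ _ _]
  rw [h3, h4, Finset.sum_mul_sum, map_sum, Finset.mul_sum]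
  refine Finset.sum_congr rfl fun l _ => ?_
  rw [Finset.sum_eq_single l]
  · have := hcd l l
    rw [if_pos rfl] at this
    rw [map_mul, ← this]
    ring
  · intro m _ hm
    have := hcd l m
    rw [if_neg hm.symm] at this
    rw [mul_assoc, ← mul_assoc (c l), this]
    simp
  · simp

end Residue

section RankOne

open MvPolynomial

variable {ι σ : Type} [Fintype ι] [DecidableEq ι] [Finite σ]
variable {O K : Type} [CommRing O] [CommRing K] [Algebra O K]

lemma mem_nonZeroDivisors_of_minimalPrimes [IsReduced O] {s : O}
    (hs : ∀ 𝔭 ∈ minimalPrimes O, s ∉ 𝔭) : s ∈ nonZeroDivisors O := by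
  rw [mem_nonZeroDivisors_iff_right]
  intro x hx
  have : x ∈ sInf (minimalPrimes O) := by
    rw [Submodule.mem_sInf]
    intro (𝔭 : Ideal O) h𝔭
    have := h𝔭.1.1
    exact (this.mem_or_mem (hx ▸ 𝔭.zero_mem : x * s ∈ 𝔭)).resolve_right (hs 𝔭 h𝔭)
  rw [minimalPrimes, Ideal.sInf_minimalPrimes, ← Ideal.zero_eq_bot] at this
  exact (mem_nilradical.mp this).eq_zero

/-- A rank one projective module over a polynomial ring over a reduced Noetherian ring becomes
free over the total ring of fractions. -/
lemma exists_rank_one_split [IsNoetherianRing O] [IsReduced O] [IsFractionRing O K]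
    {e : Matrix ι ι (MvPolynomial σ O)} (he : e * e = e) (h1 : RkGE e 1) (h2 : RkLE e 1) :
    ∃ a b : ι → MvPolynomial σ K, vecMulVec a b = e.map (MvPolynomial.map (algebraMap O K)) ∧
      b ⬝ᵥ a = 1 := by
  obtain ⟨s, p, φ, hs, hp, hφ, hφp⟩ := exists_generic_coordinates he h1
  have hφp0 : φ 0 ⬝ᵥ p 0 = C s := by
    have := (hφp 0 0).eq_zero
    rwa [if_pos rfl, sub_eq_zero] at this
  have hsu : IsUnit (algebraMap O K s) :=
    IsLocalization.map_units K (⟨s, mem_nonZeroDivisors_of_minimalPrimes hs⟩ : nonZeroDivisors O)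
  obtain ⟨t, ht⟩ := hsu.exists_right_inv
  set g := MvPolynomial.map (σ := σ) (algebraMap O K)
  set a := g ∘ p 0
  set b := (C t : MvPolynomial σ K) • (g ∘ φ 0)
  have hba : b ⬝ᵥ a = 1 := by
    rw [smul_dotProduct, comp_dotProduct, hφp0, map_C, smul_eq_mul, ← C_mul, mul_comm t, ht, C_1]
  have ha : e.map g *ᵥ a = a := by rw [map_mulVec_comp, hp]
  have hb : b ᵥ* e.map g = b := by rw [smul_vecMul, map_vecMul_comp, hφ]
  refine ⟨a, b, ?_, hba⟩
  have h0 := eq_zero_of_rkLE (sub1_mul_self (map_mul_self he g) ha hb hba)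
    ((h2.map g).sub1 ha hb hba)
  rw [sub1, sub_eq_zero] at h0
  exact h0.symm

/-- The products of the coefficients of the two factors of a split rank one idempotent. -/
def prodCoeffs (a b : ι → MvPolynomial σ K) : Set K :=
  Set.range fun x : (ι × ι) × (σ →₀ ℕ) × (σ →₀ ℕ) => (a x.1.1).coeff x.2.1 * (b x.1.2).coeff x.2.2

lemma prodCoeffs_finite (a b : ι → MvPolynomial σ K) : (prodCoeffs a b).Finite := by
  have h1 : (⋃ i, Set.range (fun α => (a i).coeff α)).Finite :=
    Set.finite_iUnion fun i => Finsupp.finite_range _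
  have h2 : (⋃ i, Set.range (fun α => (b i).coeff α)).Finite :=
    Set.finite_iUnion fun i => Finsupp.finite_range _
  refine (h1.image2 (fun x y => x * y) h2).subset ?_
  rintro _ ⟨⟨⟨i, j⟩, α, β⟩, rfl⟩
  exact ⟨_, Set.mem_iUnion.mpr ⟨i, α, rfl⟩, _, Set.mem_iUnion.mpr ⟨j, β, rfl⟩, rfl⟩

lemma prodCoeffs_isIntegral {e : Matrix ι ι (MvPolynomial σ O)} {a b : ι → MvPolynomial σ K}
    (hab : vecMulVec a b = e.map (MvPolynomial.map (algebraMap O K))) :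
    ∀ x ∈ prodCoeffs a b, IsIntegral O x := by
  rintro _ ⟨⟨⟨i, j⟩, α, β⟩, rfl⟩
  refine mvKronecker (fun d => ?_) α β
  have := congrFun (congrFun hab i) j
  rw [vecMulVec_apply] at this
  rw [this, Matrix.map_apply, coeff_map]
  exact isIntegral_algebraMap

lemma exists_map_subtype_eq (T : Subalgebra O K) (p : MvPolynomial σ K)
    (h : ∀ α, p.coeff α ∈ T) : ∃ q : MvPolynomial σ T, MvPolynomial.map T.val.toRingHom q = p := by
  have : p ∈ Set.range (MvPolynomial.map (σ := σ) T.val.toRingHom) := by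
    rw [mem_range_map_iff_coeffs_subset]
    rintro c hc
    obtain ⟨d, _, rfl⟩ := mem_coeffs_iff.mp hc
    exact ⟨⟨_, h d⟩, rfl⟩
  exact this

lemma exists_residue {e : Matrix ι ι (MvPolynomial σ O)} (he : e * e = e)
    {a b : ι → MvPolynomial σ K}
    (hab : vecMulVec a b = e.map (MvPolynomial.map (algebraMap O K))) (hba : b ⬝ᵥ a = 1)
    (T : Subalgebra O K) (hT : prodCoeffs a b ⊆ T) (𝔪 : Ideal O) [h𝔪 : 𝔪.IsMaximal] (x : T)
    (hx : (x : K) ∈ prodCoeffs a b) :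
    ∃ c : O, ∀ M : Ideal T, M.IsMaximal → M.comap (algebraMap O T) = 𝔪 →
      x - algebraMap O T c ∈ M := by
  obtain ⟨⟨⟨i, j⟩, α, β⟩, hx⟩ := hx
  letI := Ideal.Quotient.field 𝔪
  obtain ⟨r, V, Ψ, h1, h2⟩ := quillen_suslin
    (map_mul_self he (MvPolynomial.map (Ideal.Quotient.mk 𝔪)))
  obtain ⟨c, hc⟩ := Ideal.Quotient.mk_surjective (∑ l, (V i l).coeff α * (Ψ l j).coeff β)
  refine ⟨c, fun M hM hM𝔪 => ?_⟩
  letI := Ideal.Quotient.field M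
  have hmem : ∀ i j α β, (a i).coeff α * (b j).coeff β ∈ T := fun i j α β =>
    hT ⟨⟨⟨i, j⟩, α, β⟩, rfl⟩
  set f : O ⧸ 𝔪 →+* T ⧸ M := Ideal.quotientMap M (algebraMap O T) hM𝔪.ge
  -- a unit product of constant coefficients
  obtain ⟨l, hl⟩ : ∃ l, (⟨_, hmem l l 0 0⟩ : T) ∉ M := by
    by_contra! hcon
    refine hM.ne_top ((Ideal.eq_top_iff_one _).mpr ?_)
    have : (1 : T) = ∑ l, ⟨_, hmem l l 0 0⟩ := by
      apply Subtype.ext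
      rw [AddSubmonoidClass.coe_finsetSum, OneMemClass.coe_one]
      have := congrArg constantCoeff hba
      rw [dotProduct, map_sum, map_one] at this
      rw [← this]
      refine Finset.sum_congr rfl fun l _ => ?_
      rw [map_mul, mul_comm]
      rfl
    rw [this]
    exact Ideal.sum_mem _ fun l _ => hcon l
  set u : T := ⟨_, hmem l l 0 0⟩ with hu
  choose a' ha' using fun i => exists_map_subtype_eq T (C ((b l).coeff 0) * a i) (fun α => by
    rw [coeff_C_mul, mul_comm]; exact hmem _ _ _ _)
  choose b' hb' using fun i => exists_map_subtype_eq T (C ((a l).coeff 0) * b i) (fun α => by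
    rw [coeff_C_mul]; exact hmem _ _ _ _)
  set γ := MvPolynomial.map (σ := σ) T.val.toRingHom
  have hγ : Function.Injective γ := MvPolynomial.map_injective _ Subtype.val_injective
  have hγa : γ ∘ a' = (C ((b l).coeff 0) : MvPolynomial σ K) • a := funext ha'
  have hγb : γ ∘ b' = (C ((a l).coeff 0) : MvPolynomial σ K) • b := funext hb'
  set eT := e.map (MvPolynomial.map (algebraMap O T))
  have heT : eT.map γ = e.map (MvPolynomial.map (algebraMap O K)) := by
    ext1 i j
    simp only [eT, γ, Matrix.map_apply, MvPolynomial.map_map]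
    rfl
  have hea : eT.map γ *ᵥ a = a := by
    rw [heT, ← hab, vecMulVec_mulVec, hba]
    simp
  have heb : b ᵥ* eT.map γ = b := by
    rw [heT, ← hab, vecMul_vecMulVec, hba, one_smul]
  have hea' : eT *ᵥ a' = a' := by
    apply hγ.comp_left
    change γ ∘ (eT *ᵥ a') = γ ∘ a'
    rw [← map_mulVec_comp, hγa, mulVec_smul, hea]
  have heb' : b' ᵥ* eT = b' := by
    apply hγ.comp_left
    change γ ∘ (b' ᵥ* eT) = γ ∘ b'
    rw [← map_vecMul_comp, hγb, smul_vecMul, heb]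
  have hab' : vecMulVec a' b' = (C u : MvPolynomial σ T) • eT := by
    ext1 i j
    apply hγ
    rw [vecMulVec_apply, map_mul, ha', hb', Matrix.smul_apply, smul_eq_mul, map_mul]
    have := congrFun (congrFun (heT.trans hab.symm) i) j
    rw [Matrix.map_apply, vecMulVec_apply] at this
    rw [this, map_C]
    change _ = C (coeff 0 (a l) * coeff 0 (b l)) * _
    rw [C_mul]
    ring
  set q := MvPolynomial.map (σ := σ) (Ideal.Quotient.mk M)
  have heq : eT.map q = (e.map (MvPolynomial.map (Ideal.Quotient.mk 𝔪))).map
      (MvPolynomial.map f) := by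
    ext1 i j
    simp only [eT, q, Matrix.map_apply, MvPolynomial.map_map]
    rfl
  have key := coeff_mul_coeff_of_split f h1 h2 (a := q ∘ a') (b := q ∘ b')
    (u := Ideal.Quotient.mk M u) (fun h => hl (Ideal.Quotient.eq_zero_iff_mem.mp h))
    (by rw [← heq, map_mulVec_comp, hea']) (by rw [← heq, map_vecMul_comp, heb'])
    (by
      rw [← heq]
      ext1 i j
      have := congrArg q (congrFun (congrFun hab' i) j)
      rw [vecMulVec_apply, map_mul, Matrix.smul_apply, smul_eq_mul, map_mul, map_C] at this
      exact this) i j α β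
  rw [← hc] at key
  have hux : (a' i).coeff α * (b' j).coeff β = u * x := by
    apply Subtype.ext
    have e1 := congrArg (coeff α) (ha' i)
    have e2 := congrArg (coeff β) (hb' j)
    rw [coeff_map, coeff_C_mul] at e1 e2
    change ((T.val.toRingHom (coeff α (a' i))) * (T.val.toRingHom (coeff β (b' j)))) =
      coeff 0 (a l) * coeff 0 (b l) * x
    rw [e1, e2, ← hx]
    ring
  have h5 : Ideal.Quotient.mk M (u * x) = Ideal.Quotient.mk M (u * algebraMap O T c) := by
    rw [← hux, map_mul, map_mul]
    simp only [Function.comp, q, coeff_map] at key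
    rw [key]
    rfl
  rw [Ideal.Quotient.eq, ← mul_sub] at h5
  exact (hM.isPrime.mem_or_mem h5).resolve_left hl

end RankOne

section Extension

open MvPolynomial

variable {ι σ : Type} [Fintype ι] [DecidableEq ι] [Finite σ]
variable {O K : Type} [CommRing O] [CommRing K] [Algebra O K]

/-- The idempotent `e` splits over `K` with factors whose products are defined over `T`. -/
def SplitOver (T : Subalgebra O K) (e : Matrix ι ι (MvPolynomial σ O)) : Prop :=
  ∃ (r : ℕ) (V : Matrix ι (Fin r) (MvPolynomial σ K)) (Ψ : Matrix (Fin r) ι (MvPolynomial σ K)),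
    V * Ψ = e.map (MvPolynomial.map (algebraMap O K)) ∧ Ψ * V = 1 ∧
    ∀ i j α β, ∑ l, (V i l).coeff α * (Ψ l j).coeff β ∈ T

lemma SplitOver.of_sub1 {T : Subalgebra O K} {e : Matrix ι ι (MvPolynomial σ O)}
    {q ψ : ι → MvPolynomial σ O} (hq : e *ᵥ q = q) (hψ : ψ ᵥ* e = ψ) (h : ψ ⬝ᵥ q = 1)
    (hs : SplitOver T (sub1 e q ψ)) : SplitOver T e := by
  obtain ⟨r, V, Ψ, h1, h2, h3⟩ := hs
  set g := MvPolynomial.map (σ := σ) (algebraMap O K)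
  have hq' : e.map g *ᵥ (g ∘ q) = g ∘ q := by rw [map_mulVec_comp, hq]
  have hψ' : (g ∘ ψ) ᵥ* e.map g = g ∘ ψ := by rw [map_vecMul_comp, hψ]
  have h' : (g ∘ ψ) ⬝ᵥ (g ∘ q) = 1 := by rw [comp_dotProduct, h, map_one]
  have h1' : V * Ψ = sub1 (e.map g) (g ∘ q) (g ∘ ψ) := by rw [h1, sub1_map]
  have h4 : Ψ *ᵥ (g ∘ q) = 0 := by
    have := sub1_mulVec_self hq' h'
    rw [← h1', ← mulVec_mulVec] at this
    have h5 := congrArg (Ψ *ᵥ ·) this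
    simpa [mulVec_mulVec, h2, ← Matrix.mul_assoc] using h5
  have h5 : (g ∘ ψ) ᵥ* V = 0 := by
    have := vecMul_sub1_self hψ' h'
    rw [← h1', ← vecMul_vecMul] at this
    have h5 := congrArg (· ᵥ* V) this
    simpa [vecMul_vecMul, h2, Matrix.mul_assoc] using h5
  refine ⟨r + 1, Matrix.of fun i => Fin.cons (α := fun _ => MvPolynomial σ K) (g (q i)) (V i),
    Matrix.of fun k j => Fin.cons (α := fun _ => MvPolynomial σ K) (g (ψ j)) (fun l => Ψ l j) k,
        ?_, ?_, ?_⟩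
  · ext1 i j
    have := congrFun (congrFun h1' i) j
    rw [mul_apply] at this
    rw [mul_apply, Fin.sum_univ_succ]
    simp only [of_apply, Fin.cons_zero, Fin.cons_succ]
    rw [this, sub1, Matrix.sub_apply, vecMulVec_apply]
    exact add_sub_cancel _ _
  · ext1 k l
    rw [mul_apply]
    refine Fin.cases ?_ (fun k => ?_) k <;> refine Fin.cases ?_ (fun l => ?_) l <;>
      simp only [of_apply, Fin.cons_zero, Fin.cons_succ]
    · rw [one_apply_eq]; exact h'
    · rw [one_apply_ne (Fin.succ_ne_zero l).symm]; exact congrFun h5 l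
    · rw [one_apply_ne (Fin.succ_ne_zero k)]; exact congrFun h4 k
    · have := congrFun (congrFun h2 k) l
      rw [mul_apply] at this
      rw [this, one_apply, one_apply]
      simp
  · intro i j α β
    rw [Fin.sum_univ_succ]
    simp only [of_apply, Fin.cons_zero, Fin.cons_succ]
    refine add_mem (mul_mem ?_ ?_) (h3 i j α β)
    · rw [show (g (q i)).coeff α = algebraMap O K _ from coeff_map _ _ _]
      exact T.algebraMap_mem _
    · rw [show (g (ψ j)).coeff β = algebraMap O K _ from coeff_map _ _ _]
      exact T.algebraMap_mem _

lemma isMaximal_of_mem_nonZeroDivisors (hdim : DimLT O 2) {𝔭 : Ideal O} [h𝔭 : 𝔭.IsPrime] {s : O}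
    (hs : s ∈ nonZeroDivisors O) (hsp : s ∈ 𝔭) : 𝔭.IsMaximal := by
  obtain ⟨𝔪, h𝔪, hle⟩ := Ideal.exists_le_maximal 𝔭 h𝔭.ne_top
  rcases hle.eq_or_lt with h | h
  · exact h ▸ h𝔪
  exfalso
  have := h𝔪.isPrime
  have h1 : 1 ≤ 𝔭.height := by
    rw [Order.one_le_iff_ne_zero]
    intro h0
    exact notMem_nonZeroDivisors_of_mem_mem_minimalPrimes hsp (Ideal.height_eq_zero_iff.mp h0) hs
  have h2 := Ideal.height_add_one_le_of_lt_of_isPrime h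
  have h3 := hdim 𝔪 this
  have h4 : (2 : ℕ∞) ≤ 𝔪.height := by
    calc (2 : ℕ∞) = 1 + 1 := by norm_num
      _ ≤ 𝔭.height + 1 := by gcongr
      _ ≤ _ := h2
  exact absurd h3 (not_lt.mpr h4)

/-- `T` is a finite extension of `O` which is a nilpotent thickening up to an ideal with a power
inside `O`. -/
def NilExt (O T : Type) [CommRing O] [CommRing T] [Algebra O T] : Prop :=
  ∃ (𝔧 : Ideal T) (k : ℕ), (∀ x, ∃ c, x - algebraMap O T c ∈ 𝔧) ∧
    ∀ x ∈ 𝔧 ^ k, ∃ c, algebraMap O T c = x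

lemma exists_conductor [IsFractionRing O K] (T : Subalgebra O K) (hT : T.toSubmodule.FG) :
    ∃ s ∈ nonZeroDivisors O, ∀ x ∈ T, ∃ c, algebraMap O K c = algebraMap O K s * x := by
  obtain ⟨S, hS⟩ := hT
  obtain ⟨b, hb⟩ := IsLocalization.exist_integer_multiples_of_finset (nonZeroDivisors O) S
  refine ⟨b, b.2, fun x hx => ?_⟩
  have hle : T.toSubmodule ≤
      (1 : Submodule O K).comap (LinearMap.mulLeft O (algebraMap O K b)) := by
    rw [← hS, Submodule.span_le]
    intro y hy
    obtain ⟨c, hc⟩ := hb y hy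
    refine Submodule.mem_one.mpr ⟨c, ?_⟩
    rw [hc, Algebra.smul_def]
    rfl
  exact Submodule.mem_one.mp (hle hx)

lemma nilExt_of_residue [IsNoetherianRing O] [IsFractionRing O K] (hdim : DimLT O 2) (C : Set K)
    (hC : (Algebra.adjoin O C).toSubmodule.FG)
    (hres : ∀ (𝔪 : Ideal O), 𝔪.IsMaximal → ∀ x : Algebra.adjoin O C, (x : K) ∈ C →
      ∃ c : O, ∀ M : Ideal (Algebra.adjoin O C), M.IsMaximal →
        M.comap (algebraMap O (Algebra.adjoin O C)) = 𝔪 → x - algebraMap O _ c ∈ M) :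
    NilExt O (Algebra.adjoin O C) := by
  set T := Algebra.adjoin O C with hTdef
  obtain ⟨s, hs, hsT⟩ := exists_conductor T hC
  haveI : Module.Finite O T := Module.Finite.iff_fg.mpr hC
  haveI : IsNoetherianRing T := IsNoetherianRing.of_finite O T
  set I : Ideal T := Ideal.span {algebraMap O T s} with hI
  have hmax : ∀ Q ∈ I.minimalPrimes, Q.IsMaximal ∧ (Q.comap (algebraMap O T)).IsMaximal := by
    intro Q hQ
    have hQp : Q.IsPrime := hQ.1.1
    have hQp' : (Q.comap (algebraMap O T)).IsPrime := Ideal.comap_isPrime _ _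
    have h1 : (Q.comap (algebraMap O T)).IsMaximal := isMaximal_of_mem_nonZeroDivisors hdim hs
      (hQ.1.2 (Ideal.mem_span_singleton_self _))
    exact ⟨Ideal.isMaximal_of_isIntegral_of_isMaximal_comap Q h1, h1⟩
  have hfin : I.minimalPrimes.Finite := Ideal.finite_minimalPrimes_of_isNoetherianRing T I
  obtain ⟨k, hk⟩ := Ideal.exists_pow_le_of_le_radical_of_fg (I := I.radical) (J := I) le_rfl
    (IsNoetherian.noetherian _)
  refine ⟨I.radical, k, ?_, ?_⟩
  · have hgen : ∀ x : T, (x : K) ∈ C → ∃ c, x - algebraMap O T c ∈ I.radical := by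
      intro x hx
      set A : Set (Ideal O) := (fun Q : Ideal T => Q.comap (algebraMap O T)) '' I.minimalPrimes
      haveI : Finite A := (hfin.image _).to_subtype
      have hA : ∀ 𝔪 : A, 𝔪.1.IsMaximal := by
        rintro ⟨_, Q, hQ, rfl⟩
        exact (hmax Q hQ).2
      choose c hc using fun 𝔪 : A => hres 𝔪.1 (hA 𝔪) x hx
      obtain ⟨r, hr⟩ := Ideal.exists_forall_sub_mem_ideal (I := fun 𝔪 : A => 𝔪.1)
        (fun 𝔪 𝔪' hne => by
          have := hA 𝔪
          have := hA 𝔪'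
          exact Ideal.isCoprime_of_isMaximal (fun h => hne (Subtype.ext h))) c
      refine ⟨r, ?_⟩
      rw [← Ideal.sInf_minimalPrimes, Submodule.mem_sInf]
      intro (Q : Ideal T) hQ
      have h1 := hc ⟨_, Q, hQ, rfl⟩ Q (hmax Q hQ).1 rfl
      have h2 : algebraMap O T (r - c ⟨_, Q, hQ, rfl⟩) ∈ Q := hr ⟨_, Q, hQ, rfl⟩
      have : x - algebraMap O T r = (x - algebraMap O T (c ⟨_, Q, hQ, rfl⟩)) -
          algebraMap O T (r - c ⟨_, Q, hQ, rfl⟩) := by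
        rw [map_sub]; ring
      rw [this]
      exact Q.sub_mem h1 h2
    rintro ⟨x, hx⟩
    induction hx using Algebra.adjoin_induction with
    | mem x hx => exact hgen ⟨x, _⟩ hx
    | algebraMap r => exact ⟨r, by
        rw [show (⟨algebraMap O K r, _⟩ : T) = algebraMap O T r from rfl, sub_self]
        exact zero_mem _⟩
    | add x y hx hy h1 h2 =>
      obtain ⟨c, hc⟩ := h1
      obtain ⟨d, hd⟩ := h2
      refine ⟨c + d, ?_⟩
      convert Ideal.add_mem _ hc hd using 1
      rw [map_add]
      apply Subtype.ext
      push_cast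
      ring
    | mul x y hx hy h1 h2 =>
      obtain ⟨c, hc⟩ := h1
      obtain ⟨d, hd⟩ := h2
      refine ⟨c * d, ?_⟩
      convert Ideal.add_mem _ (Ideal.mul_mem_right ⟨y, hy⟩ _ hc)
        (Ideal.mul_mem_left _ (algebraMap O T c) hd) using 1
      rw [map_mul]
      apply Subtype.ext
      push_cast
      ring
  · intro x hx
    obtain ⟨y, hy⟩ := Ideal.mem_span_singleton'.mp (hk hx)
    obtain ⟨c, hc⟩ := hsT y y.2
    refine ⟨c, Subtype.ext ?_⟩
    rw [← hy, mul_comm]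
    exact hc

/-- Over a reduced Noetherian ring of dimension at most one, every projective module of constant
rank over a polynomial ring splits over the total ring of fractions, compatibly with a finite
extension having trivial residue extensions. -/
lemma exists_splitOver [IsNoetherianRing O] [IsReduced O] [IsFractionRing O K] (hdim : DimLT O 2)
    (n : ℕ) : ∀ {e : Matrix ι ι (MvPolynomial σ O)} (_ : e * e = e) (_ : RkGE e (n + 1))
    (_ : RkLE e (n + 1)),
    ∃ T : Subalgebra O K, T.toSubmodule.FG ∧ NilExt O T ∧ SplitOver T e := by
  induction n with
  | zero =>
    intro e he h1 h2
    obtain ⟨a, b, hab, hba⟩ := exists_rank_one_split (K := K) he h1 h2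
    have hfg : (Algebra.adjoin O (prodCoeffs a b)).toSubmodule.FG :=
      fg_adjoin_of_finite (prodCoeffs_finite a b) (prodCoeffs_isIntegral hab)
    refine ⟨Algebra.adjoin O (prodCoeffs a b), hfg, nilExt_of_residue hdim _ hfg
      fun 𝔪 h𝔪 x hx => exists_residue he hab hba _ Algebra.subset_adjoin 𝔪 x hx, 1,
      Matrix.of fun i _ => a i, Matrix.of fun _ j => b j, ?_, ?_, ?_⟩
    · rw [← hab]
      ext1 i j
      simp [mul_apply, vecMulVec_apply]
    · ext1 k l
      rw [Subsingleton.elim k l, mul_apply, one_apply_eq]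
      exact hba
    · intro i j α β
      rw [Fin.sum_univ_one]
      exact Algebra.subset_adjoin ⟨⟨⟨i, j⟩, α, β⟩, rfl⟩
  | succ n IH =>
    intro e he h1 h2
    obtain ⟨k, ⟨ε⟩⟩ := Finite.exists_equiv_fin σ
    obtain ⟨v, hv, hu⟩ : ∃ v, e *ᵥ v = v ∧ Um v := by
      refine exists_um_of_bijective (renameEquiv O ε).toRingEquiv.toRingHom
        (renameEquiv O ε).bijective ?_
      exact exists_um_mvPolynomial k O (map_mul_self he _) hdim ((h1.mono (by omega)).map _)
    obtain ⟨ψ, hψ, hψv⟩ := exists_dual hv hu he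
    obtain ⟨T, hT, hnil, hsp⟩ := IH (sub1_mul_self he hv hψ hψv) (h1.sub1 v ψ)
      (h2.sub1 hv hψ hψv)
    exact ⟨T, hT, hnil, hsp.of_sub1 hv hψ hψv⟩

end Extension

section Descent

variable {R T : Type} [CommRing R] [CommRing T] [Algebra R T]

/-- The subalgebra `R + E`, for a submodule `E` closed under multiplication. -/
def adjoinSubmodule (E : Submodule R T) (hE : E * E ≤ E) : Subalgebra R T where
  carrier := {x | ∃ r, x - algebraMap R T r ∈ E}
  mul_mem' := by
    rintro x y ⟨r, hr⟩ ⟨s, hs⟩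
    refine ⟨r * s, ?_⟩
    have : x * y - algebraMap R T (r * s) = (x - algebraMap R T r) * (y - algebraMap R T s) +
        (r • (y - algebraMap R T s) + s • (x - algebraMap R T r)) := by
      rw [map_mul, Algebra.smul_def, Algebra.smul_def]; ring
    rw [this]
    exact E.add_mem (hE (Submodule.mul_mem_mul hr hs))
      (E.add_mem (E.smul_mem _ hs) (E.smul_mem _ hr))
  add_mem' := by
    rintro x y ⟨r, hr⟩ ⟨s, hs⟩
    refine ⟨r + s, ?_⟩
    rw [map_add, add_sub_add_comm]
    exact E.add_mem hr hs
  algebraMap_mem' r := ⟨r, by rw [sub_self]; exact E.zero_mem⟩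

lemma adjoinSubmodule_fg {E : Submodule R T} (hE : E * E ≤ E) (h : E.FG) :
    (adjoinSubmodule E hE).toSubmodule.FG := by
  have : (adjoinSubmodule E hE).toSubmodule = 1 ⊔ E := by
    apply le_antisymm
    · rintro x ⟨r, hr⟩
      rw [← add_sub_cancel (algebraMap R T r) x]
      exact Submodule.add_mem_sup (Submodule.mem_one.mpr ⟨r, rfl⟩) hr
    · refine sup_le ?_ fun x hx => ⟨0, by rwa [map_zero, sub_zero]⟩
      intro x hx
      obtain ⟨r, rfl⟩ := Submodule.mem_one.mp hx
      exact (adjoinSubmodule E hE).algebraMap_mem r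
  rw [this]
  refine Submodule.FG.sup ⟨{1}, ?_⟩ h
  rw [Finset.coe_singleton, Submodule.one_eq_span]

lemma adjoinSubmodule_nilExt {E : Submodule R T} (hE : E * E ≤ E) {k : ℕ} (hk : E ^ (k + 1) ≤ 1) :
    NilExt R (adjoinSubmodule E hE) := by
  let N : Ideal (adjoinSubmodule E hE) :=
    { carrier := {x | (x : T) ∈ E}
      add_mem' := fun {x y} hx hy => E.add_mem hx hy
      zero_mem' := E.zero_mem
      smul_mem' := by
        rintro ⟨s, r, hr⟩ x hx
        change s * (x : T) ∈ E
        have : s * (x : T) = (s - algebraMap R T r) * x + r • (x : T) := by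
          rw [Algebra.smul_def]; ring
        rw [this]
        exact E.add_mem (hE (Submodule.mul_mem_mul hr hx)) (E.smul_mem _ hx) }
  refine ⟨N, k + 1, ?_, ?_⟩
  · rintro ⟨x, r, hr⟩
    exact ⟨r, hr⟩
  · have key : ∀ j : ℕ, ∀ x ∈ N ^ (j + 1), (x : T) ∈ E ^ (j + 1) := by
      intro j
      induction j with
      | zero =>
        intro x hx
        rw [zero_add, pow_one] at hx ⊢
        exact hx
      | succ j IH =>
        intro x hx
        rw [pow_succ] at hx ⊢
        refine Submodule.mul_induction_on hx (fun a ha b hb => ?_) fun a b ha hb => ?_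
        · exact Submodule.mul_mem_mul (IH a ha) hb
        · exact Submodule.add_mem _ ha hb
    intro x hx
    obtain ⟨c, hc⟩ := Submodule.mem_one.mp (hk (key k x hx))
    exact ⟨c, Subtype.ext hc⟩

lemma exists_nilExt_subalgebra {O : Type} [CommRing O] [Algebra R O] [Algebra O T]
    [IsScalarTower R O T] [IsNoetherianRing O] [Module.Finite O T] (D : Submonoid R)
    [IsLocalization D O] (h : NilExt O T) :
    ∃ S : Subalgebra R T, S.toSubmodule.FG ∧ NilExt R S ∧ ∀ y : T, ∃ d ∈ D, d • y ∈ S := by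
  obtain ⟨𝔧, k, h1, h2⟩ := h
  obtain ⟨r, g, hg⟩ := Submodule.fg_iff_exists_fin_generating_family.mp
    (IsNoetherian.noetherian (𝔧.restrictScalars O))
  have hmem : ∀ x ∈ 𝔧, ∃ c : Fin r → O, ∑ l, c l • g l = x := by
    intro x hx
    have : x ∈ 𝔧.restrictScalars O := hx
    rw [← hg] at this
    exact Submodule.mem_span_range_iff_exists_fun O |>.mp this
  have hgm : ∀ i, g i ∈ 𝔧 := by
    intro i
    have : g i ∈ 𝔧.restrictScalars O := hg ▸ Submodule.subset_span ⟨i, rfl⟩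
    exact this
  choose c hc using fun i j => hmem (g i * g j) (𝔧.mul_mem_left _ (hgm j))
  have hprod : ∀ f : Fin (k + 1) → Fin r, ∃ q, algebraMap O T q = ∏ i, g (f i) := by
    intro f
    refine h2 _ ?_
    refine Ideal.pow_le_pow_right k.le_succ ?_
    have := Ideal.prod_mem_prod (s := Finset.univ) (I := fun _ : Fin (k + 1) => 𝔧)
      (x := fun i => g (f i)) fun i _ => hgm (f i)
    simpa using this
  choose q hq using hprod
  obtain ⟨τ, hτ⟩ := IsLocalization.exist_integer_multiples_of_finite D
    (Sum.elim (fun p : Fin r × Fin r × Fin r => c p.1 p.2.1 p.2.2) q)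
  choose bc hbc using fun i j l => hτ (Sum.inl (i, j, l))
  choose bq hbq using fun f => hτ (Sum.inr f)
  simp only [Sum.elim_inl, Sum.elim_inr] at hbc hbq
  set t : R := τ.1
  set E : Submodule R T := Submodule.span R (Set.range fun i => t • g i)
  have hE : E * E ≤ E := by
    rw [Submodule.span_mul_span, Submodule.span_le]
    rintro _ ⟨_, ⟨i, rfl⟩, _, ⟨j, rfl⟩, rfl⟩
    have : (t • g i) * (t • g j) = ∑ l, bc i j l • (t • g l) := by
      rw [smul_mul_smul_comm, ← hc, Finset.smul_sum]
      refine Finset.sum_congr rfl fun l _ => ?_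
      rw [← IsScalarTower.algebraMap_smul O (bc i j l), hbc, smul_assoc,
        smul_comm (c i j l) t, mul_smul]
    change (t • g i) * (t • g j) ∈ E
    rw [this]
    exact sum_mem fun l _ => E.smul_mem _ (Submodule.subset_span ⟨l, rfl⟩)
  have hk : E ^ (k + 1) ≤ 1 := by
    rw [Submodule.span_pow, Submodule.span_le]
    intro x hx
    obtain ⟨f, rfl⟩ := Set.mem_pow.mp hx
    choose f' hf' using fun i => (f i).2
    have : (List.ofFn fun i => (f i : T)).prod = algebraMap R T (t ^ k * bq f') := by
      rw [List.prod_ofFn]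
      simp_rw [← hf']
      rw [Finset.prod_smul, Finset.prod_const, Finset.card_univ, Fintype.card_fin, ← hq, pow_succ,
          mul_smul,
        map_mul, IsScalarTower.algebraMap_apply R O T (bq f'), hbq, Algebra.smul_def, map_pow,
        Algebra.smul_def, Algebra.smul_def, map_mul (algebraMap O T),
        ← IsScalarTower.algebraMap_apply R O T]
    rw [this]
    exact Submodule.mem_one.mpr ⟨_, rfl⟩
  refine ⟨adjoinSubmodule E hE, adjoinSubmodule_fg hE (Submodule.fg_span (Set.finite_range _)),
    adjoinSubmodule_nilExt hE hk, fun y => ?_⟩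
  obtain ⟨a, ha⟩ := h1 y
  obtain ⟨o, ho⟩ := hmem _ ha
  obtain ⟨d, hd⟩ := IsLocalization.exist_integer_multiples_of_finite D
    (fun i : Option (Fin r) => i.elim a o)
  obtain ⟨b, hb⟩ := hd none
  choose bo hbo using fun l => hd (some l)
  simp only [Option.elim_none, Option.elim_some] at hb hbo
  refine ⟨t * d, D.mul_mem τ.2 d.2, t * b, ?_⟩
  have : (t * (d : R)) • y - algebraMap R T (t * b) = ∑ l, bo l • (t • g l) := by
    rw [← sub_add_cancel y (algebraMap O T a), ← ho, smul_add, Finset.smul_sum, map_mul,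
      IsScalarTower.algebraMap_apply R O T b, hb]
    have h3 : ∀ l, (t * (d : R)) • o l • g l = bo l • (t • g l) := by
      intro l
      rw [← IsScalarTower.algebraMap_smul O (bo l), hbo, mul_smul, smul_assoc]
      rw [smul_comm t (d : R), smul_comm t (o l)]
    rw [Finset.sum_congr rfl fun l _ => h3 l]
    rw [Algebra.smul_def, Algebra.smul_def, map_mul (algebraMap O T), map_mul (algebraMap R T),
      ← IsScalarTower.algebraMap_apply R O T]
    ring
  rw [this]
  exact sum_mem fun l _ => E.smul_mem _ (Submodule.subset_span ⟨l, rfl⟩)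

end Descent

section SemiLocal

open MvPolynomial

variable {ι σ τ : Type} [Fintype ι] [DecidableEq ι]
variable {R O K : Type} [CommRing R] [CommRing O] [CommRing K]

lemma aeval_eq_sum_of_subset {B : Type} [CommRing B] [Algebra K B] (z : σ → B)
    {p : MvPolynomial σ K} {s : Finset (σ →₀ ℕ)} (hs : p.support ⊆ s) :
    aeval z p = ∑ α ∈ s, algebraMap K B (p.coeff α) * ∏ i ∈ α.support, z i ^ α i := by
  rw [aeval_def, eval₂_eq]
  refine Finset.sum_subset hs fun α _ hα => ?_
  rw [notMem_support_iff.mp hα, map_zero, zero_mul]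

lemma exists_map_eq_of_coeff_mem [Algebra O K] {T : Subalgebra O K} {r : ℕ}
    {V : Matrix ι (Fin r) (MvPolynomial σ K)} {Ψ : Matrix (Fin r) ι (MvPolynomial σ K)}
    (h : ∀ i j α β, ∑ l, (V i l).coeff α * (Ψ l j).coeff β ∈ T)
    {z w : σ → MvPolynomial τ K}
    (hz : ∀ i, z i ∈ (MvPolynomial.map (σ := τ) T.val.toRingHom).range)
    (hw : ∀ i, w i ∈ (MvPolynomial.map (σ := τ) T.val.toRingHom).range) :
    ∃ a : Matrix ι ι (MvPolynomial τ T), a.map (MvPolynomial.map T.val.toRingHom) =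
      V.map (aeval (R := K) z) * Ψ.map (aeval (R := K) w) := by
  have key : ∀ i j, (V.map (aeval (R := K) z) * Ψ.map (aeval (R := K) w)) i j ∈
      (MvPolynomial.map (σ := τ) T.val.toRingHom).range := by
    classical
    intro i j
    rw [mul_apply]
    set s := Finset.univ.biUnion fun l => (V i l).support
    set t := Finset.univ.biUnion fun l => (Ψ l j).support
    have hs : ∀ l, (V i l).support ⊆ s := fun l =>
      Finset.subset_biUnion_of_mem (fun l => (V i l).support) (Finset.mem_univ l)
    have ht : ∀ l, (Ψ l j).support ⊆ t := fun l =>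
      Finset.subset_biUnion_of_mem (fun l => (Ψ l j).support) (Finset.mem_univ l)
    have : ∑ l, (V.map (aeval (R := K) z)) i l * (Ψ.map (aeval (R := K) w)) l j =
        ∑ α ∈ s, ∑ β ∈ t, C (∑ l, (V i l).coeff α * (Ψ l j).coeff β) *
          ((∏ i ∈ α.support, z i ^ α i) * ∏ i ∈ β.support, w i ^ β i) := by
      simp_rw [map_sum, Finset.sum_mul]
      rw [Finset.sum_congr rfl fun α _ => Finset.sum_comm, Finset.sum_comm]
      refine Finset.sum_congr rfl fun l _ => ?_
      rw [map_apply, map_apply, aeval_eq_sum_of_subset z (hs l), aeval_eq_sum_of_subset w (ht l),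
        Finset.sum_mul_sum]
      refine Finset.sum_congr rfl fun α _ => Finset.sum_congr rfl fun β _ => ?_
      rw [algebraMap_eq, map_mul]
      ring
    rw [this]
    refine sum_mem fun α _ => sum_mem fun β _ => mul_mem ⟨C ⟨_, h i j α β⟩, map_C _ _⟩
      (mul_mem (prod_mem fun i _ => pow_mem (hz i) _) (prod_mem fun i _ => pow_mem (hw i) _))
  choose a ha using key
  exact ⟨Matrix.of a, by ext1 i j; exact ha i j⟩

lemma isLocalization_subalgebra {T : Type} [CommRing T] [Algebra R T] (D : Submonoid R)
    (hD : ∀ d ∈ D, IsUnit (algebraMap R T d)) (S : Subalgebra R T)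
    (hS : ∀ y : T, ∃ d ∈ D, d • y ∈ S) : IsLocalization (D.map (algebraMap R S)) T := by
  rw [isLocalization_iff]
  refine ⟨?_, ?_, ?_⟩
  · rintro ⟨_, d, hd, rfl⟩
    exact hD d hd
  · intro y
    obtain ⟨d, hd, hdS⟩ := hS y
    refine ⟨(⟨_, hdS⟩, ⟨_, d, hd, rfl⟩), ?_⟩
    change y * algebraMap R T d = d • y
    rw [Algebra.smul_def, mul_comm]
  · intro x y hxy
    exact ⟨1, by rw [Subtype.ext hxy]⟩

lemma exists_mem_J_of_splitOver [Algebra R O] [Algebra O K] [Algebra R K] [IsScalarTower R O K]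
    (D : Submonoid R) [IsLocalization D O] {e : Matrix ι ι (MvPolynomial σ R)} (he : e * e = e)
    {T : Subalgebra O K}
    (hT : SplitOver T (e.map (MvPolynomial.map (algebraMap R O)))) (S : Subalgebra R T)
    (hS : ∀ y : T, ∃ d ∈ D, d • y ∈ S) :
    ∃ t ∈ D, algebraMap R S t ∈ J (e.map (MvPolynomial.map (algebraMap R S)))
      (map_mul_self he _) := by
  obtain ⟨r, V, Ψ, h1, h2, h3⟩ := hT
  haveI := isLocalization_subalgebra D (fun d hd => by
    rw [IsScalarTower.algebraMap_apply R O T]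
    exact (IsLocalization.map_units O (⟨d, hd⟩ : D)).map _) S hS
  have hinl : ∀ i : σ, (X (Sum.inl i) : MvPolynomial (σ ⊕ σ) K) ∈
      (MvPolynomial.map (σ := σ ⊕ σ) T.val.toRingHom).range := fun i =>
    ⟨X (Sum.inl i), map_X _ _⟩
  have hinr : ∀ i : σ, (X (Sum.inl i) + X (Sum.inr i) : MvPolynomial (σ ⊕ σ) K) ∈
      (MvPolynomial.map (σ := σ ⊕ σ) T.val.toRingHom).range := fun i =>
    add_mem (hinl i) ⟨X (Sum.inr i), map_X _ _⟩
  obtain ⟨a, ha⟩ := exists_map_eq_of_coeff_mem h3 hinl hinr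
  obtain ⟨b, hb⟩ := exists_map_eq_of_coeff_mem h3 hinr hinl
  have h1' : V * Ψ = (e.map (MvPolynomial.map (algebraMap R S))).map
      (MvPolynomial.map ((T.val.toRingHom).comp (algebraMap S T))) := by
    rw [h1]
    ext1 i j
    simp only [map_apply, MvPolynomial.map_map]
    congr 2
    rw [← IsScalarTower.algebraMap_eq R O K]
    rfl
  obtain ⟨_, ⟨t, ht, rfl⟩, htJ⟩ := exists_mem_J_of_split_of_injective
    (he := map_mul_self he _) (D.map (algebraMap R S))
    T.val.toRingHom Subtype.val_injective h1' h2 a b ha hb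
  exact ⟨t, ht, htJ⟩

/-- The elements avoiding a set of prime ideals. -/
def avoiding (ℙ : Set (Ideal R)) (h : ∀ 𝔭 ∈ ℙ, 𝔭.IsPrime) : Submonoid R where
  carrier := {x | ∀ 𝔭 ∈ ℙ, x ∉ 𝔭}
  one_mem' 𝔭 h𝔭 h1 := (h 𝔭 h𝔭).ne_top ((Ideal.eq_top_iff_one _).mpr h1)
  mul_mem' hx hy 𝔭 h𝔭 hxy := ((h 𝔭 h𝔭).mem_or_mem hxy).elim (hx 𝔭 h𝔭) (hy 𝔭 h𝔭)

lemma dimLT_of_avoiding {ℙ : Set (Ideal R)} (hfin : ℙ.Finite) (h : ∀ 𝔭 ∈ ℙ, 𝔭.IsPrime)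
    (hht : ∀ 𝔭 ∈ ℙ, 𝔭.height ≤ 1) [Algebra R O] [IsLocalization (avoiding ℙ h) O] :
    DimLT O 2 := by
  intro q hq
  rw [← IsLocalization.height_under (avoiding ℙ h) q]
  have hsub : ((q.under R : Ideal R) : Set R) ⊆ ⋃ 𝔭 ∈ ℙ, ((id 𝔭 : Ideal R) : Set R) := by
    intro x hx
    by_contra hcon
    simp only [id, Set.mem_iUnion, not_exists] at hcon
    exact hq.ne_top (q.eq_top_of_isUnit_mem hx
      (IsLocalization.map_units O (⟨x, fun 𝔭 h𝔭 => hcon 𝔭 h𝔭⟩ : avoiding ℙ h)))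
  obtain ⟨𝔭, h𝔭, hle⟩ := (Ideal.subset_union_prime_finite hfin 0 0 fun i hi _ _ => h i hi).mp hsub
  exact ((Ideal.height_mono hle).trans (hht 𝔭 h𝔭)).trans_lt (by norm_num)

/-- Given finitely many primes of height at most one in a reduced Noetherian ring, there is a
finite extension, nilpotent up to conductor, over which the Quillen ideal avoids these primes. -/
lemma exists_extension [IsNoetherianRing R] [IsReduced R] [Finite σ] {ℙ : Set (Ideal R)}
    (hfin : ℙ.Finite) (hP : ∀ 𝔭 ∈ ℙ, 𝔭.IsPrime) (hht : ∀ 𝔭 ∈ ℙ, 𝔭.height ≤ 1)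
    (hmin : minimalPrimes R ⊆ ℙ) {n : ℕ} {e : Matrix ι ι (MvPolynomial σ R)} (he : e * e = e)
    (hge : RkGE e (n + 1)) (hle : RkLE e (n + 1)) :
    ∃ (S : Type) (_ : CommRing S) (_ : Algebra R S), Function.Injective (algebraMap R S) ∧
      Module.Finite R S ∧ NilExt R S ∧ ∃ t : R, (∀ 𝔭 ∈ ℙ, t ∉ 𝔭) ∧
      algebraMap R S t ∈ J (e.map (MvPolynomial.map (algebraMap R S))) (map_mul_self he _) := by
  set D := avoiding ℙ hP
  let O := Localization D
  have hD : D ≤ nonZeroDivisors R := fun x hx =>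
    mem_nonZeroDivisors_of_minimalPrimes fun 𝔭 h𝔭 => hx 𝔭 (hmin h𝔭)
  have hRO : Function.Injective (algebraMap R O) := IsLocalization.injective O hD
  haveI : IsNoetherianRing O := IsLocalization.isNoetherianRing D O inferInstance
  have hdim : DimLT O 2 := dimLT_of_avoiding hfin hP hht
  let K := FractionRing O
  obtain ⟨T, hT, hnil, hsp⟩ := exists_splitOver (K := K) hdim n
    (map_mul_self he (MvPolynomial.map (algebraMap R O))) (hge.map _) (hle.map _)
  haveI : Module.Finite O T := Module.Finite.iff_fg.mpr hT
  obtain ⟨S, hS, hnilS, hclear⟩ := exists_nilExt_subalgebra (R := R) D hnil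
  refine ⟨S, inferInstance, inferInstance, ?_, Module.Finite.iff_fg.mpr hS, hnilS, ?_⟩
  · have h1 : Function.Injective (algebraMap R K) := by
      rw [IsScalarTower.algebraMap_eq R O K]
      exact (IsFractionRing.injective O K).comp hRO
    intro x y hxy
    exact h1 (congrArg (fun z : S => ((z : T) : K)) hxy)
  · exact exists_mem_J_of_splitOver D he hsp S hclear

end SemiLocal

section CriticalRank

open Polynomial

variable {ι : Type} [Fintype ι] [DecidableEq ι]

lemma DimLT.quotient_of_two_le {R S : Type} [CommRing R] [CommRing S] [Algebra R S]
    [Algebra.IsIntegral R S] {D : ℕ} (h : DimLT R (D + 2)) {I : Ideal S}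
    (hI : ∀ Q : Ideal S, Q.IsPrime → I ≤ Q → 2 ≤ (Q.comap (algebraMap R S)).height) :
    DimLT (S ⧸ I) D := by
  set c : Ideal (S ⧸ I) → Ideal R := fun Q => (Q.comap (Ideal.Quotient.mk I)).comap (algebraMap R S)
  have hc : ∀ Q : Ideal (S ⧸ I), Q.IsPrime → (c Q).IsPrime := fun Q hQ =>
    have : (Q.comap (Ideal.Quotient.mk I)).IsPrime := Ideal.comap_isPrime _ _
    Ideal.comap_isPrime _ _
  have key : ∀ (n : ℕ) (Q : Ideal (S ⧸ I)) [Q.IsPrime],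
      (c Q).height ≤ n + 1 → Q.height < n := by
    intro n
    induction n with
    | zero =>
      intro Q _ hQ
      have hp : (Q.comap (Ideal.Quotient.mk I)).IsPrime := Ideal.comap_isPrime _ _
      have := hI _ hp fun x hx => by
        rw [Ideal.mem_comap, Ideal.Quotient.eq_zero_iff_mem.2 hx]
        exact Q.zero_mem
      exact absurd (this.trans hQ) (by norm_num)
    | succ n ih =>
      intro Q _ hQ
      have h1 : Q.height ≤ n := by
        rw [Ideal.height_le_iff]
        intro q hq hlt
        apply ih
        have hp : (Q.comap (Ideal.Quotient.mk I)).IsPrime := Ideal.comap_isPrime _ _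
        have hp' : (q.comap (Ideal.Quotient.mk I)).IsPrime := Ideal.comap_isPrime _ _
        have hlt' : q.comap (Ideal.Quotient.mk I) < Q.comap (Ideal.Quotient.mk I) :=
          (Ideal.comap_mono hlt.le).lt_of_not_ge fun hle => hlt.not_ge <|
            (Ideal.comap_le_comap_iff_of_surjective _ Ideal.Quotient.mk_surjective _ _).1 hle
        have hlt2 : c q < c Q := Ideal.IsIntegral.comap_lt_comap hlt'
        have := hc Q inferInstance
        have := (Ideal.height_le_iff.1 (show (c Q).height ≤ (n + 1 + 1 : ℕ) by exact_mod_cast hQ))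
          _ (hc q hq) hlt2
        refine Order.le_of_lt_add_one ?_
        exact_mod_cast this
      exact h1.trans_lt (by exact_mod_cast Nat.lt_succ_self n)
  intro Q hQ
  apply key
  have := h _ (hc Q hQ)
  refine Order.le_of_lt_add_one ?_
  exact_mod_cast this

lemma J_congr {σ R : Type} [CommRing R] {e e' : Matrix ι ι (MvPolynomial σ R)} (h : e = e')
    (he : e * e = e) (he' : e' * e' = e') : J e he = J e' he' := by
  subst h
  rfl

lemma optionEquivRight_symm_mapB {σ R S : Type} [CommRing R] [CommRing S] (g : R →+* S)
    (x : MvPolynomial σ R[X]) :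
    (MvPolynomial.optionEquivRight S σ).symm (mapB σ g x) =
      MvPolynomial.map g ((MvPolynomial.optionEquivRight R σ).symm x) := by
  rw [AlgEquiv.symm_apply_eq]
  obtain ⟨y, rfl⟩ := (MvPolynomial.optionEquivRight R σ).surjective x
  rw [AlgEquiv.symm_apply_apply]
  have : (mapB σ g).comp (MvPolynomial.optionEquivRight R σ).toRingEquiv.toRingHom =
      (MvPolynomial.optionEquivRight S σ).toRingEquiv.toRingHom.comp (MvPolynomial.map g) := by
    refine MvPolynomial.ringHom_ext (fun r => ?_) fun i => ?_
    · change mapB σ g (MvPolynomial.optionEquivRight R σ (MvPolynomial.C r)) =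
        MvPolynomial.optionEquivRight S σ (MvPolynomial.map g (MvPolynomial.C r))
      rw [MvPolynomial.map_C, MvPolynomial.optionEquivRight_C, MvPolynomial.optionEquivRight_C,
        mapB_C, Polynomial.map_C]
    · change mapB σ g (MvPolynomial.optionEquivRight R σ (MvPolynomial.X i)) =
        MvPolynomial.optionEquivRight S σ (MvPolynomial.map g (MvPolynomial.X i))
      rw [MvPolynomial.map_X]
      cases i with
      | none =>
        rw [MvPolynomial.optionEquivRight_X_none, MvPolynomial.optionEquivRight_X_none,
          mapB_C, Polynomial.map_X]
      | some i =>
        rw [MvPolynomial.optionEquivRight_X_some, MvPolynomial.optionEquivRight_X_some, mapB,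
          MvPolynomial.map_X]
  exact congrArg (fun f => f y) this

lemma JT_mapB {σ R S : Type} [CommRing R] [CommRing S] (g : R →+* S)
    {e : Matrix ι ι (MvPolynomial σ R[X])} (he : e * e = e) :
    JT (e.map (mapB σ g)) (map_mul_self he _) =
      J ((e.map (MvPolynomial.optionEquivRight R σ).symm.toRingEquiv.toRingHom).map
        (MvPolynomial.map g)) (map_mul_self (map_mul_self he _) _) := by
  refine J_congr ?_ _ _
  ext1 i j
  exact optionEquivRight_symm_mapB g (e i j)

lemma C_mem_span_map {σ R S : Type} [CommRing R] [CommRing S] (g : R →+* S)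
    {e : Matrix ι ι (MvPolynomial σ R[X])} {φ : ι → MvPolynomial σ R[X]} {f : R[X]}
    (h : MvPolynomial.C f ∈ Ideal.span (Set.range (φ ᵥ* e))) :
    MvPolynomial.C (f.map g) ∈
      Ideal.span (Set.range ((mapB σ g ∘ φ) ᵥ* e.map (mapB σ g))) := by
  obtain ⟨ψ, hψ⟩ := mem_span_range.mp h
  refine mem_span_range.mpr ⟨mapB σ g ∘ ψ, ?_⟩
  rw [map_vecMul_comp, comp_dotProduct, hψ, mapB_C]

lemma exists_sub_one_mem_map {σ R S : Type} [CommRing R] [CommRing S] (g : R →+* S)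
    {U : ι → MvPolynomial σ R[X]} (h : ∃ ρ, ρ ⬝ᵥ U - 1 ∈ Ideal.span {MvPolynomial.C X}) :
    ∃ ρ, ρ ⬝ᵥ (mapB σ g ∘ U) - 1 ∈ Ideal.span {(MvPolynomial.C X : MvPolynomial σ S[X])} := by
  obtain ⟨ρ, hρ⟩ := h
  obtain ⟨c, hc⟩ := Ideal.mem_span_singleton'.mp hρ
  refine ⟨mapB σ g ∘ ρ, Ideal.mem_span_singleton'.mpr ⟨mapB σ g c, ?_⟩⟩
  rw [comp_dotProduct, ← map_one (mapB σ g), ← map_sub, ← hc, map_mul, mapB_C, Polynomial.map_X]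

lemma two_le_height_of_le_comap {R : Type} [CommRing R] {I p : Ideal R} [hp : p.IsPrime] {t : R}
    (hI : ∀ 𝔭 ∈ minimalPrimes R, ¬ I ≤ 𝔭) (ht : ∀ 𝔭 ∈ I.minimalPrimes, 𝔭.height ≤ 1 → t ∉ 𝔭)
    (hIp : I ≤ p) (htp : t ∈ p) : 2 ≤ p.height := by
  obtain ⟨𝔭, h𝔭, hle⟩ := Ideal.exists_minimalPrimes_le hIp
  have h𝔭' : 𝔭.IsPrime := h𝔭.1.1
  by_contra hlt
  have hlt2 : p.height ≤ 1 := by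
    refine Order.le_of_lt_add_one ?_
    rw [one_add_one_eq_two]
    exact not_le.mp hlt
  rcases hle.eq_or_lt with heq | hlt'
  · exact ht 𝔭 h𝔭 (heq ▸ hlt2) (heq ▸ htp)
  · have h1 := (Ideal.height_add_one_le_of_lt_of_isPrime hlt').trans hlt2
    have h0 : 𝔭.height = 0 := by
      have : 𝔭.height + 1 ≤ 0 + 1 := by simpa using h1
      simpa using (ENat.add_le_add_iff_right (by norm_num)).mp this
    exact hI 𝔭 (Ideal.height_eq_zero_iff.mp h0) h𝔭.1.2

lemma exists_extension_dimLT {m n : ℕ} {R : Type} [CommRing R] [IsNoetherianRing R]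
    [IsReduced R] (hdim : DimLT R (n + 2))
    {e : Matrix ι ι (MvPolynomial (Fin m) R[X])} (he : e * e = e)
    (hge : RkGE e (n + 1)) (hle : RkLE e (n + 1)) :
    ∃ (S : Type) (_ : CommRing S) (_ : Algebra R S), Function.Injective (algebraMap R S) ∧
      Module.Finite R S ∧ NilExt R S ∧
      DimLT (S ⧸ JT (e.map (mapB (Fin m) (algebraMap R S))) (map_mul_self he _)) n := by
  have hJp : ∀ 𝔭 ∈ minimalPrimes R, ¬ JT e he ≤ 𝔭 := fun 𝔭 h𝔭 => by
    have := h𝔭.1.1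
    exact exists_mem_J_of_minimalPrime _ h𝔭
  have hfinP : ({𝔭 | 𝔭 ∈ (JT e he).minimalPrimes ∧ 𝔭.height ≤ 1} ∪ minimalPrimes R).Finite :=
    ((Ideal.finite_minimalPrimes_of_isNoetherianRing R _).subset fun _ h => h.1).union
      (minimalPrimes.finite_of_isNoetherianRing R)
  obtain ⟨S, i1, i2, hinj, hfin, hnil, t, htP, htJ⟩ := exists_extension hfinP
    (by
      rintro 𝔭 (h | h)
      · exact h.1.1.1
      · exact h.1.1)
    (by
      rintro 𝔭 (h | h)
      · exact h.2
      · have := h.1.1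
        rw [Ideal.height_eq_zero_iff.mpr h]
        exact zero_le_one)
    Set.subset_union_right
    (map_mul_self he (MvPolynomial.optionEquivRight R (Fin m)).symm.toRingEquiv.toRingHom)
    (hge.map _) (hle.map _)
  refine ⟨S, i1, i2, hinj, hfin, hnil, ?_⟩
  rw [JT_mapB _ he]
  refine hdim.quotient_of_two_le fun Q hQ hle => ?_
  have hp : (Q.comap (algebraMap R S)).IsPrime := Ideal.comap_isPrime _ _
  exact two_le_height_of_le_comap (t := t) hJp (fun 𝔭 h1 h2 => htP 𝔭 (Or.inl ⟨h1, h2⟩))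
    (fun c hc => hle (algebraMap_mem_J hc)) (hle htJ)

/-- In the critical rank, over a reduced ring. -/
lemma exists_um_of_monic_of_reduced {m n : ℕ} {R : Type} [CommRing R] [IsNoetherianRing R]
    [IsReduced R] (hdim : DimLT R (n + 2)) (hn : 1 ≤ n)
    {e : Matrix ι ι (MvPolynomial (Fin m) R[X])} (he : e * e = e)
    (hge : RkGE e (n + 1)) (hle : RkLE e (n + 1))
    {φ : ι → MvPolynomial (Fin m) R[X]} {f : R[X]} (hf : f.Monic)
    (hfφ : MvPolynomial.C f ∈ Ideal.span (Set.range (φ ᵥ* e)))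
    {U : ι → MvPolynomial (Fin m) R[X]} (hU : e *ᵥ U = U)
    (hUO : ∃ ρ, ρ ⬝ᵥ U - 1 ∈ Ideal.span {MvPolynomial.C X}) :
    ∃ v, e *ᵥ v = v ∧ Um v := by
  obtain ⟨S, _, _, hinj, hfin, ⟨𝔫, k, hn1, hn2⟩, hdimS⟩ := exists_extension_dimLT hdim he hge hle
  haveI : IsNoetherianRing S := IsNoetherianRing.of_finite R S
  refine exists_um_of_nilpotent_extension (algebraMap R S) hinj 𝔫 hn1 k hn2 he
    (hge.mono (by omega)) ?_
  obtain ⟨v, hv, hvu, -⟩ := exists_um_of_quotient (map_mul_self he _) (hf.map (algebraMap R S))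
    (C_mem_span_map _ hfφ) (by rw [map_mulVec_comp, hU]) (exists_sub_one_mem_map _ hUO) le_rfl
    hdimS (hge.map _)
    fun he' h1 h2 φ' f' hf' hφ' U' hU' hUO' => exists_um_of_monic n _ he' h1 h2 hf' hφ' hU' hUO'
  exact ⟨v, hv, hvu⟩

lemma exists_um_of_mapB_mk {σ R : Type} [CommRing R] {𝔫 : Ideal R} (hn : IsNilpotent 𝔫)
    {e : Matrix ι ι (MvPolynomial σ R[X])} (he : e * e = e)
    (h : ∃ w, e.map (mapB σ (Ideal.Quotient.mk 𝔫)) *ᵥ w = w ∧ Um w) :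
    ∃ v, e *ᵥ v = v ∧ Um v := by
  obtain ⟨w, hw, ψ', hψ'⟩ := h
  set g := mapB σ (Ideal.Quotient.mk 𝔫) with hg
  have hgs : Function.Surjective g := mapB_surjective _ Ideal.Quotient.mk_surjective
  choose v0 hv0 using fun i => hgs (w i)
  choose ψ hψ using fun i => hgs (ψ' i)
  refine ⟨e *ᵥ v0, by rw [mulVec_mulVec, he], ?_⟩
  have h1 : g (ψ ⬝ᵥ (e *ᵥ v0) - 1) = 0 := by
    rw [map_sub, map_one, ← comp_dotProduct, ← map_mulVec_comp, show g ∘ v0 = w from funext hv0,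
      show g ∘ ψ = ψ' from funext hψ, hw, hψ', sub_self]
  obtain ⟨k, hk⟩ := hn
  have h2 : IsNilpotent (ψ ⬝ᵥ (e *ᵥ v0) - 1) := by
    refine ⟨k, ?_⟩
    have := Ideal.pow_mem_pow (mem_map_of_mapB_mk_eq_zero h1) k
    rw [← Ideal.map_pow, hk] at this
    simpa using this
  have h3 : IsUnit (ψ ⬝ᵥ (e *ᵥ v0)) := by
    have := h2.isUnit_one_add
    rwa [add_sub_cancel] at this
  obtain ⟨u, hu⟩ := h3
  refine ⟨(↑u⁻¹ : MvPolynomial σ R[X]) • ψ, ?_⟩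
  rw [smul_dotProduct, ← hu, smul_eq_mul, Units.inv_mul]

/-- In the critical rank, for a monic polynomial with constant coefficients. -/
lemma exists_um_of_monic_of_rank_eq {m n : ℕ} {R : Type} [CommRing R] [IsNoetherianRing R]
    (hdim : DimLT R (n + 2)) (hn : 1 ≤ n)
    {e : Matrix ι ι (MvPolynomial (Fin m) R[X])} (he : e * e = e)
    (hge : RkGE e (n + 1)) (hle : RkLE e (n + 1))
    {φ : ι → MvPolynomial (Fin m) R[X]} {f : R[X]} (hf : f.Monic)
    (hfφ : MvPolynomial.C f ∈ Ideal.span (Set.range (φ ᵥ* e)))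
    {U : ι → MvPolynomial (Fin m) R[X]} (hU : e *ᵥ U = U)
    (hUO : ∃ ρ, ρ ⬝ᵥ U - 1 ∈ Ideal.span {MvPolynomial.C X}) :
    ∃ v, e *ᵥ v = v ∧ Um v := by
  refine exists_um_of_mapB_mk (𝔫 := nilradical R) (IsNoetherianRing.isNilpotent_nilradical R) he ?_
  have hred : IsReduced (R ⧸ nilradical R) :=
    (Ideal.isRadical_iff_quotient_reduced _).mp (Ideal.radical_isRadical _)
  set g := Ideal.Quotient.mk (nilradical R)
  have hdim' : DimLT (R ⧸ nilradical R) (n + 2) := dimLT_of_ringKrullDim_le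
    ((ringKrullDim_quotient_le _).trans (DimLT.ringKrullDim_le hdim))
  exact exists_um_of_monic_of_reduced hdim' hn (map_mul_self he _) (hge.map _) (hle.map _)
    (hf.map g) (C_mem_span_map g hfφ) (by rw [map_mulVec_comp, hU]) (exists_sub_one_mem_map g hUO)

end CriticalRank

section MonicInduction

open Polynomial

variable {ι : Type} [Fintype ι] [DecidableEq ι]

lemma map_mem_span_vecMul {A B : Type} [CommRing A] [CommRing B] (h : A →+* B) {e : Matrix ι ι A}
    {φ : ι → A} {f : A} (hf : f ∈ Ideal.span (Set.range (φ ᵥ* e))) :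
    h f ∈ Ideal.span (Set.range ((h ∘ φ) ᵥ* e.map h)) := by
  obtain ⟨ψ, hψ⟩ := mem_span_range.mp hf
  exact mem_span_range.mpr ⟨h ∘ ψ, by rw [map_vecMul_comp, comp_dotProduct, hψ]⟩

lemma exists_sub_one_mem_of_map {A B : Type} [CommRing A] [CommRing B] (h : A →+* B)
    {U : ι → A} {x : A} {y : B} (hxy : h x ∈ Ideal.span {y})
    (hU : ∃ ρ, ρ ⬝ᵥ U - 1 ∈ Ideal.span {x}) :
    ∃ ρ, ρ ⬝ᵥ (h ∘ U) - 1 ∈ Ideal.span {y} := by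
  obtain ⟨ρ, hρ⟩ := hU
  obtain ⟨c, hc⟩ := Ideal.mem_span_singleton'.mp hρ
  refine ⟨h ∘ ρ, ?_⟩
  rw [comp_dotProduct, ← map_one h, ← map_sub, ← hc, map_mul]
  exact Ideal.mul_mem_left _ _ hxy

lemma exists_lift_um {A B : Type} [CommRing A] [CommRing B] (β : A →+* B)
    (hβ : Function.Surjective β) {e : Matrix ι ι A} (he : e * e = e)
    (h : ∃ v, e.map β *ᵥ v = v ∧ Um v) :
    ∃ U, e *ᵥ U = U ∧ ∃ ρ, ρ ⬝ᵥ U - 1 ∈ RingHom.ker β := by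
  obtain ⟨v, hv, ψ, hψ⟩ := h
  choose u hu using fun i => hβ (v i)
  choose ρ hρ using fun i => hβ (ψ i)
  refine ⟨e *ᵥ u, by rw [mulVec_mulVec, he], ρ, ?_⟩
  rw [RingHom.mem_ker, map_sub, map_one, ← comp_dotProduct, ← map_mulVec_comp,
    show β ∘ u = v from funext hu, show β ∘ ρ = ψ from funext hρ, hv, hψ, sub_self]

lemma exists_forall_monic_eval₂ {A B : Type} [CommRing A] [CommRing B] {f : A[X]} (hf : f.Monic)
    (μ : A →+* B[X]) :
    ∃ r₀ : ℕ, ∀ r ≥ r₀, ∀ y : B, (f.eval₂ μ (X ^ r + C y)).Monic := by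
  rcases subsingleton_or_nontrivial B with hB | hB
  · exact ⟨0, fun r _ y => Subsingleton.elim _ _⟩
  refine ⟨(Finset.range f.natDegree).sup (fun i => (μ (f.coeff i)).natDegree) + 1,
    fun r hr y => ?_⟩
  set x : B[X] := X ^ r + C y
  have hr0 : r ≠ 0 := by omega
  have hx : x.Monic := monic_X_pow_add_C y hr0
  have hxd : ∀ i, (x ^ i).natDegree = i * r := fun i => by
    rw [hx.natDegree_pow, natDegree_X_pow_add_C]
  rw [eval₂_eq_sum_range, Finset.sum_range_succ, hf.coeff_natDegree, map_one, one_mul, add_comm]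
  refine (hx.pow _).add_of_left ?_
  refine (degree_sum_le _ _).trans_lt ?_
  rw [Finset.sup_lt_iff (by
    rw [degree_eq_natDegree (hx.pow _).ne_zero]; exact WithBot.bot_lt_coe _)]
  intro i hi
  have hi' := Finset.mem_range.mp hi
  have h1 : (μ (f.coeff i)).natDegree < r := lt_of_le_of_lt
    (Finset.le_sup (f := fun i => (μ (f.coeff i)).natDegree) hi) (by omega)
  rw [degree_eq_natDegree (hx.pow _).ne_zero, hxd]
  refine degree_le_natDegree.trans_lt (Nat.cast_lt.mpr ?_)
  refine natDegree_mul_le.trans_lt ?_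
  rw [hxd]
  calc _ < r + i * r := by omega
    _ = (i + 1) * r := by ring
    _ ≤ f.natDegree * r := Nat.mul_le_mul_right r hi'

lemma exists_unimodular_mod_X {A A' B : Type} [CommRing A] [CommRing A'] [CommRing B]
    (s : A →+* A'[X]) (ν : A' →+* B) (y : B) {r : ℕ} (hr : r ≠ 0) {e : Matrix ι ι A[X]}
    (he : e * e = e)
    (h : ∃ w, e.map (mapRingHom ((evalRingHom 0).comp s)) *ᵥ w = w ∧ Um w) :
    ∃ W, e.map (eval₂RingHom ((mapRingHom ν).comp s) (X ^ r + C y)) *ᵥ W = W ∧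
      ∃ ρ, ρ ⬝ᵥ W - 1 ∈ Ideal.span {(X : B[X])} := by
  obtain ⟨w, hw, hwu⟩ := h
  set ξ : A'[X] →+* B := eval₂RingHom ν y
  have hcomp : (evalRingHom 0).comp (eval₂RingHom ((mapRingHom ν).comp s) (X ^ r + C y)) =
      ξ.comp (mapRingHom ((evalRingHom 0).comp s)) := by
    refine Polynomial.ringHom_ext (fun a => ?_) ?_
    · simp only [RingHom.comp_apply, coe_eval₂RingHom, eval₂_C, coe_mapRingHom, coe_evalRingHom,
        Polynomial.map_C, ξ]
      rw [← coeff_zero_eq_eval_zero, ← coeff_zero_eq_eval_zero, coeff_map]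
    · simp [ξ, hr]
  have hcompe : (e.map (eval₂RingHom ((mapRingHom ν).comp s) (X ^ r + C y))).map (evalRingHom 0) =
      (e.map (mapRingHom ((evalRingHom 0).comp s))).map ξ := by
    ext1 i j
    exact congrArg (fun f => f (e i j)) hcomp
  obtain ⟨W, hW, ρ, hρ⟩ := exists_lift_um (evalRingHom (0 : B)) (fun b => ⟨C b, by simp⟩)
    (map_mul_self he (eval₂RingHom ((mapRingHom ν).comp s) (X ^ r + C y)))
    ⟨ξ ∘ w, by rw [hcompe, map_mulVec_comp, hw], hwu.map ξ⟩
  refine ⟨W, hW, ρ, Ideal.mem_span_singleton.mpr ?_⟩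
  rw [X_dvd_iff, coeff_zero_eq_eval_zero]
  exact hρ

lemma finSuccEquiv_map {R L : Type} [CommRing R] [CommRing L] (j : R →+* L) (m : ℕ) :
    (MvPolynomial.finSuccEquiv L m).toRingEquiv.toRingHom.comp (MvPolynomial.map j) =
      (mapRingHom (MvPolynomial.map j)).comp
        (MvPolynomial.finSuccEquiv R m).toRingEquiv.toRingHom := by
  refine MvPolynomial.ringHom_ext (fun r => ?_) fun i => ?_
  · change MvPolynomial.finSuccEquiv L m (MvPolynomial.map j (MvPolynomial.C r)) =
      (MvPolynomial.finSuccEquiv R m (MvPolynomial.C r)).map (MvPolynomial.map j)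
    rw [MvPolynomial.map_C, MvPolynomial.finSuccEquiv_apply, MvPolynomial.finSuccEquiv_apply,
      MvPolynomial.eval₂Hom_C, MvPolynomial.eval₂Hom_C, RingHom.comp_apply, RingHom.comp_apply,
      Polynomial.map_C, MvPolynomial.map_C]
  · change MvPolynomial.finSuccEquiv L m (MvPolynomial.map j (MvPolynomial.X i)) =
      (MvPolynomial.finSuccEquiv R m (MvPolynomial.X i)).map (MvPolynomial.map j)
    rw [MvPolynomial.map_X]
    refine Fin.cases ?_ (fun i => ?_) i
    · rw [MvPolynomial.finSuccEquiv_X_zero, MvPolynomial.finSuccEquiv_X_zero, Polynomial.map_X]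
    · rw [MvPolynomial.finSuccEquiv_X_succ, MvPolynomial.finSuccEquiv_X_succ, Polynomial.map_C,
        MvPolynomial.map_X]

/-- The change of variables `T ↦ T + X₀ ^ r`. -/
noncomputable def shift (R : Type) [CommRing R] (m r : ℕ) :
    (MvPolynomial (Fin (m + 1)) R)[X] →+* MvPolynomial (Fin (m + 1)) R[X] :=
  eval₂RingHom (MvPolynomial.map C) (MvPolynomial.C X + MvPolynomial.X 0 ^ r)

lemma shift_bijective (R : Type) [CommRing R] (m r : ℕ) : Function.Bijective (shift R m r) := by
  set χ := chi (R := R) (0 : Fin (m + 1) → R[X])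
  set τ := algEquivAevalXAddC (MvPolynomial.X 0 ^ r : MvPolynomial (Fin (m + 1)) R)
  have hC : ∀ a : MvPolynomial (Fin (m + 1)) R, χ (MvPolynomial.map C a) = C a := by
    intro a
    have : χ.toRingEquiv.toRingHom.comp (MvPolynomial.map C) = C := by
      refine MvPolynomial.ringHom_ext (fun r => ?_) fun i => ?_
      · change χ (MvPolynomial.map C (MvPolynomial.C r)) = C (MvPolynomial.C r)
        rw [MvPolynomial.map_C, chi_C, Polynomial.map_C]
      · change χ (MvPolynomial.map C (MvPolynomial.X i)) = C (MvPolynomial.X i)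
        rw [MvPolynomial.map_X, chi_X, Pi.zero_apply, Polynomial.map_zero, add_zero]
    exact congrArg (fun f => f a) this
  have : (shift R m r : _ → _) = χ.symm ∘ τ := by
    have h : χ.toRingEquiv.toRingHom.comp (shift R m r) = τ.toRingEquiv.toRingHom := by
      refine Polynomial.ringHom_ext (fun a => ?_) ?_
      · change χ (eval₂ (MvPolynomial.map C) _ (C a)) = τ (C a)
        rw [eval₂_C, hC]
        exact (τ.commutes a).symm
      · change χ (eval₂ (MvPolynomial.map C) _ X) = τ X
        rw [eval₂_X, map_add, map_pow, chi_C_X, ← MvPolynomial.map_X (σ := Fin (m + 1)) C, hC]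
        simp [τ, algEquivAevalXAddC]
    funext x
    rw [Function.comp_apply, AlgEquiv.eq_symm_apply]
    exact congrArg (fun f => f x) h
  rw [this]
  exact χ.symm.bijective.comp τ.bijective

lemma eval_shift (R : Type) [CommRing R] (m r : ℕ) :
    ((MvPolynomial.finSuccEquiv R m).toRingEquiv.toRingHom.comp
      (MvPolynomial.map (evalRingHom (0 : R)))).comp (shift R m r) =
      eval₂RingHom (MvPolynomial.finSuccEquiv R m).toRingEquiv.toRingHom (X ^ r + C 0) := by
  refine Polynomial.ringHom_ext (fun a => ?_) ?_
  · change MvPolynomial.finSuccEquiv R m (MvPolynomial.map _ (eval₂ (MvPolynomial.map C) _ (C a))) =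
      eval₂ _ _ (C a)
    rw [eval₂_C, eval₂_C, MvPolynomial.map_map]
    have : (evalRingHom (0 : R)).comp C = RingHom.id R := by ext; simp
    rw [this, MvPolynomial.map_id]
    rfl
  · change MvPolynomial.finSuccEquiv R m (MvPolynomial.map _ (eval₂ (MvPolynomial.map C) _ X)) =
      eval₂ _ _ X
    rw [eval₂_X, eval₂_X, map_add, map_pow, MvPolynomial.map_C, MvPolynomial.map_X, map_add,
      map_pow, MvPolynomial.finSuccEquiv_X_zero]
    simp [add_comm]

lemma localize_shift (R : Type) [CommRing R] (m r : ℕ) {L : Type} [CommRing L] (j : R[X] →+* L) :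
    ((MvPolynomial.finSuccEquiv L m).toRingEquiv.toRingHom.comp
      (MvPolynomial.map j)).comp (shift R m r) =
      eval₂RingHom ((mapRingHom (MvPolynomial.map (j.comp C))).comp
        (MvPolynomial.finSuccEquiv R m).toRingEquiv.toRingHom)
        (X ^ r + C (MvPolynomial.C (j X))) := by
  refine Polynomial.ringHom_ext (fun a => ?_) ?_
  · change MvPolynomial.finSuccEquiv L m (MvPolynomial.map _ (eval₂ (MvPolynomial.map C) _ (C a))) =
      eval₂ _ _ (C a)
    rw [eval₂_C, eval₂_C, MvPolynomial.map_map]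
    exact congrArg (fun f => f a) (finSuccEquiv_map (j.comp C) m)
  · change MvPolynomial.finSuccEquiv L m (MvPolynomial.map _ (eval₂ (MvPolynomial.map C) _ X)) =
      eval₂ _ _ X
    rw [eval₂_X, eval₂_X, map_add, map_pow, MvPolynomial.map_C, MvPolynomial.map_X, map_add,
      map_pow, MvPolynomial.finSuccEquiv_X_zero, add_comm]
    congr 1
    rw [MvPolynomial.finSuccEquiv_apply, MvPolynomial.eval₂Hom_C]
    rfl

end MonicInduction

section MainInduction

open Polynomial

variable {ι : Type} [Fintype ι] [DecidableEq ι]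

/-- For idempotent matrices of rank `n + 1` over `A[X]`, a unimodular element modulo `X` together
with a monic polynomial in the content ideal gives a unimodular element. -/
def LiftsUm (ι : Type) [Fintype ι] [DecidableEq ι] (n : ℕ) (A : Type) [CommRing A] : Prop :=
  ∀ e : Matrix ι ι A[X], e * e = e → RkGE e (n + 1) → RkLE e (n + 1) →
    ∀ (φ : ι → A[X]) (f : A[X]), f.Monic → f ∈ Ideal.span (Set.range (φ ᵥ* e)) →
      ∀ U, e *ᵥ U = U → (∃ ρ, ρ ⬝ᵥ U - 1 ∈ Ideal.span {(X : A[X])}) →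
        ∃ v, e *ᵥ v = v ∧ Um v

lemma exists_unimodular_shift_mod_X {n m r : ℕ} {R : Type} [CommRing R] (hr : r ≠ 0)
    (hlift : LiftsUm ι n (MvPolynomial (Fin m) R))
    {e : Matrix ι ι (MvPolynomial (Fin (m + 1)) R)[X]} (he : e * e = e)
    (hge : RkGE e (n + 1)) (hle : RkLE e (n + 1)) {φ : ι → (MvPolynomial (Fin (m + 1)) R)[X]}
    {f : (MvPolynomial (Fin (m + 1)) R)[X]}
    (hf : (f.eval₂ (MvPolynomial.finSuccEquiv R m).toRingEquiv.toRingHom (X ^ r + C 0)).Monic)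
    (hfφ : f ∈ Ideal.span (Set.range (φ ᵥ* e)))
    {U : ι → (MvPolynomial (Fin (m + 1)) R)[X]} (hU : e *ᵥ U = U)
    (hUO : ∃ ρ, ρ ⬝ᵥ U - 1 ∈ Ideal.span {(X : (MvPolynomial (Fin (m + 1)) R)[X])}) :
    ∃ U', e.map (shift R m r) *ᵥ U' = U' ∧
      ∃ ρ, ρ ⬝ᵥ U' - 1 ∈ Ideal.span {(MvPolynomial.C X : MvPolynomial (Fin (m + 1)) R[X])} := by
  set α := eval₂RingHom (MvPolynomial.finSuccEquiv R m).toRingEquiv.toRingHom (X ^ r + C 0) with hα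
  set β := (MvPolynomial.finSuccEquiv R m).toRingEquiv.toRingHom.comp
      (MvPolynomial.map (σ := Fin (m + 1)) (evalRingHom (0 : R))) with hβ
  have hβα : β.comp (shift R m r) = α := eval_shift R m r
  have hv : ∃ v, e.map α *ᵥ v = v ∧ Um v := by
    refine hlift (e.map α) (map_mul_self he α) (hge.map α) (hle.map α) (α ∘ φ) (α f) hf
      (map_mem_span_vecMul α hfφ) (α ∘ U) (by rw [map_mulVec_comp, hU]) ?_
    refine exists_sub_one_mem_of_map α ?_ hUO
    rw [Ideal.mem_span_singleton, hα, coe_eval₂RingHom, eval₂_X, map_zero, add_zero]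
    exact dvd_pow_self X hr
  have hβs : Function.Surjective β := by
    refine (MvPolynomial.finSuccEquiv R m).surjective.comp
      (MvPolynomial.map_surjective _ fun a => ⟨C a, by simp⟩)
  have hmap : (e.map (shift R m r)).map β = e.map α := by
    rw [← hβα]
    rfl
  obtain ⟨U', hU', ρ, hρ⟩ := exists_lift_um β hβs (map_mul_self he (shift R m r))
    (by rw [hmap]; exact hv)
  refine ⟨U', hU', ρ, ?_⟩
  have h0 : MvPolynomial.map (evalRingHom (0 : R)) (ρ ⬝ᵥ U' - 1) = 0 :=
    (MvPolynomial.finSuccEquiv R m).injective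
      ((RingHom.mem_ker.1 hρ : _).trans (map_zero (MvPolynomial.finSuccEquiv R m)).symm)
  have h1 := map_eval_zero_sub_mem (ρ ⬝ᵥ U' - 1)
  rwa [h0, map_zero, sub_zero] at h1

lemma exists_monic_mem_content_shift {n m r : ℕ} {R : Type} [CommRing R] [IsNoetherianRing R]
    (hr : r ≠ 0) {L : Type} [CommRing L] [Algebra R[X] L] [IsLocalization (monics R) L]
    (hliftR : LiftsUm ι n (MvPolynomial (Fin m) R))
    (hliftL : LiftsUm ι n (MvPolynomial (Fin m) L))
    {e : Matrix ι ι (MvPolynomial (Fin (m + 1)) R)[X]} (he : e * e = e)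
    (hge : RkGE e (n + 1)) (hle : RkLE e (n + 1)) {φ : ι → (MvPolynomial (Fin (m + 1)) R)[X]}
    {f : (MvPolynomial (Fin (m + 1)) R)[X]} (hf : f.Monic)
    (hfr : (f.eval₂ ((mapRingHom (MvPolynomial.map ((algebraMap R[X] L).comp C))).comp
      (MvPolynomial.finSuccEquiv R m).toRingEquiv.toRingHom)
        (X ^ r + C (MvPolynomial.C (algebraMap R[X] L X)))).Monic)
    (hfφ : f ∈ Ideal.span (Set.range (φ ᵥ* e)))
    {U : ι → (MvPolynomial (Fin (m + 1)) R)[X]} (hU : e *ᵥ U = U)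
    (hUO : ∃ ρ, ρ ⬝ᵥ U - 1 ∈ Ideal.span {(X : (MvPolynomial (Fin (m + 1)) R)[X])}) :
    ∃ (g : R[X]) (φ' : ι → MvPolynomial (Fin (m + 1)) R[X]), g.Monic ∧
      MvPolynomial.C g ∈ Ideal.span (Set.range (φ' ᵥ* e.map (shift R m r))) := by
  set s := (MvPolynomial.finSuccEquiv R m).toRingEquiv.toRingHom with hs
  set δ := mapRingHom ((evalRingHom 0).comp s) with hδ
  have hw : ∃ w, e.map δ *ᵥ w = w ∧ Um w := by
    refine hliftR (e.map δ) (map_mul_self he δ) (hge.map δ) (hle.map δ) (δ ∘ φ) (δ f) (hf.map _)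
      (map_mem_span_vecMul δ hfφ) (δ ∘ U) (by rw [map_mulVec_comp, hU]) ?_
    refine exists_sub_one_mem_of_map δ ?_ hUO
    rw [hδ, coe_mapRingHom, map_X]
    exact Ideal.mem_span_singleton_self X
  obtain ⟨W, hW, hWO⟩ := exists_unimodular_mod_X s
    (MvPolynomial.map ((algebraMap R[X] L).comp C)) (MvPolynomial.C (algebraMap R[X] L X)) hr he hw
  set θ := eval₂RingHom ((mapRingHom (MvPolynomial.map ((algebraMap R[X] L).comp C))).comp s)
    (X ^ r + C (MvPolynomial.C (algebraMap R[X] L X))) with hθ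
  have hls : ((MvPolynomial.finSuccEquiv L m).toRingEquiv.toRingHom.comp
      (MvPolynomial.map (algebraMap R[X] L))).comp (shift R m r) = θ :=
    localize_shift R m r (algebraMap R[X] L)
  obtain ⟨v, hv, hvu⟩ := hliftL (e.map θ) (map_mul_self he θ) (hge.map θ) (hle.map θ) (θ ∘ φ) (θ f)
    hfr (map_mem_span_vecMul θ hfφ) W hW hWO
  have hmap : ((e.map (shift R m r)).map (MvPolynomial.map (algebraMap R[X] L))).map
      (MvPolynomial.finSuccEquiv L m).toRingEquiv.toRingHom = e.map θ := by
    rw [← hls]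
    rfl
  obtain ⟨v', hv', hvu'⟩ := exists_um_of_bijective
    (MvPolynomial.finSuccEquiv L m).toRingEquiv.toRingHom
    (MvPolynomial.finSuccEquiv L m).bijective (by rw [hmap]; exact ⟨v, hv, hvu⟩)
  obtain ⟨g, hg, φ', v0, h⟩ := exists_mem_content_of_um (monics R) hv' hvu'
  exact ⟨g, φ', hg, mem_span_range.2 ⟨v0, by rw [dotProduct_comm, vecMul_dotProduct, h]⟩⟩

lemma liftsUm_zero {n : ℕ} (hn : 1 ≤ n) {R : Type} [CommRing R] [IsNoetherianRing R]
    (hdim : DimLT R (n + 2)) : LiftsUm ι n (MvPolynomial (Fin 0) R) := by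
  intro e he hge hle φ f hf hfφ U hU hUO
  set χ := (chi (R := R) (0 : Fin 0 → R[X])).symm.toRingEquiv.toRingHom with hχ
  have hbij : Function.Bijective χ := (chi (R := R) (0 : Fin 0 → R[X])).symm.bijective
  set f0 := f.map (MvPolynomial.isEmptyAlgEquiv R (Fin 0)).toRingEquiv.toRingHom
  have hf0 : χ f = MvPolynomial.C f0 := by
    refine (AlgEquiv.symm_apply_eq _).2 ?_
    rw [chi_C, Polynomial.map_map]
    have : (MvPolynomial.C (σ := Fin 0)).comp
        (MvPolynomial.isEmptyAlgEquiv R (Fin 0)).toRingEquiv.toRingHom = RingHom.id _ := by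
      refine RingHom.ext fun a => ?_
      exact (MvPolynomial.isEmptyAlgEquiv R (Fin 0)).symm_apply_apply a
    rw [this, Polynomial.map_id]
  have hX : χ X = MvPolynomial.C X := by
    refine (AlgEquiv.symm_apply_eq _).2 ?_
    rw [chi_C_X]
  refine exists_um_of_bijective χ hbij ?_
  refine exists_um_of_monic_of_rank_eq hdim hn (map_mul_self he χ) (hge.map χ) (hle.map χ)
    (hf.map _ : f0.Monic) (φ := χ ∘ φ) (hf0 ▸ map_mem_span_vecMul χ hfφ) (U := χ ∘ U)
    (by rw [map_mulVec_comp, hU]) ?_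
  refine exists_sub_one_mem_of_map χ ?_ hUO
  rw [hX]
  exact Ideal.mem_span_singleton_self _

lemma liftsUm_succ {n m : ℕ} (hn : 1 ≤ n) {R : Type} [CommRing R] [IsNoetherianRing R]
    (hdim : DimLT R (n + 2)) {L : Type} [CommRing L] [Algebra R[X] L] [IsLocalization (monics R) L]
    (hliftR : LiftsUm ι n (MvPolynomial (Fin m) R))
    (hliftL : LiftsUm ι n (MvPolynomial (Fin m) L)) :
    LiftsUm ι n (MvPolynomial (Fin (m + 1)) R) := by
  intro e he hge hle φ f hf hfφ U hU hUO
  obtain ⟨r₁, h₁⟩ := exists_forall_monic_eval₂ hf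
    (MvPolynomial.finSuccEquiv R m).toRingEquiv.toRingHom
  obtain ⟨r₂, h₂⟩ := exists_forall_monic_eval₂ hf
    ((mapRingHom (MvPolynomial.map ((algebraMap R[X] L).comp C))).comp
      (MvPolynomial.finSuccEquiv R m).toRingEquiv.toRingHom)
  set r := max r₁ r₂ + 1 with hr
  have hr0 : r ≠ 0 := by omega
  obtain ⟨U', hU', hUO'⟩ := exists_unimodular_shift_mod_X hr0 hliftR he hge hle
    (h₁ r (by omega) 0) hfφ hU hUO
  obtain ⟨g, φ', hg, hgφ⟩ := exists_monic_mem_content_shift (L := L) hr0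
    hliftR hliftL he hge hle hf (h₂ r (by omega) _) hfφ hU hUO
  exact exists_um_of_bijective (shift R m r) (shift_bijective R m r)
    (exists_um_of_monic_of_rank_eq hdim hn (map_mul_self he _) (hge.map _) (hle.map _) hg hgφ hU'
      hUO')

theorem liftsUm {n : ℕ} (hn : 1 ≤ n) (m : ℕ) : ∀ (R : Type) [CommRing R] [IsNoetherianRing R],
    DimLT R (n + 2) → LiftsUm ι n (MvPolynomial (Fin m) R) := by
  induction m with
  | zero => exact fun R _ _ hdim => liftsUm_zero hn hdim
  | succ m ih =>
    intro R _ _ hdim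
    have : IsNoetherianRing (Localization (monics R)) :=
      IsLocalization.isNoetherianRing (monics R) _ inferInstance
    exact liftsUm_succ hn hdim (L := Localization (monics R)) (ih R hdim) (ih _ (hdim.locMonic _))

end MainInduction

section ModuleBridge

variable {ι : Type} [Fintype ι] [DecidableEq ι]
variable {B : Type} [CommRing B] {P : Type} [AddCommGroup P] [Module B P]

lemma linearMap_apply_eq_sum {Q : Type} [AddCommGroup Q] [Module B Q] (g : (ι → B) →ₗ[B] Q)
    (x : ι → B) : g x = ∑ i, x i • g (Pi.single i 1) := by
  conv_lhs => rw [← Finset.univ_sum_single x]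
  rw [map_sum]
  refine Finset.sum_congr rfl fun i _ => ?_
  rw [← map_smul, ← Pi.single_smul, smul_eq_mul, mul_one]

lemma rank_map_toMatrix' [Module.Finite B P] [Module.Projective B P] {π : (ι → B) →ₗ[B] P}
    {s : P →ₗ[B] ι → B} (hπs : π ∘ₗ s = LinearMap.id) {n : ℕ}
    (hrank : ∀ (𝔭 : Ideal B) [𝔭.IsPrime],
      Module.finrank (Localization.AtPrime 𝔭) (LocalizedModule 𝔭.primeCompl P) = n)
    (F : Type) [Field F] (f : B →+* F) : ((LinearMap.toMatrix' (s ∘ₗ π)).map f).rank = n := by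
  letI := f.toAlgebra
  have hn : Module.finrank F (TensorProduct B F P) = n := by
    have h1 := Module.rankAtStalk_baseChange (R := B) (M := P) (S := F) ⊥
    rw [Module.rankAtStalk_eq_finrank_of_free] at h1
    exact h1.trans (hrank _)
  have hs : Function.Injective (s.baseChange F) := by
    refine Function.LeftInverse.injective (g := π.baseChange F) fun x => ?_
    rw [← LinearMap.comp_apply, ← LinearMap.baseChange_comp, hπs, LinearMap.baseChange_id,
      LinearMap.id_apply]
  have hπ : Function.Surjective (π.baseChange F) := fun x => ⟨s.baseChange F x, by
    rw [← LinearMap.comp_apply, ← LinearMap.baseChange_comp, hπs, LinearMap.baseChange_id,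
      LinearMap.id_apply]⟩
  have hM : (LinearMap.toMatrix' (s ∘ₗ π)).map f =
      LinearMap.toMatrix (Algebra.TensorProduct.basis F (Pi.basisFun B ι))
          (Algebra.TensorProduct.basis F (Pi.basisFun B ι))
        ((s ∘ₗ π).baseChange F) :=
    (LinearMap.toMatrix_baseChange F (s ∘ₗ π) (Pi.basisFun B ι) (Pi.basisFun B ι)).symm
  rw [hM, Matrix.rank_eq_finrank_range_toLin _ (Algebra.TensorProduct.basis F (Pi.basisFun B ι))
    (Algebra.TensorProduct.basis F (Pi.basisFun B ι)), Matrix.toLin_toMatrix,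
        LinearMap.baseChange_comp,
    LinearMap.range_comp, LinearMap.range_eq_top.2 hπ, Submodule.map_top,
    LinearMap.finrank_range_of_inj hs, hn]

lemma exists_dotProduct_mem_of_localizedModule (D : Submonoid B) {π : (ι → B) →ₗ[B] P}
    {s : P →ₗ[B] ι → B} (hπs : π ∘ₗ s = LinearMap.id)
    (h : ∃ (u : LocalizedModule D P) (φ : LocalizedModule D P →ₗ[Localization D] Localization D),
      φ u = 1) : ∃ (c : ι → B) (p : P), c ⬝ᵥ s p ∈ D := by
  obtain ⟨u, φ, hu⟩ := h
  obtain ⟨b, hb⟩ := IsLocalization.exist_integer_multiples_of_finite D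
    fun i => φ (LocalizedModule.mkLinearMap D P (π (Pi.single i 1)))
  choose c hc using hb
  obtain ⟨⟨p, t⟩, hp⟩ := IsLocalizedModule.surj D (LocalizedModule.mkLinearMap D P) u
  set g : P →ₗ[B] Localization D := (φ.restrictScalars B) ∘ₗ LocalizedModule.mkLinearMap D P
  have hg : ∀ x, algebraMap B (Localization D) (c ⬝ᵥ x) = (b : B) • g (π x) := by
    intro x
    have h1 := linearMap_apply_eq_sum (g ∘ₗ π) x
    rw [LinearMap.comp_apply] at h1
    rw [h1, Finset.smul_sum, dotProduct, map_sum]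
    refine Finset.sum_congr rfl fun i _ => ?_
    rw [map_mul, hc, smul_comm, mul_comm, ← Algebra.smul_def]
    rfl
  have h2 : algebraMap B (Localization D) (c ⬝ᵥ s p) = algebraMap B (Localization D) (b * t) := by
    rw [hg, ← LinearMap.comp_apply π s, hπs, LinearMap.id_apply]
    have h3 : g p = algebraMap B (Localization D) t := by
      change φ (LocalizedModule.mkLinearMap D P p) = _
      rw [← hp]
      change (φ.restrictScalars B) ((t : B) • u) = _
      rw [map_smul]
      change (t : B) • φ u = _
      rw [hu, Algebra.smul_def, mul_one]
    rw [h3, map_mul, Algebra.smul_def]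
  obtain ⟨d, hd⟩ := (IsLocalization.eq_iff_exists D (Localization D)).1 h2
  refine ⟨(d : B) • c, p, ?_⟩
  rw [smul_dotProduct, smul_eq_mul, hd]
  exact D.mul_mem d.2 (D.mul_mem b.2 t.2)

lemma exists_dotProduct_sub_one_mem {I : Ideal B} {π : (ι → B) →ₗ[B] P}
    {s : P →ₗ[B] ι → B} (hπs : π ∘ₗ s = LinearMap.id)
    (h : ∃ (p : P) (φ : P →ₗ[B] B ⧸ I), φ p = 1) :
    ∃ (p : P) (ρ : ι → B), ρ ⬝ᵥ s p - 1 ∈ I := by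
  obtain ⟨p, φ, hp⟩ := h
  choose ρ hρ using fun i => Ideal.Quotient.mk_surjective (φ (π (Pi.single i 1)))
  refine ⟨p, ρ, Ideal.Quotient.eq.1 ?_⟩
  have h1 := linearMap_apply_eq_sum (φ ∘ₗ π) (s p)
  rw [LinearMap.comp_apply, ← LinearMap.comp_apply π s, hπs, LinearMap.id_apply, hp] at h1
  rw [map_one, h1, dotProduct, map_sum]
  refine Finset.sum_congr rfl fun i _ => ?_
  rw [map_mul, hρ, mul_comm]
  rfl

end ModuleBridge

end ProjMat

/-- Let `R` be a commutative Noetherian ring of Krull dimension `n ≥ 3`,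
`A = R[X₁,…,X_m]`, and `P` a finitely generated projective `A[T]`-module of constant
rank `n`.  If `P/TP` contains a unimodular element and `P_f` contains a unimodular
element for some polynomial `f ∈ A[T]` monic in `T`, then `P` contains a unimodular
element. -/
theorem unimodular_of_unimodular_mod_T_and_monic_localization
    (R : Type) [CommRing R] [IsNoetherianRing R] (n m : ℕ) (hn : 3 ≤ n)
    (hdim : ringKrullDim R = n)
    (P : Type) [AddCommGroup P]
    [Module (Polynomial (MvPolynomial (Fin m) R)) P]
    [Module.Finite (Polynomial (MvPolynomial (Fin m) R)) P]
    [Module.Projective (Polynomial (MvPolynomial (Fin m) R)) P]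
    (hrank : ∀ (𝔭 : Ideal (Polynomial (MvPolynomial (Fin m) R))) [𝔭.IsPrime],
      Module.finrank (Localization.AtPrime 𝔭) (LocalizedModule 𝔭.primeCompl P) = n)
    (f : Polynomial (MvPolynomial (Fin m) R)) (hf : f.Monic)
    (hmodT : ∃ (p : P) (φ : P →ₗ[Polynomial (MvPolynomial (Fin m) R)]
        (Polynomial (MvPolynomial (Fin m) R) ⧸
          Ideal.span {(Polynomial.X : Polynomial (MvPolynomial (Fin m) R))})),
      φ p = 1)
    (hloc : ∃ (u : LocalizedModule (Submonoid.powers f) P)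
        (φ : LocalizedModule (Submonoid.powers f) P →ₗ[Localization (Submonoid.powers f)]
          Localization (Submonoid.powers f)), φ u = 1) :
    ∃ (p : P) (φ : P →ₗ[Polynomial (MvPolynomial (Fin m) R)]
        Polynomial (MvPolynomial (Fin m) R)), φ p = 1 := by
  obtain ⟨N, π, hπ⟩ := Module.Finite.exists_fin' (Polynomial (MvPolynomial (Fin m) R)) P
  obtain ⟨s, hπs⟩ := Module.projective_lifting_property π LinearMap.id hπ
  obtain ⟨k, rfl⟩ : ∃ k, n = k + 1 := ⟨n - 1, by omega⟩
  obtain ⟨c, q, K, hK⟩ :=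
    ProjMat.exists_dotProduct_mem_of_localizedModule (Submonoid.powers f) hπs hloc
  obtain ⟨p, hp⟩ := ProjMat.exists_dotProduct_sub_one_mem hπs hmodT
  have hmul : ∀ x, LinearMap.toMatrix' (s ∘ₗ π) *ᵥ x = s (π x) := fun x => by
    rw [← Matrix.toLin'_apply, Matrix.toLin'_toMatrix', LinearMap.comp_apply]
  have hfix : ∀ x, π (s x) = x := fun x => by
    rw [← LinearMap.comp_apply π s, hπs, LinearMap.id_apply]
  have he : LinearMap.toMatrix' (s ∘ₗ π) * LinearMap.toMatrix' (s ∘ₗ π) =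
      LinearMap.toMatrix' (s ∘ₗ π) := by
    rw [← LinearMap.toMatrix'_comp, LinearMap.comp_assoc, ← LinearMap.comp_assoc π s π, hπs,
      LinearMap.id_comp]
  obtain ⟨v, hv, ψ, hψ⟩ := ProjMat.liftsUm (by omega : 1 ≤ k) m R
    (ProjMat.dimLT_of_ringKrullDim_le hdim.le) (LinearMap.toMatrix' (s ∘ₗ π)) he
    (fun F _ g => (ProjMat.rank_map_toMatrix' hπs hrank F g).ge)
    (fun F _ g => (ProjMat.rank_map_toMatrix' hπs hrank F g).le) c (f ^ K) (hf.pow K)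
    (ProjMat.mem_span_range.2 ⟨s q, by
      rw [dotProduct_comm, ProjMat.vecMul_dotProduct, hmul, hfix]; exact hK.symm⟩)
    (s p) (by rw [hmul, hfix]) hp
  refine ⟨π v, (∑ i, ψ i • LinearMap.proj i) ∘ₗ s, ?_⟩
  rw [LinearMap.comp_apply, ← hmul, hv, LinearMap.sum_apply]
  exact hψ
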